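/- For 1 < p, p₁, p₂ < ∞ with 1/p = 1/p₁ + 1/p₂, if m(ξ,η) is a smooth function on ℝ^d × ℝ^d \ {(0,0)} satisfying |∂^α_{ξ,η} m(ξ,η)| ≤ C_α (|ξ|+|η|)^{-|α|} for all multi-indices α, then the bilinear operator T(f,g) = ℱ^{-1}[∫_{ℝ^d} m(ξ-η, η) f̂(ξ-η) ĝ(η) dη] satisfies ‖T(f,g)‖_{L^p} ≤ C ‖f‖_{L^{p₁}} ‖g‖_{L^{p₂}}. -/

import Mathlib

open MeasureTheory
open scoped FourierTransform ENNReal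
noncomputable section

namespace CoifmanMeyer

/-- Euclidean space `ℝ^d`. -/
abbrev Rd (d : ℕ) := EuclideanSpace ℝ (Fin d)

variable {d : ℕ}

/-- The integer label of the dyadic cube of side `2^(-n)` containing `x`. -/
def dyadicIndex (n : ℤ) (x : Rd d) : Fin d → ℤ := fun i => ⌊(2 : ℝ) ^ n * x i⌋

/-- The dyadic cube of side `2^(-n)` with label `k`. -/
def dyadicCube (n : ℤ) (k : Fin d → ℤ) : Set (Rd d) := dyadicIndex n ⁻¹' {k}

/-- The lower corner of a dyadic cube. -/
def dyadicCorner (n : ℤ) (k : Fin d → ℤ) : Rd d :=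
  WithLp.toLp 2 fun i => (2 : ℝ) ^ (-n) * k i

lemma mem_dyadicCube {n : ℤ} {k : Fin d → ℤ} {x : Rd d} :
    x ∈ dyadicCube n k ↔ dyadicIndex n x = k := Iff.rfl

lemma measurableSet_dyadicCube (n : ℤ) (k : Fin d → ℤ) : MeasurableSet (dyadicCube n k) := by
  have : Measurable (dyadicIndex (d := d) n) := by
    unfold dyadicIndex
    refine measurable_pi_lambda _ fun i => Int.measurable_floor.comp ?_
    fun_prop
  exact this (measurableSet_singleton k)

lemma dyadicCube_eq_preimage (n : ℤ) (k : Fin d → ℤ) :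
    dyadicCube n k = (WithLp.ofLp : Rd d → (Fin d → ℝ)) ⁻¹'
      Set.pi Set.univ fun i => Set.Ico ((2 : ℝ) ^ (-n) * k i) ((2 : ℝ) ^ (-n) * (k i + 1)) := by
  ext x
  have h2 : (0 : ℝ) < 2 ^ n := by positivity
  simp only [mem_dyadicCube, dyadicIndex, funext_iff, Set.mem_preimage, Set.mem_pi, Set.mem_univ,
    true_imp_iff, Set.mem_Ico, Int.floor_eq_iff, zpow_neg]
  refine forall_congr' fun i => ?_
  rw [inv_mul_le_iff₀ h2, lt_inv_mul_iff₀ h2]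

lemma volume_dyadicCube (n : ℤ) (k : Fin d → ℤ) :
    volume (dyadicCube n k) = ENNReal.ofReal ((2 : ℝ) ^ (-n)) ^ d := by
  rw [dyadicCube_eq_preimage,
    (PiLp.volume_preserving_ofLp (Fin d)).measure_preimage
      (MeasurableSet.univ_pi fun i => measurableSet_Ico).nullMeasurableSet,
    Real.volume_pi_Ico]
  have : ∀ i, (2 : ℝ) ^ (-n) * (k i + 1) - (2 : ℝ) ^ (-n) * k i = 2 ^ (-n) := fun i => by ring
  simp only [this, Finset.prod_const, Finset.card_univ, Fintype.card_fin]

lemma dyadicIndex_eq_of_le {m n : ℤ} (hmn : m ≤ n) {x y : Rd d}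
    (h : dyadicIndex n x = dyadicIndex n y) : dyadicIndex m x = dyadicIndex m y := by
  obtain ⟨j, rfl⟩ := Int.le.dest hmn
  have key : ∀ t : ℝ, ⌊(2 : ℝ) ^ m * t⌋ = ⌊(2 : ℝ) ^ (m + j : ℤ) * t⌋ / ((2 ^ j : ℕ) : ℤ) := by
    intro t
    rw [← Int.natCast_mul_floor_div_cancel (n := 2 ^ j) (by positivity) ((2 : ℝ) ^ m * t),
      zpow_add₀ two_ne_zero, zpow_natCast]
    push_cast
    congr 2
    ring
  funext i
  have := congrFun h i
  simp only [dyadicIndex] at this ⊢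
  rw [key, key, this]

lemma dist_corner_le {n : ℤ} {k : Fin d → ℤ} {x : Rd d} (hx : x ∈ dyadicCube n k) :
    dist x (dyadicCorner n k) ≤ √d * (2 : ℝ) ^ (-n) := by
  rw [dyadicCube_eq_preimage] at hx
  simp only [Set.mem_preimage, Set.mem_pi, Set.mem_univ, true_imp_iff, Set.mem_Ico] at hx
  rw [EuclideanSpace.dist_eq]
  have h2 : (0 : ℝ) < 2 ^ (-n) := by positivity
  have : ∀ i, dist (x i) ((dyadicCorner n k) i) ^ 2 ≤ ((2 : ℝ) ^ (-n)) ^ 2 := by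
    intro i
    have := hx i
    refine pow_le_pow_left₀ dist_nonneg ?_ 2
    rw [Real.dist_eq, abs_le]
    simp only [dyadicCorner]
    constructor <;> nlinarith
  calc √(∑ i, dist (x i) ((dyadicCorner n k) i) ^ 2) ≤ √(∑ i : Fin d, ((2 : ℝ) ^ (-n)) ^ 2) :=
        Real.sqrt_le_sqrt (Finset.sum_le_sum fun i _ => this i)
    _ = √d * (2 : ℝ) ^ (-n) := by
        rw [Finset.sum_const, Finset.card_univ, Fintype.card_fin, nsmul_eq_mul,
          Real.sqrt_mul (by positivity), Real.sqrt_sq h2.le]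

/-- The ratio of the volumes of the doubled circumscribed ball and of a cube. -/
def ballRatio (d : ℕ) : ℝ≥0∞ := ENNReal.ofReal (2 * √d) ^ d * volume (Metric.ball (0 : Rd d) 1)

lemma ballRatio_ne_top : ballRatio d ≠ ⊤ :=
  ENNReal.mul_ne_top (ENNReal.pow_ne_top ENNReal.ofReal_ne_top) measure_ball_lt_top.ne

lemma volume_closedBall_le (n : ℤ) (k k' : Fin d → ℤ) :
    volume (Metric.closedBall (dyadicCorner n k) (2 * (√d * (2 : ℝ) ^ (-n))))
      = ballRatio d * volume (dyadicCube n k') := by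
  rw [Measure.addHaar_closedBall _ _ (by positivity), volume_dyadicCube, ballRatio,
    ← mul_assoc, ENNReal.ofReal_pow (by positivity), ENNReal.ofReal_mul (by positivity)]
  simp only [finrank_euclideanSpace, Fintype.card_fin]
  ring

lemma dyadicCube_subset_closedBall {n : ℤ} {x : Rd d} :
    dyadicCube n (dyadicIndex n x) ⊆ Metric.closedBall x (2 * (√d * (2 : ℝ) ^ (-n))) := by
  intro y hy
  have h1 := dist_corner_le hy
  have h2 := dist_corner_le (x := x) (n := n) (k := dyadicIndex n x) rfl
  rw [Metric.mem_closedBall]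
  linarith [dist_triangle_right y x (dyadicCorner n (dyadicIndex n x))]

lemma volume_dyadicCube_pred (n : ℤ) (k k' : Fin d → ℤ) :
    volume (dyadicCube (n - 1) k) = 2 ^ d * volume (dyadicCube n k') := by
  rw [volume_dyadicCube, volume_dyadicCube, ← mul_pow]
  congr 1
  rw [show (-(n - 1) : ℤ) = 1 + -n by ring, zpow_add₀ two_ne_zero,
    ENNReal.ofReal_mul (by norm_num)]
  simp

lemma volume_dyadicCube_ne_zero (n : ℤ) (k : Fin d → ℤ) : volume (dyadicCube n k) ≠ 0 := by
  rw [volume_dyadicCube]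
  exact pow_ne_zero _ (by simp; positivity)

lemma volume_dyadicCube_ne_top (n : ℤ) (k : Fin d → ℤ) : volume (dyadicCube n k) ≠ ⊤ := by
  rw [volume_dyadicCube]; simp

/-- Calderón–Zygmund stopping cubes of a continuous integrable function. -/
theorem exists_stopping_cubes (hd : 0 < d) {E : Type*} [NormedAddCommGroup E]
    {f : Rd d → E} (hf : Continuous f) (hfi : Integrable f) {a : ℝ} (ha : 0 < a) :
    ∃ S : Set (ℤ × (Fin d → ℤ)),
      S.PairwiseDisjoint (fun Q => dyadicCube Q.1 Q.2) ∧
      (∀ Q ∈ S, ENNReal.ofReal a * volume (dyadicCube Q.1 Q.2)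
        ≤ ∫⁻ x in dyadicCube Q.1 Q.2, ‖f x‖ₑ) ∧
      (∀ Q ∈ S, ∫⁻ x in dyadicCube Q.1 Q.2, ‖f x‖ₑ
        ≤ 2 ^ d * (ENNReal.ofReal a * volume (dyadicCube Q.1 Q.2))) ∧
      ∀ x, (∀ Q ∈ S, x ∉ dyadicCube Q.1 Q.2) → ‖f x‖ ≤ a := by
  set P : ℤ → (Fin d → ℤ) → Prop := fun n k =>
    ENNReal.ofReal a * volume (dyadicCube n k) < ∫⁻ x in dyadicCube n k, ‖f x‖ₑ with hP
  refine ⟨{Q | P Q.1 Q.2 ∧ ∀ m < Q.1, ∀ x ∈ dyadicCube Q.1 Q.2, ¬ P m (dyadicIndex m x)},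
    ?_, fun Q hQ => hQ.1.le, ?_, ?_⟩
  · intro Q hQ R hR hne
    refine Set.disjoint_left.2 fun x hxQ hxR => hne ?_
    have hQ' := mem_dyadicCube.1 hxQ
    have hR' := mem_dyadicCube.1 hxR
    rcases lt_trichotomy Q.1 R.1 with h | h | h
    · exact absurd (hQ' ▸ hQ.1) (hR.2 _ h x hxR)
    · refine Prod.ext h ?_
      rw [← hQ', ← hR', h]
    · exact absurd (hR' ▸ hR.1) (hQ.2 _ h x hxQ)
  · rintro ⟨n, k⟩ ⟨h1, h2⟩
    dsimp only at h1 h2 ⊢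
    have hne : (dyadicCube n k).Nonempty := by
      by_contra h
      exact volume_dyadicCube_ne_zero n k (by simp [Set.not_nonempty_iff_eq_empty.1 h])
    obtain ⟨x, hx⟩ := hne
    have h3 := h2 (n - 1) (by lia) x hx
    simp only [hP, not_lt] at h3
    have hsub : dyadicCube n k ⊆ dyadicCube (n - 1) (dyadicIndex (n - 1) x) := by
      intro y hy
      exact dyadicIndex_eq_of_le (by lia) ((mem_dyadicCube.1 hy).trans (mem_dyadicCube.1 hx).symm)
    calc ∫⁻ x in dyadicCube n k, ‖f x‖ₑ
        ≤ ∫⁻ x in dyadicCube (n - 1) (dyadicIndex (n - 1) x), ‖f x‖ₑ := lintegral_mono_set hsub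
      _ ≤ _ := h3
      _ = _ := by rw [volume_dyadicCube_pred n _ k]; ring
  · intro x hx
    have hnP : ∀ n, ¬ P n (dyadicIndex n x) := by
      by_contra! hcon
      have hbdd : ∃ b : ℤ, ∀ z, P z (dyadicIndex z x) → b ≤ z := by
        set I := ∫⁻ x, ‖f x‖ₑ
        have hI : I ≠ ⊤ := hfi.2.ne
        obtain ⟨N, hN⟩ := pow_unbounded_of_one_lt (I.toReal / a) (one_lt_two (α := ℝ))
        refine ⟨-N, fun z hz => ?_⟩
        by_contra! hlt
        have h1 : ENNReal.ofReal a * volume (dyadicCube z (dyadicIndex z x)) < I :=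
          lt_of_lt_of_le hz (setLIntegral_le_lintegral _ _)
        rw [volume_dyadicCube, ← ENNReal.ofReal_pow (by positivity),
          ← ENNReal.ofReal_mul ha.le, ENNReal.ofReal_lt_iff_lt_toReal (by positivity) hI] at h1
        rw [div_lt_iff₀ ha] at hN
        have h2 : (2 : ℝ) ^ N ≤ (2 : ℝ) ^ (-z) := by
          rw [← zpow_natCast]
          exact zpow_le_zpow_right₀ one_le_two (by lia)
        have h3 : (2 : ℝ) ^ (-z) ≤ ((2 : ℝ) ^ (-z)) ^ d :=
          le_self_pow₀ (le_trans (one_le_pow₀ one_le_two) h2) hd.ne'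
        nlinarith
      obtain ⟨n, hn, hmin⟩ := Int.exists_least_of_bdd hbdd hcon
      refine hx (n, dyadicIndex n x) ⟨hn, fun m hm y hy hPm => ?_⟩ rfl
      have : dyadicIndex m y = dyadicIndex m x := dyadicIndex_eq_of_le hm.le hy
      rw [this] at hPm
      exact absurd (hmin m hPm) (by dsimp only at hm; lia)
    by_contra! hlt
    obtain ⟨b, hab, hb⟩ := exists_between hlt
    have hU : ∀ᶠ y in nhds x, b < ‖f y‖ := hf.norm.continuousAt.eventually (lt_mem_nhds hb)
    obtain ⟨ε, hε, hball⟩ := Metric.eventually_nhds_iff_ball.1 hU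
    obtain ⟨N, hN⟩ := pow_unbounded_of_one_lt (2 * √d / ε) (one_lt_two (α := ℝ))
    have hsub : dyadicCube N (dyadicIndex N x) ⊆ Metric.ball x ε := by
      refine dyadicCube_subset_closedBall.trans (Metric.closedBall_subset_ball ?_)
      rw [zpow_neg, zpow_natCast, ← mul_assoc, ← div_eq_mul_inv, div_lt_iff₀ (by positivity)]
      rw [div_lt_iff₀ hε] at hN
      linarith
    refine hnP N ?_
    calc ENNReal.ofReal a * volume (dyadicCube N (dyadicIndex N x))
        < ENNReal.ofReal b * volume (dyadicCube N (dyadicIndex N x)) := by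
          rw [ENNReal.mul_lt_mul_iff_left (volume_dyadicCube_ne_zero _ _)
            (volume_dyadicCube_ne_top _ _)]
          exact (ENNReal.ofReal_lt_ofReal_iff (ha.trans hab)).2 hab
      _ = ∫⁻ y in dyadicCube N (dyadicIndex N x), ENNReal.ofReal b := by
          rw [setLIntegral_const]
      _ ≤ _ := by
          refine setLIntegral_mono' (measurableSet_dyadicCube _ _) fun y hy => ?_
          rw [← ofReal_norm]
          exact ENNReal.ofReal_le_ofReal (hball y (hsub hy)).le

section CalderonZygmund

variable {E F : Type*} [NormedAddCommGroup E] [NormedSpace ℂ E]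
  [NormedAddCommGroup F] [NormedSpace ℂ F]

lemma enorm_setAverage_mul_le {X : Type*} [MeasurableSpace X] {μ : Measure X} (f : X → E)
    {s : Set X} (h0 : μ s ≠ 0) (ht : μ s ≠ ⊤) :
    ‖⨍ y in s, f y ∂μ‖ₑ * μ s ≤ ∫⁻ y in s, ‖f y‖ₑ ∂μ := by
  rw [setAverage_eq, enorm_smul, Measure.real, enorm_inv (ENNReal.toReal_ne_zero.2 ⟨h0, ht⟩),
    mul_right_comm, Real.enorm_of_nonneg ENNReal.toReal_nonneg, ENNReal.ofReal_toReal ht,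
    ENNReal.inv_mul_cancel h0 ht, one_mul]
  exact enorm_integral_le_lintegral_enorm _

/-- Replacing an integrable function by its averages on disjoint sets. -/
lemma exists_averaged {X ι : Type*} [MeasurableSpace X] {μ : Measure X} [Countable ι]
    {Q : ι → Set X} (hQ : ∀ i, MeasurableSet (Q i)) (hdisj : Pairwise (Function.onFun Disjoint Q))
    (h0 : ∀ i, μ (Q i) ≠ 0) (ht : ∀ i, μ (Q i) ≠ ⊤) {f : X → E} (hf : Integrable f μ) :
    ∃ g : X → E, Integrable g μ ∧ (∀ x, x ∉ ⋃ i, Q i → g x = f x) ∧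
      ∀ i, ∀ x ∈ Q i, g x = ⨍ y in Q i, f y ∂μ := by
  classical
  set g : X → E := fun x => if h : ∃ i, x ∈ Q i then ⨍ y in Q h.choose, f y ∂μ else f x with hg
  have h1 : ∀ x, x ∉ ⋃ i, Q i → g x = f x := by
    intro x hx
    rw [Set.mem_iUnion] at hx
    simp only [hg, dif_neg hx]
  have h2 : ∀ i, ∀ x ∈ Q i, g x = ⨍ y in Q i, f y ∂μ := by
    intro i x hx
    have hex : ∃ i, x ∈ Q i := ⟨i, hx⟩
    simp only [hg, dif_pos hex]
    have : hex.choose = i := by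
      by_contra hne
      exact Set.disjoint_left.1 (hdisj hne) hex.choose_spec hx
    rw [this]
  have hU : MeasurableSet (⋃ i, Q i) := MeasurableSet.iUnion hQ
  refine ⟨g, ⟨?_, ?_⟩, h1, h2⟩
  · rw [← Measure.restrict_univ (μ := μ), ← Set.union_compl_self (⋃ i, Q i),
      aestronglyMeasurable_union_iff, aestronglyMeasurable_iUnion_iff]
    refine ⟨fun i => ?_, ?_⟩
    · exact (aestronglyMeasurable_const (b := ⨍ y in Q i, f y ∂μ)).congr
        ((ae_restrict_iff' (hQ i)).2 (.of_forall fun x hx => (h2 i x hx).symm))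
    · exact hf.1.restrict.congr
        ((ae_restrict_iff' hU.compl).2 (.of_forall fun x hx => (h1 x hx).symm))
  · rw [HasFiniteIntegral, ← lintegral_add_compl _ hU, lintegral_iUnion hQ hdisj]
    refine lt_of_le_of_lt ?_ hf.2
    rw [← lintegral_add_compl (fun x => ‖f x‖ₑ) hU, lintegral_iUnion hQ hdisj]
    refine add_le_add (ENNReal.tsum_le_tsum fun i => ?_) (le_of_eq ?_)
    · rw [setLIntegral_congr_fun (g := fun _ => ‖⨍ y in Q i, f y ∂μ‖ₑ) (hQ i)
        (fun x hx => by simp only [h2 i x hx]), setLIntegral_const]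
      exact enorm_setAverage_mul_le f (h0 i) (ht i)
    · exact setLIntegral_congr_fun hU.compl (fun x hx => by simp only [h1 x hx])

/-- Convolution of a scalar kernel with a vector-valued function. -/
def conv (κ : Rd d → ℂ) (f : Rd d → E) (x : Rd d) : E := ∫ y, κ (x - y) • f y

/-- Continuous, bounded, integrable kernels. -/
structure IsKernel (κ : Rd d → ℂ) : Prop where
  continuous : Continuous κ
  integrable : Integrable κ
  bounded : ∃ M : ℝ, ∀ x, ‖κ x‖ ≤ M

lemma IsKernel.integrable_smul {κ : Rd d → ℂ} (hκ : IsKernel κ) {f : Rd d → E}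
    (hf : Integrable f) (x : Rd d) : Integrable fun y => κ (x - y) • f y := by
  obtain ⟨M, hM⟩ := hκ.bounded
  exact hf.bdd_smul M
    (hκ.continuous.comp (continuous_const.sub continuous_id)).aestronglyMeasurable
    (.of_forall fun y => hM _)

lemma conv_add {κ : Rd d → ℂ} (hκ : IsKernel κ) {f g : Rd d → E} (hf : Integrable f)
    (hg : Integrable g) (x : Rd d) : conv κ (f + g) x = conv κ f x + conv κ g x := by
  simp only [conv, Pi.add_apply, smul_add]
  exact integral_add (hκ.integrable_smul hf x) (hκ.integrable_smul hg x)

/-- The convolution operator with kernel `∑ i, κ i • L i`. -/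
def vecConv {ι : Type*} [Fintype ι] (κ : ι → Rd d → ℂ) (L : ι → E →L[ℂ] F) (f : Rd d → E)
    (x : Rd d) : F := ∑ i, L i (conv (κ i) f x)

lemma enorm_conv_bad_le {ι' : Type*} [Countable ι'] {κ : Rd d → ℂ} (hκ : IsKernel κ)
    {Q : ι' → Set (Rd d)} (hQ : ∀ i, MeasurableSet (Q i))
    (hdisj : Pairwise (Function.onFun Disjoint Q)) (c : ι' → Rd d) {b : Rd d → E}
    (hb : Integrable b) (hb0 : ∀ x, x ∉ ⋃ i, Q i → b x = 0) (hbQ : ∀ i, ∫ y in Q i, b y = 0)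
    (x : Rd d) :
    ‖conv κ b x‖ₑ ≤ ∑' i, ∫⁻ y in Q i, ‖κ (x - y) - κ (x - c i)‖ₑ * ‖b y‖ₑ := by
  have hint := hκ.integrable_smul hb x
  have h1 : conv κ b x = ∑' i, ∫ y in Q i, κ (x - y) • b y := by
    rw [conv, ← integral_iUnion hQ hdisj hint.integrableOn]
    refine (setIntegral_eq_integral_of_forall_compl_eq_zero fun y hy => ?_).symm
    rw [hb0 y hy, smul_zero]
  rw [h1]
  refine (enorm_tsum_le_tsum_enorm).trans (ENNReal.tsum_le_tsum fun i => ?_)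
  have h2 : ∫ y in Q i, κ (x - y) • b y = ∫ y in Q i, (κ (x - y) - κ (x - c i)) • b y := by
    simp only [sub_smul]
    rw [integral_sub (f := fun y => κ (x - y) • b y) hint.integrableOn
      (g := fun y => κ (x - c i) • b y) (hb.smul (κ (x - c i))).integrableOn,
      integral_smul, hbQ i, smul_zero,
      sub_zero]
  rw [h2]
  refine (enorm_integral_le_lintegral_enorm _).trans (le_of_eq ?_)
  simp only [enorm_smul]

/-- The Hörmander condition with constant `A` for a finite family of kernels. -/
def Hormander {ι : Type*} [Fintype ι] (κ : ι → Rd d → ℂ) (A : ℝ) : Prop :=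
  ∀ (c y : Rd d) (R : ℝ), dist y c ≤ R →
    ∑ i, ∫⁻ x in (Metric.closedBall c (2 * R))ᶜ, ‖κ i (x - y) - κ i (x - c)‖ₑ ≤ ENNReal.ofReal A

lemma enorm_vecConv_le {ι : Type*} [Fintype ι] (κ : ι → Rd d → ℂ) {L : ι → E →L[ℂ] F}
    (hL : ∀ i, ‖L i‖ ≤ 1) (f : Rd d → E) (x : Rd d) :
    ‖vecConv κ L f x‖ₑ ≤ ∑ i, ‖conv (κ i) f x‖ₑ := by
  refine (enorm_sum_le _ _).trans (Finset.sum_le_sum fun i _ => ?_)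
  rw [← ofReal_norm, ← ofReal_norm]
  exact ENNReal.ofReal_le_ofReal (((L i).le_opNorm _).trans
    (mul_le_of_le_one_left (norm_nonneg _) (hL i)))

lemma lintegral_vecConv_bad_le {ι ι' : Type*} [Fintype ι] [Countable ι'] {κ : ι → Rd d → ℂ}
    {L : ι → E →L[ℂ] F} (hL : ∀ i, ‖L i‖ ≤ 1) (hκ : ∀ i, IsKernel (κ i)) {A : ℝ}
    (hA : Hormander κ A) {Q : ι' → Set (Rd d)} (hQ : ∀ i, MeasurableSet (Q i))
    (hdisj : Pairwise (Function.onFun Disjoint Q)) {c : ι' → Rd d} {R : ι' → ℝ}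
    (hR : ∀ i, ∀ y ∈ Q i, dist y (c i) ≤ R i) {b : Rd d → E}
    (hb : Integrable b) (hb0 : ∀ x, x ∉ ⋃ i, Q i → b x = 0) (hbQ : ∀ i, ∫ y in Q i, b y = 0) :
    ∫⁻ x in (⋃ i, Metric.closedBall (c i) (2 * R i))ᶜ, ‖vecConv κ L b x‖ₑ
      ≤ ENNReal.ofReal A * ∫⁻ y in ⋃ i, Q i, ‖b y‖ₑ := by
  set U := (⋃ i, Metric.closedBall (c i) (2 * R i))ᶜ
  have hmeas : ∀ (j : ι) (i : ι'), AEMeasurable (fun p : Rd d × Rd d =>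
      ‖κ j (p.1 - p.2) - κ j (p.1 - c i)‖ₑ * ‖b p.2‖ₑ)
      ((volume.restrict U).prod (volume.restrict (Q i))) := by
    intro j i
    have hb' : AEMeasurable (fun p : Rd d × Rd d => ‖b p.2‖ₑ)
        ((volume.restrict U).prod (volume.restrict (Q i))) :=
      (hb.1.restrict.comp_snd).enorm
    refine AEMeasurable.mul ?_ hb'
    · have : Continuous fun p : Rd d × Rd d => κ j (p.1 - p.2) - κ j (p.1 - c i) :=
        ((hκ j).continuous.comp (by fun_prop)).sub ((hκ j).continuous.comp (by fun_prop))
      exact this.enorm.measurable.aemeasurable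
  calc ∫⁻ x in U, ‖vecConv κ L b x‖ₑ
      ≤ ∫⁻ x in U, ∑ j, ∑' i, ∫⁻ y in Q i, ‖κ j (x - y) - κ j (x - c i)‖ₑ * ‖b y‖ₑ :=
        lintegral_mono fun x => (enorm_vecConv_le κ hL b x).trans
          (Finset.sum_le_sum fun j _ => enorm_conv_bad_le (hκ j) hQ hdisj c hb hb0 hbQ x)
    _ = ∑ j, ∑' i, ∫⁻ y in Q i, (∫⁻ x in U, ‖κ j (x - y) - κ j (x - c i)‖ₑ) * ‖b y‖ₑ := by
        rw [lintegral_finsetSum' _ fun j _ => AEMeasurable.tsum fun i =>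
          (hmeas j i).lintegral_prod_right']
        refine Finset.sum_congr rfl fun j _ => ?_
        rw [lintegral_tsum fun i => (hmeas j i).lintegral_prod_right']
        refine tsum_congr fun i => ?_
        rw [lintegral_lintegral_swap (hmeas j i)]
        refine lintegral_congr fun y => ?_
        dsimp only
        refine lintegral_mul_const (f := fun x => ‖κ j (x - y) - κ j (x - c i)‖ₑ) _ ?_
        exact (((hκ j).continuous.comp (by fun_prop)).sub
          ((hκ j).continuous.comp (by fun_prop))).enorm.measurable
    _ = ∑' i, ∫⁻ y in Q i, (∑ j, ∫⁻ x in U, ‖κ j (x - y) - κ j (x - c i)‖ₑ) * ‖b y‖ₑ := by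
        rw [← Summable.tsum_finsetSum fun j _ => ENNReal.summable]
        refine tsum_congr fun i => ?_
        rw [← lintegral_finsetSum']
        · simp only [Finset.sum_mul]
        · intro j _
          refine AEMeasurable.mul ?_ hb.1.restrict.enorm
          have : Continuous fun p : Rd d × Rd d => κ j (p.2 - p.1) - κ j (p.2 - c i) :=
            ((hκ j).continuous.comp (by fun_prop)).sub ((hκ j).continuous.comp (by fun_prop))
          exact (Measurable.lintegral_prod_right' (f := fun p : Rd d × Rd d =>
            ‖κ j (p.2 - p.1) - κ j (p.2 - c i)‖ₑ) this.enorm.measurable).aemeasurable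
    _ ≤ ∑' i, ∫⁻ y in Q i, ENNReal.ofReal A * ‖b y‖ₑ := by
        refine ENNReal.tsum_le_tsum fun i => setLIntegral_mono' (hQ i) fun y hy => ?_
        gcongr
        refine le_trans (Finset.sum_le_sum fun j _ => ?_) (hA (c i) y (R i) (hR i y hy))
        exact lintegral_mono_set (Set.compl_subset_compl.2
          (Set.subset_iUnion (fun i => Metric.closedBall (c i) (2 * R i)) i))
    _ = ENNReal.ofReal A * ∫⁻ y in ⋃ i, Q i, ‖b y‖ₑ := by
        rw [lintegral_iUnion hQ hdisj, ← ENNReal.tsum_mul_left]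
        exact tsum_congr fun i => lintegral_const_mul' _ _ ENNReal.ofReal_ne_top

end CalderonZygmund

section Distribution

variable {E F : Type*} [NormedAddCommGroup E] [NormedSpace ℂ E]
  [NormedAddCommGroup F] [NormedSpace ℂ F]

/-- A weak-type estimate of exponent `q` on functions bounded by the height. -/
def WeakBound {ι : Type*} [Fintype ι] (κ : ι → Rd d → ℂ) (L : ι → E →L[ℂ] F) (q A : ℝ) : Prop :=
  ∀ g : Rd d → E, Integrable g → ∀ a : ℝ, 0 < a → (∀ x, ‖g x‖ ≤ 2 ^ d * a) →
    volume {x | A * a < ‖vecConv κ L g x‖} ≤ ENNReal.ofReal a ^ (-q) * ∫⁻ x, ‖g x‖ₑ ^ q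

/-- The constant in the distributional Calderón–Zygmund inequality. -/
def czConst (d : ℕ) (q : ℝ) : ℝ≥0∞ := 2 * (2 ^ (d * q) + ballRatio d + 2 * 2 ^ d)

lemma czConst_ne_top {q : ℝ} : czConst d q ≠ ⊤ := by
  refine ENNReal.mul_ne_top (by simp) (ENNReal.add_ne_top.2 ⟨ENNReal.add_ne_top.2
    ⟨ENNReal.rpow_ne_top_of_ne_zero two_ne_zero (by simp), ballRatio_ne_top⟩,
    ENNReal.mul_ne_top (by simp) (by simp)⟩)

lemma vecConv_add {ι : Type*} [Fintype ι] {κ : ι → Rd d → ℂ} {L : ι → E →L[ℂ] F}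
    (hκ : ∀ i, IsKernel (κ i)) {f g : Rd d → E} (hf : Integrable f) (hg : Integrable g)
    (x : Rd d) : vecConv κ L (f + g) x = vecConv κ L f x + vecConv κ L g x := by
  simp only [vecConv, conv_add (hκ _) hf hg, map_add, Finset.sum_add_distrib]

lemma enorm_le_of_mul_le {s t : ℝ≥0∞} {e b : ℝ≥0∞} (h0 : s ≠ 0) (ht : s ≠ ⊤)
    (h1 : e * s ≤ t) (h2 : t ≤ b * s) : e ≤ b := by
  have := h1.trans h2
  rwa [ENNReal.mul_le_mul_iff_left h0 ht] at this

lemma measure_le_of_stopping {X F : Type*} [MeasurableSpace X] [NormedAddCommGroup F]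
    {μ : Measure X} {f : X → F}
    (hf : Integrable f μ) (hfm : StronglyMeasurable f) {Ω : Set X} {a : ℝ} (ha : 0 < a)
    (h : ENNReal.ofReal a * μ Ω ≤ ∫⁻ x in Ω, ‖f x‖ₑ ∂μ) :
    μ Ω ≤ 2 * ((ENNReal.ofReal a)⁻¹ * ∫⁻ x in {x | a / 2 < ‖f x‖}, ‖f x‖ₑ ∂μ) := by
  set α := ENNReal.ofReal a with hα
  have hα0 : α ≠ 0 := by simp [hα, ha]
  have hαt : α ≠ ⊤ := ENNReal.ofReal_ne_top
  have hV : μ Ω ≠ ⊤ := by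
    intro hV
    rw [hV, ENNReal.mul_top hα0] at h
    exact ((h.trans (setLIntegral_le_lintegral _ _)).trans_lt hf.2).ne rfl
  set I := ∫⁻ x in {x | a / 2 < ‖f x‖}, ‖f x‖ₑ ∂μ
  have hm : MeasurableSet {x | a / 2 < ‖f x‖} :=
    measurableSet_lt measurable_const hfm.norm.measurable
  have h1 : ∫⁻ x in Ω, ‖f x‖ₑ ∂μ ≤ I + α / 2 * μ Ω := by
    rw [← lintegral_inter_add_sdiff _ Ω hm]
    refine add_le_add (lintegral_mono_set Set.inter_subset_right) ?_
    calc ∫⁻ x in Ω \ {x | a / 2 < ‖f x‖}, ‖f x‖ₑ ∂μ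
        ≤ ∫⁻ x in Ω \ {x | a / 2 < ‖f x‖}, α / 2 ∂μ := by
          refine setLIntegral_mono measurable_const fun x hx => ?_
          have := hx.2
          simp only [Set.mem_ofPred_eq, not_lt] at this
          rw [← ofReal_norm, hα, show (2 : ℝ≥0∞) = ENNReal.ofReal 2 by simp,
            ← ENNReal.ofReal_div_of_pos two_pos]
          exact ENNReal.ofReal_le_ofReal this
      _ ≤ α / 2 * μ Ω := by
          rw [setLIntegral_const]
          gcongr
          exact Set.sdiff_subset
  have h2 : α / 2 * μ Ω + α / 2 * μ Ω ≤ I + α / 2 * μ Ω := by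
    rw [← add_mul, ENNReal.add_halves]
    exact h.trans h1
  have hfin : α / 2 * μ Ω ≠ ⊤ := ENNReal.mul_ne_top (ENNReal.div_ne_top hαt (by simp)) hV
  have h3 : α / 2 * μ Ω ≤ I := by rwa [ENNReal.add_le_add_iff_right hfin] at h2
  calc μ Ω = 2 * (α⁻¹ * (α / 2 * μ Ω)) := by
        rw [ENNReal.div_eq_inv_mul, mul_comm 2⁻¹ α, mul_assoc, ← mul_assoc α⁻¹,
          ENNReal.inv_mul_cancel hα0 hαt, one_mul, ← mul_assoc,
          ENNReal.mul_inv_cancel (by simp) (by simp), one_mul]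
    _ ≤ _ := by gcongr

/-- Calderón–Zygmund: distributional inequality for convolution operators. -/
theorem volume_lt_vecConv_le (hd : 0 < d) [CompleteSpace E] {ι : Type*} [Fintype ι]
    {κ : ι → Rd d → ℂ}
    {L : ι → E →L[ℂ] F} (hL : ∀ i, ‖L i‖ ≤ 1) (hκ : ∀ i, IsKernel (κ i)) {A q : ℝ} (hA0 : 0 < A)
    (hq : 0 ≤ q) (hA : Hormander κ A) (hW : WeakBound κ L q A)
    {f : Rd d → E} (hf : Continuous f) (hfi : Integrable f) {a : ℝ} (ha : 0 < a) :
    volume {x | 2 * A * a < ‖vecConv κ L f x‖} ≤ czConst d q *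
      ((ENNReal.ofReal a)⁻¹ * (∫⁻ x in {x | a / 2 < ‖f x‖}, ‖f x‖ₑ) +
        ENNReal.ofReal a ^ (-q) * ∫⁻ x in {x | ‖f x‖ ≤ a}, ‖f x‖ₑ ^ q) := by
  obtain ⟨S, hSd, hS1, hS2, hS3⟩ := exists_stopping_cubes hd hf hfi ha
  set α := ENNReal.ofReal a with hα
  have hα0 : α ≠ 0 := by simp [hα, ha]
  have hαt : α ≠ ⊤ := ENNReal.ofReal_ne_top
  set Q : S → Set (Rd d) := fun s => dyadicCube s.1.1 s.1.2 with hQdef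
  have hQm : ∀ s, MeasurableSet (Q s) := fun s => measurableSet_dyadicCube _ _
  have hdisj : Pairwise (Function.onFun Disjoint Q) := fun s t hst =>
    hSd s.2 t.2 (fun h => hst (Subtype.ext h))
  have hQ0 : ∀ s, volume (Q s) ≠ 0 := fun s => volume_dyadicCube_ne_zero _ _
  have hQt : ∀ s, volume (Q s) ≠ ⊤ := fun s => volume_dyadicCube_ne_top _ _
  obtain ⟨g, hgi, hg1, hg2⟩ := exists_averaged hQm hdisj hQ0 hQt hfi
  set Ω := ⋃ s, Q s with hΩ
  have hΩm : MeasurableSet Ω := MeasurableSet.iUnion hQm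
  have hvolΩ : volume Ω = ∑' s, volume (Q s) := measure_iUnion hdisj hQm
  have hΩ1 : α * volume Ω ≤ ∫⁻ x in Ω, ‖f x‖ₑ := by
    rw [hvolΩ, lintegral_iUnion hQm hdisj, ← ENNReal.tsum_mul_left]
    exact ENNReal.tsum_le_tsum fun s => hS1 s.1 s.2
  have hΩ2 : ∫⁻ x in Ω, ‖f x‖ₑ ≤ 2 ^ d * α * volume Ω := by
    rw [hvolΩ, lintegral_iUnion hQm hdisj, ← ENNReal.tsum_mul_left]
    refine ENNReal.tsum_le_tsum fun s => ?_
    rw [mul_assoc]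
    exact hS2 s.1 s.2
  have hfΩ : ∀ x, x ∉ Ω → ‖f x‖ ≤ a := fun x hx => hS3 x fun s hs hxs =>
    hx (Set.mem_iUnion.2 ⟨⟨s, hs⟩, hxs⟩)
  have havg : ∀ s, ‖⨍ y in Q s, f y‖ₑ ≤ 2 ^ d * α := fun s =>
    enorm_le_of_mul_le (hQ0 s) (hQt s) (enorm_setAverage_mul_le f (hQ0 s) (hQt s))
      ((hS2 s.1 s.2).trans_eq (mul_assoc _ _ _).symm)
  have hgb : ∀ x, x ∈ Ω → ‖g x‖ₑ ≤ 2 ^ d * α := by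
    intro x hx
    obtain ⟨s, hs⟩ := Set.mem_iUnion.1 hx
    rw [hg2 s x hs]
    exact havg s
  have hgb' : ∀ x, ‖g x‖ ≤ 2 ^ d * a := by
    intro x
    by_cases hx : x ∈ Ω
    · have := hgb x hx
      rw [← ofReal_norm, hα, show (2 : ℝ≥0∞) ^ d = ENNReal.ofReal (2 ^ d) by
        rw [ENNReal.ofReal_pow two_pos.le]; simp, ← ENNReal.ofReal_mul (by positivity)] at this
      exact (ENNReal.ofReal_le_ofReal_iff (by positivity)).1 this
    · rw [hg1 x hx]
      refine (hfΩ x hx).trans ?_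
      exact le_mul_of_one_le_left ha.le (one_le_pow₀ one_le_two)
  -- the good part
  have hgood : volume {x | A * a < ‖vecConv κ L g x‖} ≤
      α ^ (-q) * (∫⁻ x in {x | ‖f x‖ ≤ a}, ‖f x‖ₑ ^ q) + 2 ^ (d * q) * volume Ω := by
    refine (hW g hgi a ha hgb').trans ?_
    rw [← lintegral_add_compl _ hΩm, add_comm, mul_add]
    refine add_le_add ?_ ?_
    · refine mul_le_mul_right ?_ _
      rw [setLIntegral_congr_fun (f := fun x => ‖g x‖ₑ ^ q) (g := fun x => ‖f x‖ₑ ^ q) hΩm.compl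
        fun x hx => by simp only [hg1 x hx]]
      exact lintegral_mono_set fun x hx => hfΩ x hx
    · calc α ^ (-q) * ∫⁻ x in Ω, ‖g x‖ₑ ^ q
          ≤ α ^ (-q) * ∫⁻ x in Ω, (2 ^ d * α) ^ q := by
            refine mul_le_mul_right ?_ _
            exact setLIntegral_mono measurable_const fun x hx =>
              ENNReal.rpow_le_rpow (hgb x hx) hq
        _ = 2 ^ (d * q) * volume Ω := by
            rw [setLIntegral_const, ENNReal.mul_rpow_of_nonneg _ _ hq, ENNReal.rpow_mul,
              ENNReal.rpow_natCast, ENNReal.rpow_neg]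
            rw [mul_comm (_ ^ q) (α ^ q), mul_assoc, ← mul_assoc _ (α ^ q),
              ENNReal.inv_mul_cancel, one_mul]
            · simp [hα0, hαt]
            · simp [hα0, hαt]
  -- the bad part
  set b : Rd d → E := f - g with hb
  have hbi : Integrable b := hfi.sub hgi
  have hb0 : ∀ x, x ∉ Ω → b x = 0 := fun x hx => by simp [hb, hg1 x hx]
  have hbQ : ∀ s, ∫ y in Q s, b y = 0 := by
    intro s
    simp only [hb, Pi.sub_apply]
    rw [integral_sub hfi.integrableOn hgi.integrableOn,
      setIntegral_congr_fun (hQm s) (fun x hx => hg2 s x hx), setIntegral_const,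
      setAverage_eq, smul_smul, Measure.real, mul_inv_cancel₀
      (ENNReal.toReal_ne_zero.2 ⟨hQ0 s, hQt s⟩), one_smul, sub_self]
  have hbn : ∫⁻ y in Ω, ‖b y‖ₑ ≤ 2 * (2 ^ d * α * volume Ω) := by
    calc ∫⁻ y in Ω, ‖b y‖ₑ ≤ ∫⁻ y in Ω, (‖f y‖ₑ + 2 ^ d * α) :=
          setLIntegral_mono' hΩm fun x hx =>
            (enorm_sub_le).trans (add_le_add le_rfl (hgb x hx))
      _ = (∫⁻ y in Ω, ‖f y‖ₑ) + 2 ^ d * α * volume Ω := by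
          rw [lintegral_add_right _ measurable_const, setLIntegral_const]
      _ ≤ _ := by rw [two_mul]; gcongr
  set c : S → Rd d := fun s => dyadicCorner s.1.1 s.1.2
  set R : S → ℝ := fun s => √d * (2 : ℝ) ^ (-s.1.1)
  set B := ⋃ s, Metric.closedBall (c s) (2 * R s) with hBdef
  have hB : volume B ≤ ballRatio d * volume Ω := by
    refine (measure_iUnion_le _).trans ?_
    rw [hvolΩ, ← ENNReal.tsum_mul_left]
    exact ENNReal.tsum_le_tsum fun s => (volume_closedBall_le _ _ _).le
  have hBm : MeasurableSet B := MeasurableSet.iUnion fun s => measurableSet_closedBall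
  have hbadint := lintegral_vecConv_bad_le hL hκ hA hQm hdisj
    (c := c) (R := R) (fun s y hy => dist_corner_le hy) hbi hb0 hbQ
  have hbad : volume {x | A * a < ‖vecConv κ L b x‖} ≤
      ballRatio d * volume Ω + 2 * 2 ^ d * volume Ω := by
    have hsub : {x | A * a < ‖vecConv κ L b x‖} ⊆
        B ∪ {x | x ∈ Bᶜ ∧ ENNReal.ofReal A * α ≤ ‖vecConv κ L b x‖ₑ} := by
      intro x hx
      by_cases hxB : x ∈ B
      · exact Or.inl hxB
      · refine Or.inr ⟨hxB, ?_⟩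
        rw [hα, ← ENNReal.ofReal_mul hA0.le, ← ofReal_norm]
        exact ENNReal.ofReal_le_ofReal (le_of_lt hx)
    refine (measure_mono hsub).trans ((measure_union_le _ _).trans (add_le_add hB ?_))
    have hA0' : ENNReal.ofReal A ≠ 0 := by simp [hA0]
    have h1 : ENNReal.ofReal A * α * volume {x | x ∈ Bᶜ ∧
        ENNReal.ofReal A * α ≤ ‖vecConv κ L b x‖ₑ} ≤ ∫⁻ x in Bᶜ, ‖vecConv κ L b x‖ₑ := by
      have := mul_meas_ge_le_lintegral₀ (μ := volume.restrict Bᶜ)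
        (f := fun x => ‖vecConv κ L b x‖ₑ) ?_ (ENNReal.ofReal A * α)
      · refine le_trans ?_ this
        rw [Measure.restrict_apply' hBm.compl]
        gcongr
        intro x hx
        exact ⟨hx.2, hx.1⟩
      · have : AEStronglyMeasurable (vecConv κ L b) volume := by
          unfold vecConv
          refine Finset.aestronglyMeasurable_fun_sum _ fun i _ =>
            (L i).continuous.comp_aestronglyMeasurable ?_
          unfold conv
          refine AEStronglyMeasurable.integral_prod_right' (μ := volume) (ν := volume)
            (f := fun p : Rd d × Rd d => κ i (p.1 - p.2) • b p.2) ?_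
          exact ((hκ i).continuous.comp (by fun_prop)).aestronglyMeasurable.smul
            hbi.1.comp_snd
        exact this.enorm.restrict
    have h2 := h1.trans (hbadint.trans (mul_le_mul_right hbn _))
    have h3 : ENNReal.ofReal A * α * volume {x | x ∈ Bᶜ ∧
        ENNReal.ofReal A * α ≤ ‖vecConv κ L b x‖ₑ}
        ≤ ENNReal.ofReal A * α * (2 * 2 ^ d * volume Ω) := by
      refine h2.trans_eq ?_
      ring
    rwa [ENNReal.mul_le_mul_iff_right (mul_ne_zero hA0' hα0)
      (ENNReal.mul_ne_top ENNReal.ofReal_ne_top hαt)] at h3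
  have hsum : ∀ x, vecConv κ L f x = vecConv κ L g x + vecConv κ L b x := fun x => by
    rw [← vecConv_add hκ hgi hbi, hb, add_sub_cancel]
  have hsub : {x | 2 * A * a < ‖vecConv κ L f x‖} ⊆
      {x | A * a < ‖vecConv κ L g x‖} ∪ {x | A * a < ‖vecConv κ L b x‖} := by
    intro x hx
    by_contra hcon
    simp only [Set.mem_union, Set.mem_ofPred_eq, not_or, not_lt] at hcon hx
    have := norm_add_le (vecConv κ L g x) (vecConv κ L b x)
    rw [← hsum] at this
    linarith [hcon.1, hcon.2]
  have hV := measure_le_of_stopping hfi hf.stronglyMeasurable ha hΩ1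
  set I := α⁻¹ * ∫⁻ x in {x | a / 2 < ‖f x‖}, ‖f x‖ₑ
  set J := α ^ (-q) * (∫⁻ x in {x | ‖f x‖ ≤ a}, ‖f x‖ₑ ^ q)
  calc volume {x | 2 * A * a < ‖vecConv κ L f x‖}
      ≤ (J + 2 ^ (d * q) * volume Ω) + (ballRatio d * volume Ω + 2 * 2 ^ d * volume Ω) :=
        (measure_mono hsub).trans ((measure_union_le _ _).trans (add_le_add hgood hbad))
    _ = (2 ^ (d * q) + ballRatio d + 2 * 2 ^ d) * volume Ω + J := by ring
    _ ≤ (2 ^ (d * q) + ballRatio d + 2 * 2 ^ d) * (2 * I) + czConst d q * J := by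
        refine add_le_add (mul_le_mul_right hV _) (le_mul_of_one_le_left zero_le ?_)
        unfold czConst
        calc (1 : ℝ≥0∞) ≤ 2 * (2 * 2 ^ d) := by
              have h1 : (1 : ℝ≥0∞) ≤ 2 := by norm_num
              have h2 : (1 : ℝ≥0∞) ≤ 2 ^ d := one_le_pow₀ h1
              calc (1 : ℝ≥0∞) = 1 * (1 * 1) := by simp
                _ ≤ _ := by gcongr
          _ ≤ _ := by gcongr; exact le_add_self
    _ = _ := by unfold czConst; ring

end Distribution

section StrongType

lemma lintegral_Ioi_ite_lt_le {p : ℝ} (hp : 1 < p) {s : ℝ} (hs : 0 ≤ s) :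
    ∫⁻ a in Set.Ioi (0 : ℝ), (if a / 2 < s then ENNReal.ofReal (s * a ^ (p - 2)) else 0)
      ≤ ENNReal.ofReal (2 ^ (p - 1) / (p - 1)) * ENNReal.ofReal (s ^ p) := by
  have hI : IntervalIntegrable (fun a : ℝ => a ^ (p - 2)) volume 0 (2 * s) :=
    intervalIntegral.intervalIntegrable_rpow' (by linarith)
  calc ∫⁻ a in Set.Ioi (0 : ℝ), (if a / 2 < s then ENNReal.ofReal (s * a ^ (p - 2)) else 0)
      = ∫⁻ a in Set.Ioi (0 : ℝ), (Set.Iio (2 * s)).indicator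
          (fun a => ENNReal.ofReal (s * a ^ (p - 2))) a := by
        refine lintegral_congr fun a => ?_
        simp only [Set.indicator, Set.mem_Iio, div_lt_iff₀' (two_pos (α := ℝ))]
    _ = ∫⁻ a in Set.Ioo (0 : ℝ) (2 * s), ENNReal.ofReal (s * a ^ (p - 2)) := by
        rw [lintegral_indicator measurableSet_Iio, Measure.restrict_restrict measurableSet_Iio,
          Set.inter_comm, Set.Ioi_inter_Iio]
    _ ≤ ∫⁻ a in Set.Ioc (0 : ℝ) (2 * s), ENNReal.ofReal (s * a ^ (p - 2)) :=
        lintegral_mono_set Set.Ioo_subset_Ioc_self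
    _ = ENNReal.ofReal (∫ a in (0 : ℝ)..(2 * s), s * a ^ (p - 2)) := by
        rw [intervalIntegral.integral_of_le (by linarith), ofReal_integral_eq_lintegral_ofReal]
        · exact (hI.const_mul s).1
        · refine (ae_restrict_iff' measurableSet_Ioc).2 (.of_forall fun a ha => ?_)
          have := ha.1
          simp only [Pi.zero_apply]
          positivity
    _ = _ := by
        rw [intervalIntegral.integral_const_mul, integral_rpow (Or.inl (by linarith)),
          ← ENNReal.ofReal_mul (by have : 0 < p - 1 := by linarith
                                   positivity)]
        congr 1
        rw [show p - 2 + 1 = p - 1 by ring, Real.zero_rpow (by linarith), sub_zero,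
          Real.mul_rpow two_pos.le hs]
        have : s ^ p = s * s ^ (p - 1) := by
          rcases hs.eq_or_lt with rfl | h
          · rw [Real.zero_rpow (by linarith), zero_mul]
          · rw [← Real.rpow_one_add' hs (by linarith)]; ring_nf
        rw [this]
        ring

lemma lintegral_Ioi_ite_ge_le {p q : ℝ} (hp : 0 < p) (hpq : p < q) {s : ℝ} (hs : 0 ≤ s) :
    ∫⁻ a in Set.Ioi (0 : ℝ), (if s ≤ a then ENNReal.ofReal (s ^ q * a ^ (p - 1 - q)) else 0)
      ≤ ENNReal.ofReal (1 / (q - p)) * ENNReal.ofReal (s ^ p) := by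
  rcases hs.eq_or_lt with rfl | hs
  · simp [Real.zero_rpow (hp.trans hpq).ne']
  have hint := integrableOn_Ioi_rpow_of_lt (a := p - 1 - q) (by linarith) hs
  calc ∫⁻ a in Set.Ioi (0 : ℝ), (if s ≤ a then ENNReal.ofReal (s ^ q * a ^ (p - 1 - q)) else 0)
      = ∫⁻ a in Set.Ioi (0 : ℝ), (Set.Ici s).indicator
          (fun a => ENNReal.ofReal (s ^ q * a ^ (p - 1 - q))) a := by
        refine lintegral_congr fun a => ?_
        simp only [Set.indicator, Set.mem_Ici]
    _ = ∫⁻ a in Set.Ici s, ENNReal.ofReal (s ^ q * a ^ (p - 1 - q)) := by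
        have : Set.Ici s ∩ Set.Ioi 0 = Set.Ici s :=
          Set.inter_eq_left.2 fun a ha => hs.trans_le (Set.mem_Ici.1 ha)
        rw [lintegral_indicator measurableSet_Ici, Measure.restrict_restrict measurableSet_Ici,
          this]
    _ = ∫⁻ a in Set.Ioi s, ENNReal.ofReal (s ^ q * a ^ (p - 1 - q)) := by
        rw [restrict_Ioi_eq_restrict_Ici]
    _ = ENNReal.ofReal (∫ a in Set.Ioi s, s ^ q * a ^ (p - 1 - q)) := by
        rw [ofReal_integral_eq_lintegral_ofReal]
        · exact hint.const_mul _
        · refine (ae_restrict_iff' measurableSet_Ioi).2 (.of_forall fun a ha => ?_)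
          have : 0 < a := hs.trans ha
          simp only [Pi.zero_apply]
          positivity
    _ ≤ _ := by
        rw [integral_const_mul, integral_Ioi_rpow_of_lt (by linarith) hs,
          ← ENNReal.ofReal_mul (by have : 0 < q - p := by linarith
                                   positivity)]
        refine ENNReal.ofReal_le_ofReal (le_of_eq ?_)
        rw [show p - 1 - q + 1 = p - q by ring, neg_div, ← div_neg, neg_sub, ← mul_div_assoc,
          ← Real.rpow_add hs, show q + (p - q) = p by ring]
        ring

/-- The constant in the strong-type Calderón–Zygmund inequality. -/
def strongConst (d : ℕ) (p q : ℝ) : ℝ≥0∞ :=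
  ENNReal.ofReal p * (czConst d q *
    (ENNReal.ofReal (2 ^ (p - 1) / (p - 1)) + ENNReal.ofReal (1 / (q - p))))

lemma strongConst_ne_top {p q : ℝ} : strongConst d p q ≠ ⊤ :=
  ENNReal.mul_ne_top ENNReal.ofReal_ne_top (ENNReal.mul_ne_top czConst_ne_top (by simp))

lemma lintegral_distribution_le {E X : Type*} [NormedAddCommGroup E] [MeasurableSpace X]
    {μ : Measure X} [SFinite μ]
    {f : X → E} (hf : StronglyMeasurable f) {p q : ℝ} (hp : 1 < p) (hpq : p < q) :
    ∫⁻ a in Set.Ioi (0 : ℝ), ((ENNReal.ofReal a)⁻¹ * (∫⁻ x in {x | a / 2 < ‖f x‖}, ‖f x‖ₑ ∂μ) +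
        ENNReal.ofReal a ^ (-q) * ∫⁻ x in {x | ‖f x‖ ≤ a}, ‖f x‖ₑ ^ q ∂μ)
        * ENNReal.ofReal (a ^ (p - 1)) ≤
      (ENNReal.ofReal (2 ^ (p - 1) / (p - 1)) + ENNReal.ofReal (1 / (q - p))) *
        ∫⁻ x, ‖f x‖ₑ ^ p ∂μ := by
  have hfn : Measurable fun x => ‖f x‖ := hf.norm.measurable
  have hfn2 : Measurable fun z : ℝ × X => ‖f z.2‖ := hfn.comp measurable_snd
  set G₁ : ℝ → X → ℝ≥0∞ := fun a x =>
    if a / 2 < ‖f x‖ then ENNReal.ofReal (‖f x‖ * a ^ (p - 2)) else 0 with hG₁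
  set G₂ : ℝ → X → ℝ≥0∞ := fun a x =>
    if ‖f x‖ ≤ a then ENNReal.ofReal (‖f x‖ ^ q * a ^ (p - 1 - q)) else 0 with hG₂
  have hm₁ : Measurable (Function.uncurry G₁) := by
    refine Measurable.ite (measurableSet_lt (measurable_fst.div_const 2) hfn2) ?_ measurable_const
    exact (hfn2.mul (measurable_fst.pow_const _)).ennreal_ofReal
  have hm₂ : Measurable (Function.uncurry G₂) := by
    refine Measurable.ite (measurableSet_le hfn2 measurable_fst) ?_ measurable_const
    exact ((hfn2.pow_const _).mul (measurable_fst.pow_const _)).ennreal_ofReal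
  calc _ = ∫⁻ a in Set.Ioi (0 : ℝ), ((∫⁻ x, G₁ a x ∂μ) + ∫⁻ x, G₂ a x ∂μ) := by
        refine setLIntegral_congr_fun measurableSet_Ioi fun a (ha : 0 < a) => ?_
        rw [add_mul]
        congr 1
        · rw [← lintegral_indicator (measurableSet_lt measurable_const hfn),
            mul_right_comm, ← lintegral_const_mul']
          · refine lintegral_congr fun x => ?_
            simp only [Set.indicator, hG₁, Set.mem_ofPred_eq]
            split_ifs
            · rw [← ENNReal.ofReal_inv_of_pos ha, ← ENNReal.ofReal_mul (by positivity),
                ← ofReal_norm, ← ENNReal.ofReal_mul (by positivity), mul_comm]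
              congr 2
              rw [← Real.rpow_neg_one, ← Real.rpow_add ha]
              ring_nf
            · simp
          · rw [← ENNReal.ofReal_inv_of_pos ha]
            exact ENNReal.mul_ne_top ENNReal.ofReal_ne_top ENNReal.ofReal_ne_top
        · rw [← lintegral_indicator (measurableSet_le hfn measurable_const),
            mul_right_comm, ← lintegral_const_mul']
          · refine lintegral_congr fun x => ?_
            simp only [Set.indicator, hG₂, Set.mem_ofPred_eq]
            split_ifs
            · rw [ENNReal.ofReal_rpow_of_pos ha, ← ENNReal.ofReal_mul (by positivity),
                ← ofReal_norm, ENNReal.ofReal_rpow_of_nonneg (norm_nonneg _) (by linarith),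
                ← ENNReal.ofReal_mul (by positivity), mul_comm]
              congr 2
              rw [← Real.rpow_add ha]
              ring_nf
            · simp
          · rw [ENNReal.ofReal_rpow_of_pos ha]
            exact ENNReal.mul_ne_top ENNReal.ofReal_ne_top ENNReal.ofReal_ne_top
    _ = (∫⁻ x, (∫⁻ a in Set.Ioi (0 : ℝ), G₁ a x) ∂μ) +
        ∫⁻ x, (∫⁻ a in Set.Ioi (0 : ℝ), G₂ a x) ∂μ := by
        rw [lintegral_add_left (f := fun a => ∫⁻ x, G₁ a x ∂μ) hm₁.lintegral_prod_right',
          lintegral_lintegral_swap hm₁.aemeasurable,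
          lintegral_lintegral_swap hm₂.aemeasurable]
    _ ≤ _ := by
        rw [add_mul, ← lintegral_const_mul' _ _ ENNReal.ofReal_ne_top,
          ← lintegral_const_mul' _ _ ENNReal.ofReal_ne_top]
        have h : ∀ x, ‖f x‖ₑ ^ p = ENNReal.ofReal (‖f x‖ ^ p) := fun x => by
          rw [← ofReal_norm, ENNReal.ofReal_rpow_of_nonneg (norm_nonneg _) (by linarith)]
        simp only [h]
        exact add_le_add (lintegral_mono fun x => lintegral_Ioi_ite_lt_le hp (norm_nonneg _))
          (lintegral_mono fun x => lintegral_Ioi_ite_ge_le (by linarith) hpq (norm_nonneg _))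

variable {E F : Type*} [NormedAddCommGroup E] [NormedSpace ℂ E]
  [NormedAddCommGroup F] [NormedSpace ℂ F]

lemma continuous_conv {κ : Rd d → ℂ} (hκ : IsKernel κ) {f : Rd d → E} (hf : Integrable f) :
    Continuous (conv κ f) := by
  obtain ⟨M, hM⟩ := hκ.bounded
  refine continuous_of_dominated (bound := fun y => M * ‖f y‖)
    (fun x => (hκ.integrable_smul hf x).1) (fun x => .of_forall fun y => ?_)
    (hf.norm.const_mul M) (.of_forall fun y => ?_)
  · rw [norm_smul]
    exact mul_le_mul_of_nonneg_right (hM _) (norm_nonneg _)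
  · exact (hκ.continuous.comp (by fun_prop)).smul continuous_const

lemma continuous_vecConv {ι : Type*} [Fintype ι] {κ : ι → Rd d → ℂ} (hκ : ∀ i, IsKernel (κ i))
    (L : ι → E →L[ℂ] F) {f : Rd d → E} (hf : Integrable f) : Continuous (vecConv κ L f) :=
  continuous_finsetSum _ fun i _ => (L i).continuous.comp (continuous_conv (hκ i) hf)

/-- Calderón–Zygmund: strong-type inequality. -/
theorem lintegral_vecConv_rpow_le (hd : 0 < d) [CompleteSpace E] {ι : Type*} [Fintype ι]
    {κ : ι → Rd d → ℂ}
    {L : ι → E →L[ℂ] F} (hL : ∀ i, ‖L i‖ ≤ 1) (hκ : ∀ i, IsKernel (κ i)) {A p q : ℝ} (hA0 : 0 < A)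
    (hp : 1 < p) (hpq : p < q) (hA : Hormander κ A) (hW : WeakBound κ L q A)
    {f : Rd d → E} (hf : Continuous f) (hfi : Integrable f) :
    ∫⁻ x, ‖vecConv κ L f x‖ₑ ^ p ≤
      ENNReal.ofReal (2 * A) ^ p * strongConst d p q * ∫⁻ x, ‖f x‖ₑ ^ p := by
  have hp0 : 0 < p := by linarith
  have hc := continuous_vecConv hκ L hfi
  have hlayer := lintegral_rpow_eq_lintegral_meas_lt_mul (μ := (volume : Measure (Rd d)))
    (f := fun x => ‖vecConv κ L f x‖ / (2 * A)) (.of_forall fun x => by positivity)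
    (hc.norm.div_const _).aemeasurable hp0
  have h1 : ∀ x, ‖vecConv κ L f x‖ₑ ^ p = ENNReal.ofReal (2 * A) ^ p *
      ENNReal.ofReal ((‖vecConv κ L f x‖ / (2 * A)) ^ p) := fun x => by
    rw [← ENNReal.ofReal_rpow_of_nonneg (by positivity) hp0.le,
      ← ENNReal.mul_rpow_of_nonneg _ _ hp0.le, ← ENNReal.ofReal_mul (by positivity),
      mul_div_cancel₀ _ (by positivity), ofReal_norm]
  simp only [h1]
  rw [lintegral_const_mul' _ _ (ENNReal.rpow_ne_top_of_nonneg hp0.le ENNReal.ofReal_ne_top),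
    hlayer, mul_assoc]
  refine mul_le_mul_right ?_ _
  rw [strongConst, mul_assoc, mul_assoc]
  refine mul_le_mul_right ?_ _
  refine le_trans ?_ (mul_le_mul_right (lintegral_distribution_le (μ := (volume : Measure (Rd d)))
    hf.stronglyMeasurable hp hpq) _)
  rw [← lintegral_const_mul' _ _ czConst_ne_top]
  refine setLIntegral_mono' measurableSet_Ioi fun a (ha : 0 < a) => ?_
  rw [← mul_assoc]
  refine mul_le_mul_left ?_ _
  refine le_trans (le_of_eq ?_)
    (volume_lt_vecConv_le hd hL hκ hA0 (by linarith) hA hW hf hfi ha)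
  congr 1
  ext x
  simp only [Set.mem_ofPred_eq]
  rw [lt_div_iff₀' (by positivity)]

end StrongType

section Dilations

open scoped SchwartzMap

lemma summable_two_zpow_neg_natAbs : Summable fun k : ℤ => ((2 : ℝ)⁻¹) ^ k.natAbs := by
  have h : Summable fun n : ℕ => ((2 : ℝ)⁻¹) ^ n :=
    summable_geometric_of_lt_one (by norm_num) (by norm_num)
  refine Summable.of_nat_of_neg ?_ ?_ <;> simpa using h

/-- A bound for the sums `∑ j, min (2^j R) (2^j R)⁻¹`. -/
def geomConst : ℝ := 2 * ∑' k : ℤ, ((2 : ℝ)⁻¹) ^ k.natAbs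

lemma sum_min_zpow_le {R : ℝ} (hR : 0 < R) (J : Finset ℤ) :
    ∑ j ∈ J, min ((2 : ℝ) ^ j * R) ((2 : ℝ) ^ j * R)⁻¹ ≤ geomConst := by
  obtain ⟨n, hn1, hn2⟩ := exists_mem_Ico_zpow hR (one_lt_two (α := ℝ))
  have key : ∀ j : ℤ, min ((2 : ℝ) ^ j * R) ((2 : ℝ) ^ j * R)⁻¹ ≤
      2 * ((2 : ℝ)⁻¹) ^ (j + n).natAbs := by
    intro j
    have h2 : (0 : ℝ) < 2 ^ j := by positivity
    rcases le_total 0 (j + n) with h | h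
    · refine (min_le_right _ _).trans ?_
      have e : ((2 : ℝ)⁻¹) ^ (j + n).natAbs = ((2 : ℝ) ^ (j + n))⁻¹ := by
        rw [← zpow_natCast, Int.natAbs_of_nonneg h, inv_zpow]
      rw [e, zpow_add₀ two_ne_zero]
      have : ((2 : ℝ) ^ j * R)⁻¹ ≤ ((2 : ℝ) ^ j * 2 ^ n)⁻¹ := by gcongr
      have h3 : 0 < ((2 : ℝ) ^ j * 2 ^ n)⁻¹ := by positivity
      linarith
    · refine (min_le_left _ _).trans ?_
      have e : ((2 : ℝ)⁻¹) ^ (j + n).natAbs = (2 : ℝ) ^ (j + n) := by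
        rw [← zpow_natCast, Int.ofNat_natAbs_of_nonpos h, inv_zpow, zpow_neg, inv_inv]
      rw [e, zpow_add₀ two_ne_zero]
      rw [zpow_add_one₀ two_ne_zero] at hn2
      nlinarith
  calc ∑ j ∈ J, min ((2 : ℝ) ^ j * R) ((2 : ℝ) ^ j * R)⁻¹
      ≤ ∑ j ∈ J, 2 * ((2 : ℝ)⁻¹) ^ (j + n).natAbs := Finset.sum_le_sum fun j _ => key j
    _ = 2 * ∑ j ∈ J, ((2 : ℝ)⁻¹) ^ (j + n).natAbs := by rw [Finset.mul_sum]
    _ ≤ geomConst := by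
        refine mul_le_mul_of_nonneg_left ?_ two_pos.le
        have hs : Summable fun j : ℤ => ((2 : ℝ)⁻¹) ^ (j + n).natAbs :=
          summable_two_zpow_neg_natAbs.comp_injective (add_left_injective n)
        refine (hs.sum_le_tsum J fun j _ => by positivity).trans (le_of_eq ?_)
        exact (Equiv.addRight n).tsum_eq fun k : ℤ => ((2 : ℝ)⁻¹) ^ k.natAbs

lemma geomConst_nonneg : 0 ≤ geomConst :=
  mul_nonneg two_pos.le (tsum_nonneg fun _ => by positivity)

/-- The function `x ↦ 2^{jd} χ (2^j x - v)`. -/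
def dilate (j : ℤ) (v : Rd d) (χ : 𝓢(Rd d, ℂ)) : 𝓢(Rd d, ℂ) :=
  (((2 : ℝ) ^ j) ^ d) • SchwartzMap.compCLMOfContinuousLinearEquiv ℂ
    (ContinuousLinearEquiv.smulLeft (Units.mk0 ((2 : ℝ) ^ j) (by positivity)))
    (SchwartzMap.compSubConstCLM ℂ v χ)

lemma dilate_apply (j : ℤ) (v : Rd d) (χ : 𝓢(Rd d, ℂ)) (x : Rd d) :
    dilate j v χ x = (((2 : ℝ) ^ j) ^ d) • χ ((2 : ℝ) ^ j • x - v) := rfl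

lemma isKernel_schwartz (χ : 𝓢(Rd d, ℂ)) : IsKernel χ :=
  ⟨χ.continuous, χ.integrable, _, χ.norm_le_seminorm ℂ⟩

lemma lintegral_comp_zpow_smul (j : ℤ) (G : Rd d → ℝ≥0∞) :
    ∫⁻ x, ENNReal.ofReal (((2 : ℝ) ^ j) ^ d) * G ((2 : ℝ) ^ j • x) = ∫⁻ x, G x := by
  have h2 : (0 : ℝ) < 2 ^ j := by positivity
  have e := lintegral_map_equiv (μ := (volume : Measure (Rd d))) G
    (MeasurableEquiv.smul₀ ((2 : ℝ) ^ j) h2.ne')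
  have hm : Measure.map (MeasurableEquiv.smul₀ ((2 : ℝ) ^ j) h2.ne') (volume : Measure (Rd d)) =
      ENNReal.ofReal (((2 : ℝ) ^ j) ^ d)⁻¹ • volume := by
    have := Measure.map_addHaar_smul (volume : Measure (Rd d)) h2.ne'
    rw [finrank_euclideanSpace_fin, abs_of_pos (by positivity)] at this
    exact this
  rw [hm, lintegral_smul_measure] at e
  rw [lintegral_const_mul' _ _ ENNReal.ofReal_ne_top]
  simp only [MeasurableEquiv.coe_smul₀] at e
  rw [← e, smul_eq_mul, ← mul_assoc, ← ENNReal.ofReal_mul (by positivity),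
    mul_inv_cancel₀ (by positivity), ENNReal.ofReal_one, one_mul]

lemma exists_lintegral_translate_sub_le (χ : 𝓢(Rd d, ℂ)) :
    ∃ C : ℝ, 0 ≤ C ∧ ∀ v w : Rd d,
      ∫⁻ u, ‖χ (u - v) - χ (u - w)‖ₑ ≤ ENNReal.ofReal (C * ‖v - w‖) := by
  set D : Rd d → ℝ≥0∞ := fun u => ‖fderiv ℝ χ u‖ₑ with hD
  have hDc : Continuous D := ((χ.smooth 1).continuous_fderiv one_ne_zero).enorm
  have hDfin : ∫⁻ u, D u ≠ ⊤ := by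
    have := (SchwartzMap.fderivCLM ℂ (Rd d) ℂ χ).integrable (μ := volume)
    exact this.2.ne
  refine ⟨(∫⁻ u, D u).toReal, ENNReal.toReal_nonneg, fun v w => ?_⟩
  have pt : ∀ u, ‖χ (u - v) - χ (u - w)‖ₑ ≤
      ∫⁻ t in Set.Icc (0 : ℝ) 1, D (u - w + t • (w - v)) * ‖v - w‖ₑ := by
    intro u
    have hder : ∀ t ∈ Set.uIcc (0 : ℝ) 1, HasDerivAt (fun t : ℝ => χ (u - w + t • (w - v)))
        (fderiv ℝ χ (u - w + t • (w - v)) (w - v)) t := by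
      intro t _
      have h1 : HasDerivAt (fun t : ℝ => u - w + t • (w - v)) (w - v) t := by
        simpa using ((hasDerivAt_id t).smul_const (w - v)).const_add (u - w)
      exact (χ.differentiable _).hasFDerivAt.comp_hasDerivAt t h1
    have hc : Continuous fun t : ℝ => fderiv ℝ χ (u - w + t • (w - v)) (w - v) :=
      (((χ.smooth 1).continuous_fderiv one_ne_zero).comp (by fun_prop)).clm_apply continuous_const
    have := intervalIntegral.integral_eq_sub_of_hasDerivAt hder (hc.intervalIntegrable _ _)
    rw [one_smul, zero_smul, add_zero, show u - w + (w - v) = u - v by abel] at this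
    rw [← this, intervalIntegral.integral_of_le zero_le_one]
    refine (enorm_integral_le_lintegral_enorm _).trans ?_
    refine (lintegral_mono_set Set.Ioc_subset_Icc_self).trans (lintegral_mono fun t => ?_)
    rw [enorm_sub_rev v w]
    exact ContinuousLinearMap.le_opENorm _ _
  calc ∫⁻ u, ‖χ (u - v) - χ (u - w)‖ₑ
      ≤ ∫⁻ u, ∫⁻ t in Set.Icc (0 : ℝ) 1, D (u - w + t • (w - v)) * ‖v - w‖ₑ := lintegral_mono pt
    _ = ∫⁻ t in Set.Icc (0 : ℝ) 1, ∫⁻ u, D (u - w + t • (w - v)) * ‖v - w‖ₑ := by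
        refine lintegral_lintegral_swap (Continuous.measurable ?_).aemeasurable
        exact (ENNReal.continuous_mul_const enorm_ne_top).comp (hDc.comp (by fun_prop))
    _ = ∫⁻ t in Set.Icc (0 : ℝ) 1, (∫⁻ u, D u) * ‖v - w‖ₑ := by
        refine lintegral_congr fun t => ?_
        rw [lintegral_mul_const' _ _ enorm_ne_top]
        congr 1
        simp only [sub_add]
        exact lintegral_sub_right_eq_self D _
    _ = ENNReal.ofReal ((∫⁻ u, D u).toReal * ‖v - w‖) := by
        rw [ENNReal.ofReal_mul ENNReal.toReal_nonneg, ENNReal.ofReal_toReal hDfin, ofReal_norm]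
        simp

lemma exists_lintegral_norm_mul_translate_le (χ : 𝓢(Rd d, ℂ)) :
    ∃ C : ℝ, 0 ≤ C ∧ ∀ v : Rd d,
      ∫⁻ u, ‖u‖ₑ * ‖χ (u - v)‖ₑ ≤ ENNReal.ofReal (C * (1 + ‖v‖)) := by
  have h0 : ∫⁻ u, ‖χ u‖ₑ ≠ ⊤ := (χ.integrable (μ := volume)).2.ne
  have h1 : ∫⁻ u, ‖u‖ₑ * ‖χ u‖ₑ ≠ ⊤ := by
    have := (χ.integrable_pow_mul volume 1).2.ne
    simpa using this
  refine ⟨(∫⁻ u, ‖χ u‖ₑ).toReal + (∫⁻ u, ‖u‖ₑ * ‖χ u‖ₑ).toReal, by positivity, fun v => ?_⟩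
  have hm : Measurable fun u => ‖u‖ₑ * ‖χ u‖ₑ :=
    measurable_id.enorm.mul χ.continuous.measurable.enorm
  calc ∫⁻ u, ‖u‖ₑ * ‖χ (u - v)‖ₑ = ∫⁻ u, ‖u - v + v‖ₑ * ‖χ (u - v)‖ₑ := by simp
    _ = ∫⁻ u, ‖u + v‖ₑ * ‖χ u‖ₑ := lintegral_sub_right_eq_self (fun u => ‖u + v‖ₑ * ‖χ u‖ₑ) v
    _ ≤ ∫⁻ u, (‖u‖ₑ * ‖χ u‖ₑ + ‖v‖ₑ * ‖χ u‖ₑ) := by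
        refine lintegral_mono fun u => ?_
        rw [← add_mul]
        exact mul_le_mul_left (enorm_add_le _ _) _
    _ = (∫⁻ u, ‖u‖ₑ * ‖χ u‖ₑ) + ‖v‖ₑ * ∫⁻ u, ‖χ u‖ₑ := by
        rw [lintegral_add_left hm, lintegral_const_mul' _ _ enorm_ne_top]
    _ ≤ _ := by
        rw [← ENNReal.ofReal_toReal h0, ← ENNReal.ofReal_toReal h1, ← ofReal_norm,
          ← ENNReal.ofReal_mul (norm_nonneg _),
          ← ENNReal.ofReal_add (by positivity) (by positivity)]
        refine ENNReal.ofReal_le_ofReal ?_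
        rw [ENNReal.toReal_ofReal (by positivity), ENNReal.toReal_ofReal (by positivity)]
        nlinarith [norm_nonneg v, (ENNReal.toReal_nonneg : 0 ≤ (∫⁻ u, ‖χ u‖ₑ).toReal),
          (ENNReal.toReal_nonneg : 0 ≤ (∫⁻ u, ‖u‖ₑ * ‖χ u‖ₑ).toReal),
          mul_nonneg (norm_nonneg v) (ENNReal.toReal_nonneg : 0 ≤ (∫⁻ u, ‖u‖ₑ * ‖χ u‖ₑ).toReal)]

lemma enorm_dilate (j : ℤ) (v : Rd d) (χ : 𝓢(Rd d, ℂ)) (x : Rd d) :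
    ‖dilate j v χ x‖ₑ = ENNReal.ofReal (((2 : ℝ) ^ j) ^ d) * ‖χ ((2 : ℝ) ^ j • x - v)‖ₑ := by
  rw [dilate_apply, enorm_smul, Real.enorm_of_nonneg (by positivity)]

lemma lintegral_enorm_dilate (j : ℤ) (v : Rd d) (χ : 𝓢(Rd d, ℂ)) :
    ∫⁻ x, ‖dilate j v χ x‖ₑ = ∫⁻ x, ‖χ x‖ₑ := by
  simp only [enorm_dilate]
  rw [lintegral_comp_zpow_smul j (fun x => ‖χ (x - v)‖ₑ)]
  exact lintegral_sub_right_eq_self (fun u => ‖χ u‖ₑ) v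

/-- The families of dilates of a fixed Schwartz function satisfy the Hörmander condition. -/
theorem exists_hormander_dilate (χ : 𝓢(Rd d, ℂ)) :
    ∃ C : ℝ, 0 ≤ C ∧ ∀ (v : Rd d) (J : Finset ℤ),
      Hormander (fun j : J => ⇑(dilate j.1 v χ)) (C * (1 + ‖v‖)) := by
  obtain ⟨C₁, hC₁, h₁⟩ := exists_lintegral_translate_sub_le χ
  obtain ⟨C₂, hC₂, h₂⟩ := exists_lintegral_norm_mul_translate_le χ
  refine ⟨(C₁ + 2 * C₂) * geomConst, by have := geomConst_nonneg; positivity, ?_⟩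
  intro v J c y R hR
  rcases (dist_nonneg.trans hR).eq_or_lt with rfl | hR0
  · rw [dist_le_zero] at hR
    simp [hR]
  have key : ∀ j : ℤ, ∫⁻ x in (Metric.closedBall c (2 * R))ᶜ,
      ‖dilate j v χ (x - y) - dilate j v χ (x - c)‖ₑ ≤
        ENNReal.ofReal ((C₁ + 2 * C₂) * (1 + ‖v‖) * min ((2 : ℝ) ^ j * R) ((2 : ℝ) ^ j * R)⁻¹) := by
    intro j
    have h2 : (0 : ℝ) < 2 ^ j := by positivity
    have hA : ∫⁻ x in (Metric.closedBall c (2 * R))ᶜ,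
        ‖dilate j v χ (x - y) - dilate j v χ (x - c)‖ₑ ≤
          ENNReal.ofReal (C₁ * ((2 : ℝ) ^ j * R)) := by
      calc _ ≤ ∫⁻ x, ‖dilate j v χ (x - y) - dilate j v χ (x - c)‖ₑ := setLIntegral_le_lintegral _ _
        _ = ∫⁻ x, ENNReal.ofReal (((2 : ℝ) ^ j) ^ d) *
            ‖χ ((2 : ℝ) ^ j • x - ((2 : ℝ) ^ j • y + v)) -
              χ ((2 : ℝ) ^ j • x - ((2 : ℝ) ^ j • c + v))‖ₑ := by
            refine lintegral_congr fun x => ?_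
            rw [dilate_apply, dilate_apply, ← smul_sub, enorm_smul,
              Real.enorm_of_nonneg (by positivity), smul_sub, smul_sub, sub_sub, sub_sub]
        _ = ∫⁻ x, ‖χ (x - ((2 : ℝ) ^ j • y + v)) - χ (x - ((2 : ℝ) ^ j • c + v))‖ₑ :=
            lintegral_comp_zpow_smul j (fun x =>
              ‖χ (x - ((2 : ℝ) ^ j • y + v)) - χ (x - ((2 : ℝ) ^ j • c + v))‖ₑ)
        _ ≤ _ := by
            refine (h₁ _ _).trans (ENNReal.ofReal_le_ofReal ?_)
            rw [add_sub_add_right_eq_sub, ← smul_sub, norm_smul, Real.norm_of_nonneg h2.le,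
              ← dist_eq_norm]
            gcongr
    have hB1 : ∀ z : Rd d, (∀ x ∉ Metric.closedBall c (2 * R), R ≤ ‖x - z‖) →
        ∫⁻ x in (Metric.closedBall c (2 * R))ᶜ, ‖dilate j v χ (x - z)‖ₑ ≤
          ENNReal.ofReal (C₂ * (1 + ‖v‖) * ((2 : ℝ) ^ j * R)⁻¹) := by
      intro z hz
      calc ∫⁻ x in (Metric.closedBall c (2 * R))ᶜ, ‖dilate j v χ (x - z)‖ₑ
          ≤ ∫⁻ x in (Metric.closedBall c (2 * R))ᶜ, ENNReal.ofReal R⁻¹ *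
              (‖x - z‖ₑ * ‖dilate j v χ (x - z)‖ₑ) := by
            refine setLIntegral_mono' Metric.isClosed_closedBall.measurableSet.compl fun x hx => ?_
            rw [← mul_assoc]
            refine le_mul_of_one_le_left' ?_
            rw [← ofReal_norm, ← ENNReal.ofReal_mul (by positivity), ENNReal.one_le_ofReal,
              inv_mul_eq_div, one_le_div hR0]
            exact hz x hx
        _ ≤ ∫⁻ x, ENNReal.ofReal R⁻¹ * (‖x - z‖ₑ * ‖dilate j v χ (x - z)‖ₑ) :=
            setLIntegral_le_lintegral _ _
        _ = ENNReal.ofReal R⁻¹ * ∫⁻ x, ‖x‖ₑ * ‖dilate j v χ x‖ₑ := by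
            rw [lintegral_const_mul' _ _ ENNReal.ofReal_ne_top]
            congr 1
            exact lintegral_sub_right_eq_self (fun x => ‖x‖ₑ * ‖dilate j v χ x‖ₑ) z
        _ = ENNReal.ofReal R⁻¹ * ∫⁻ x, ENNReal.ofReal (((2 : ℝ) ^ j) ^ d) *
              (ENNReal.ofReal ((2 : ℝ) ^ j)⁻¹ * (‖(2 : ℝ) ^ j • x‖ₑ *
                ‖χ ((2 : ℝ) ^ j • x - v)‖ₑ)) := by
            congr 1
            refine lintegral_congr fun x => ?_
            rw [enorm_dilate, enorm_smul, Real.enorm_of_nonneg h2.le]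
            have : ENNReal.ofReal ((2 : ℝ) ^ j)⁻¹ * ENNReal.ofReal ((2 : ℝ) ^ j) = 1 := by
              rw [← ENNReal.ofReal_mul (by positivity), inv_mul_cancel₀ h2.ne', ENNReal.ofReal_one]
            rw [← mul_assoc (ENNReal.ofReal ((2 : ℝ) ^ j)⁻¹),
              ← mul_assoc (ENNReal.ofReal ((2 : ℝ) ^ j)⁻¹), this, one_mul]
            ring
        _ = ENNReal.ofReal R⁻¹ * (ENNReal.ofReal ((2 : ℝ) ^ j)⁻¹ * ∫⁻ x, ‖x‖ₑ * ‖χ (x - v)‖ₑ) := by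
            rw [lintegral_comp_zpow_smul j (fun x => ENNReal.ofReal ((2 : ℝ) ^ j)⁻¹ *
              (‖x‖ₑ * ‖χ (x - v)‖ₑ)), lintegral_const_mul' _ _ ENNReal.ofReal_ne_top]
        _ ≤ ENNReal.ofReal R⁻¹ * (ENNReal.ofReal ((2 : ℝ) ^ j)⁻¹ *
              ENNReal.ofReal (C₂ * (1 + ‖v‖))) := by gcongr; exact h₂ v
        _ = _ := by
            rw [← ENNReal.ofReal_mul (by positivity), ← ENNReal.ofReal_mul (by positivity), mul_inv]
            ring_nf
    have hB : ∫⁻ x in (Metric.closedBall c (2 * R))ᶜ,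
        ‖dilate j v χ (x - y) - dilate j v χ (x - c)‖ₑ ≤
          ENNReal.ofReal (2 * C₂ * (1 + ‖v‖) * ((2 : ℝ) ^ j * R)⁻¹) := by
      calc _ ≤ ∫⁻ x in (Metric.closedBall c (2 * R))ᶜ,
            (‖dilate j v χ (x - y)‖ₑ + ‖dilate j v χ (x - c)‖ₑ) :=
            lintegral_mono fun x => enorm_sub_le
        _ = (∫⁻ x in (Metric.closedBall c (2 * R))ᶜ, ‖dilate j v χ (x - y)‖ₑ) +
            ∫⁻ x in (Metric.closedBall c (2 * R))ᶜ, ‖dilate j v χ (x - c)‖ₑ := by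
            refine lintegral_add_left ?_ _
            exact ((dilate j v χ).continuous.comp (by fun_prop)).enorm.measurable
        _ ≤ _ := by
            refine (add_le_add (hB1 y ?_) (hB1 c ?_)).trans (le_of_eq ?_)
            · intro x hx
              rw [Metric.mem_closedBall, not_le] at hx
              have := dist_triangle x y c
              rw [← dist_eq_norm]
              linarith
            · intro x hx
              rw [Metric.mem_closedBall, not_le] at hx
              rw [← dist_eq_norm]
              linarith
            · rw [← ENNReal.ofReal_add (by positivity) (by positivity)]
              ring_nf
    have hv := norm_nonneg v
    rcases min_cases ((2 : ℝ) ^ j * R) ((2 : ℝ) ^ j * R)⁻¹ with h | h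
    · rw [h.1]
      refine hA.trans (ENNReal.ofReal_le_ofReal ?_)
      have : C₁ ≤ (C₁ + 2 * C₂) * (1 + ‖v‖) := by nlinarith [mul_nonneg hC₁ hv, mul_nonneg hC₂ hv]
      gcongr
    · rw [h.1]
      refine hB.trans (ENNReal.ofReal_le_ofReal ?_)
      gcongr
      linarith
  calc ∑ j : J, ∫⁻ x in (Metric.closedBall c (2 * R))ᶜ,
        ‖dilate j.1 v χ (x - y) - dilate j.1 v χ (x - c)‖ₑ
      ≤ ∑ j : J, ENNReal.ofReal ((C₁ + 2 * C₂) * (1 + ‖v‖) *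
          min ((2 : ℝ) ^ j.1 * R) ((2 : ℝ) ^ j.1 * R)⁻¹) := Finset.sum_le_sum fun j _ => key j
    _ = ENNReal.ofReal ((C₁ + 2 * C₂) * (1 + ‖v‖) *
          ∑ j ∈ J, min ((2 : ℝ) ^ j * R) ((2 : ℝ) ^ j * R)⁻¹) := by
        rw [Finset.mul_sum, ENNReal.ofReal_sum_of_nonneg fun j _ => by positivity]
        exact Finset.sum_coe_sort J fun j => ENNReal.ofReal ((C₁ + 2 * C₂) * (1 + ‖v‖) *
          min ((2 : ℝ) ^ j * R) ((2 : ℝ) ^ j * R)⁻¹)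
    _ ≤ _ := by
        refine ENNReal.ofReal_le_ofReal ?_
        have := sum_min_zpow_le hR0 J
        calc _ ≤ (C₁ + 2 * C₂) * (1 + ‖v‖) * geomConst := by gcongr
          _ = _ := by ring

end Dilations

section SquareFunctionL2

open scoped SchwartzMap
open Filter Topology

lemma eLpNorm_rpow_eq_lintegral {X E : Type*} [MeasurableSpace X] [NormedAddCommGroup E]
    {μ : Measure X} {p : ℝ} (hp : 0 < p) (f : X → E) :
    eLpNorm f (ENNReal.ofReal p) μ ^ p = ∫⁻ x, ‖f x‖ₑ ^ p ∂μ := by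
  rw [eLpNorm_eq_lintegral_rpow_enorm_toReal (by simpa using hp) ENNReal.ofReal_ne_top,
    ENNReal.toReal_ofReal hp.le, ← ENNReal.rpow_mul, one_div, inv_mul_cancel₀ hp.ne',
    ENNReal.rpow_one]

lemma conv_eq_convolution (κ g : 𝓢(Rd d, ℂ)) :
    conv κ g = SchwartzMap.convolution (ContinuousLinearMap.mul ℂ ℂ) g κ := by
  ext x
  rw [SchwartzMap.convolution_apply]
  simp only [conv, convolution, ContinuousLinearMap.mul_apply', smul_eq_mul, mul_comm]

lemma fourier_convolution_schwartz (κ g : 𝓢(Rd d, ℂ)) (ξ : Rd d) :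
    𝓕 (SchwartzMap.convolution (ContinuousLinearMap.mul ℂ ℂ) g κ) ξ = 𝓕 κ ξ * 𝓕 g ξ := by
  rw [SchwartzMap.fourier_convolution, SchwartzMap.pairing_apply_apply,
    ContinuousLinearMap.mul_apply', mul_comm]

lemma lintegral_enorm_sq_fourier (u : 𝓢(Rd d, ℂ)) :
    ∫⁻ ξ, ‖𝓕 u ξ‖ₑ ^ (2 : ℝ) = ∫⁻ x, ‖u x‖ₑ ^ (2 : ℝ) := by
  have h : ∀ w : 𝓢(Rd d, ℂ), ∫⁻ x, ‖w x‖ₑ ^ (2 : ℝ) = ENNReal.ofReal (∫ x, ‖w x‖ ^ 2) := fun w => by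
    have hw : MemLp w ((2 : ℕ) : ℝ≥0∞) volume := by simpa using w.memLp 2 volume
    rw [ofReal_integral_eq_lintegral_ofReal (hw.integrable_norm_pow two_ne_zero)
      (.of_forall fun x => by positivity)]
    refine lintegral_congr fun x => ?_
    rw [← ofReal_norm, ENNReal.ofReal_rpow_of_nonneg (norm_nonneg _) two_pos.le, Real.rpow_two]
  rw [h, h, SchwartzMap.integral_norm_sq_fourier]

lemma fourier_dilate_zero (j : ℤ) (χ : 𝓢(Rd d, ℂ)) (ξ : Rd d) :
    𝓕 (dilate j 0 χ) ξ = 𝓕 χ (((2 : ℝ) ^ j)⁻¹ • ξ) := by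
  have h2 : (0 : ℝ) < 2 ^ j := by positivity
  rw [SchwartzMap.fourier_coe, SchwartzMap.fourier_coe, Real.fourier_eq, Real.fourier_eq]
  have := Measure.integral_comp_smul (volume : Measure (Rd d))
    (fun x => Real.fourierChar (-inner ℝ x (((2 : ℝ) ^ j)⁻¹ • ξ)) • χ x) ((2 : ℝ) ^ j)
  rw [finrank_euclideanSpace_fin, abs_of_pos (by positivity), eq_inv_smul_iff₀ (by positivity),
    ← integral_smul] at this
  rw [← this]
  refine integral_congr_ae (.of_forall fun x => ?_)
  simp only [dilate_apply, sub_zero, inner_smul_left, inner_smul_right]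
  rw [smul_comm]
  congr 4
  simp [h2.ne']

lemma conv_dilate (j : ℤ) (v : Rd d) (χ : 𝓢(Rd d, ℂ)) {E : Type*} [NormedAddCommGroup E]
    [NormedSpace ℂ E] (g : Rd d → E) (x : Rd d) :
    conv (dilate j v χ) g x = conv (dilate j 0 χ) g (x - ((2 : ℝ) ^ j)⁻¹ • v) := by
  have h2 : (0 : ℝ) < 2 ^ j := by positivity
  unfold conv
  congr 1
  ext y
  congr 1
  rw [dilate_apply, dilate_apply, sub_zero, smul_sub, smul_sub, smul_sub, smul_inv_smul₀ h2.ne']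
  congr 2
  abel

/-- Finite overlap of the dyadic dilates of a Schwartz function vanishing at the origin. -/
lemma exists_sum_sq_dilates_le (ψ : 𝓢(Rd d, ℂ)) (h0 : ψ 0 = 0) :
    ∃ C : ℝ, 0 ≤ C ∧ ∀ (J : Finset ℤ) (ξ : Rd d),
      ∑ j ∈ J, ‖ψ (((2 : ℝ) ^ j)⁻¹ • ξ)‖ ^ 2 ≤ C := by
  set A := SchwartzMap.seminorm ℝ 0 1 ψ with hA
  set B := SchwartzMap.seminorm ℝ 1 0 ψ with hB
  have hA0 : 0 ≤ A := apply_nonneg _ _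
  have hB0 : 0 ≤ B := apply_nonneg _ _
  have h1 : ∀ z, ‖ψ z‖ ≤ A * ‖z‖ := fun z => by
    have := convex_univ.norm_image_sub_le_of_norm_fderiv_le (𝕜 := ℝ) (f := ψ) (C := A)
      (x := 0) (y := z) (fun x _ => ψ.differentiableAt) (fun x _ => by
        have := ψ.norm_iteratedFDeriv_le_seminorm ℝ 1 x
        rwa [norm_iteratedFDeriv_one] at this) trivial trivial
    simpa [h0] using this
  have h2 : ∀ z, ‖z‖ * ‖ψ z‖ ≤ B := fun z => by
    simpa using ψ.norm_pow_mul_le_seminorm ℝ 1 z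
  refine ⟨(A + B) ^ 2 * geomConst, by have := geomConst_nonneg; positivity, fun J ξ => ?_⟩
  rcases eq_or_ne ξ 0 with rfl | hξ
  · have := geomConst_nonneg
    simp only [smul_zero, h0, norm_zero, ne_eq, OfNat.ofNat_ne_zero, not_false_eq_true, zero_pow,
      Finset.sum_const_zero]
    positivity
  have hR : 0 < ‖ξ‖ := norm_pos_iff.2 hξ
  have key : ∀ j : ℤ, ‖ψ (((2 : ℝ) ^ j)⁻¹ • ξ)‖ ^ 2 ≤
      (A + B) ^ 2 * min ((2 : ℝ) ^ (-j) * ‖ξ‖) ((2 : ℝ) ^ (-j) * ‖ξ‖)⁻¹ := by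
    intro j
    set z := ((2 : ℝ) ^ j)⁻¹ • ξ with hz
    have hzn : ‖z‖ = (2 : ℝ) ^ (-j) * ‖ξ‖ := by
      rw [hz, norm_smul, norm_inv, Real.norm_of_nonneg (by positivity), zpow_neg]
    have hz0 : 0 < ‖z‖ := by rw [hzn]; positivity
    rw [← hzn]
    have hψ0 := norm_nonneg (ψ z)
    set t := min ‖z‖ ‖z‖⁻¹ with ht
    have ht0 : 0 ≤ t := le_min hz0.le (by positivity)
    have ht1 : t ≤ 1 := by
      rcases le_total ‖z‖ 1 with h | h
      · exact (min_le_left _ _).trans h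
      · exact (min_le_right _ _).trans (inv_le_one_of_one_le₀ h)
    have hle : ‖ψ z‖ ≤ (A + B) * t := by
      rcases min_cases ‖z‖ ‖z‖⁻¹ with h | h
      · rw [ht, h.1]; nlinarith [h1 z]
      · rw [ht, h.1, ← div_eq_mul_inv, le_div_iff₀ hz0]; nlinarith [h2 z]
    calc ‖ψ z‖ ^ 2 ≤ ((A + B) * t) ^ 2 := by gcongr
      _ = (A + B) ^ 2 * (t * t) := by ring
      _ ≤ (A + B) ^ 2 * (t * 1) := by gcongr
      _ = _ := by rw [mul_one]
  calc _ ≤ ∑ j ∈ J, (A + B) ^ 2 * min ((2 : ℝ) ^ (-j) * ‖ξ‖) ((2 : ℝ) ^ (-j) * ‖ξ‖)⁻¹ :=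
        Finset.sum_le_sum fun j _ => key j
    _ = (A + B) ^ 2 * ∑ j ∈ J.map (Equiv.neg ℤ).toEmbedding,
        min ((2 : ℝ) ^ j * ‖ξ‖) ((2 : ℝ) ^ j * ‖ξ‖)⁻¹ := by
        rw [Finset.sum_map, Finset.mul_sum]
        rfl
    _ ≤ _ := by
        gcongr
        exact sum_min_zpow_le hR _

lemma exists_lintegral_sum_conv_schwartz_le (χ : 𝓢(Rd d, ℂ)) (h0 : 𝓕 χ 0 = 0) :
    ∃ C : ℝ, 0 ≤ C ∧ ∀ (J : Finset ℤ) (g : 𝓢(Rd d, ℂ)),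
      ∫⁻ x, ∑ j ∈ J, ‖conv (dilate j 0 χ) g x‖ₑ ^ (2 : ℝ) ≤
        ENNReal.ofReal C * ∫⁻ x, ‖g x‖ₑ ^ (2 : ℝ) := by
  obtain ⟨C, hC, h⟩ := exists_sum_sq_dilates_le (𝓕 χ) h0
  refine ⟨C, hC, fun J g => ?_⟩
  have hm : ∀ (u : 𝓢(Rd d, ℂ)), Measurable fun x => ‖u x‖ₑ ^ (2 : ℝ) := fun u =>
    u.continuous.measurable.enorm.pow_const _
  simp only [conv_eq_convolution]
  rw [lintegral_finsetSum _ fun j _ => hm _]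
  calc ∑ j ∈ J, ∫⁻ x, ‖SchwartzMap.convolution (ContinuousLinearMap.mul ℂ ℂ) g
        (dilate j 0 χ) x‖ₑ ^ (2 : ℝ)
      = ∑ j ∈ J, ∫⁻ ξ, ‖𝓕 χ (((2 : ℝ) ^ j)⁻¹ • ξ) * 𝓕 g ξ‖ₑ ^ (2 : ℝ) := by
        refine Finset.sum_congr rfl fun j _ => ?_
        rw [← lintegral_enorm_sq_fourier]
        simp only [fourier_convolution_schwartz, fourier_dilate_zero]
    _ = ∫⁻ ξ, ∑ j ∈ J, ‖𝓕 χ (((2 : ℝ) ^ j)⁻¹ • ξ) * 𝓕 g ξ‖ₑ ^ (2 : ℝ) := by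
        rw [lintegral_finsetSum _ fun j _ => ?_]
        refine Measurable.pow_const (Continuous.measurable ?_).enorm _
        exact ((𝓕 χ).continuous.comp (by fun_prop)).mul (𝓕 g).continuous
    _ ≤ ∫⁻ ξ, ENNReal.ofReal C * ‖𝓕 g ξ‖ₑ ^ (2 : ℝ) := by
        refine lintegral_mono fun ξ => ?_
        simp only [enorm_mul, ENNReal.mul_rpow_of_nonneg _ _ two_pos.le]
        rw [← Finset.sum_mul]
        gcongr
        refine le_trans (le_of_eq ?_) (ENNReal.ofReal_le_ofReal (h J ξ))
        rw [ENNReal.ofReal_sum_of_nonneg fun j _ => by positivity]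
        refine Finset.sum_congr rfl fun j _ => ?_
        rw [← ofReal_norm, ENNReal.ofReal_rpow_of_nonneg (norm_nonneg _) two_pos.le, Real.rpow_two]
    _ = _ := by rw [lintegral_const_mul' _ _ ENNReal.ofReal_ne_top, lintegral_enorm_sq_fourier]

lemma tendsto_conv_of_tendsto_eLpNorm (κ : 𝓢(Rd d, ℂ)) {g : Rd d → ℂ} {s : ℕ → Rd d → ℂ}
    (hg : Integrable g) (hs : ∀ n, Integrable (s n))
    (hlim : Tendsto (fun n => eLpNorm (g - s n) 2) atTop (𝓝 0)) (x : Rd d) :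
    Tendsto (fun n => conv κ (s n) x) atTop (𝓝 (conv κ g x)) := by
  rw [tendsto_iff_edist_tendsto_0]
  have hκ : MemLp (fun y => κ (x - y)) 2 := by
    have := (κ.memLp 2 (μ := volume)).comp_measurePreserving
      (Measure.measurePreserving_sub_left volume x)
    exact this
  have hle : ∀ n, edist (conv κ (s n) x) (conv κ g x) ≤
      eLpNorm (fun y => κ (x - y)) 2 * eLpNorm (g - s n) 2 := fun n => by
    rw [edist_comm, edist_eq_enorm_sub]
    have : conv κ g x - conv κ (s n) x = ∫ y, κ (x - y) • (g - s n) y := by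
      simp only [conv, Pi.sub_apply, smul_sub]
      rw [integral_sub ((isKernel_schwartz κ).integrable_smul hg x)
        ((isKernel_schwartz κ).integrable_smul (hs n) x)]
    rw [this]
    refine (enorm_integral_le_lintegral_enorm _).trans ?_
    rw [← eLpNorm_one_eq_lintegral_enorm]
    exact eLpNorm_smul_le_mul_eLpNorm (p := 2) (q := 2) (r := 1) (f := g - s n)
      (φ := fun y => κ (x - y)) (hg.1.sub (hs n).1) hκ.1
  refine tendsto_of_tendsto_of_tendsto_of_le_of_le tendsto_const_nhds ?_ (fun n => zero_le) hle
  simpa using ENNReal.Tendsto.const_mul hlim (Or.inr hκ.eLpNorm_ne_top)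

lemma eLpNorm_two_le_add {g u : Rd d → ℂ} (hg : AEStronglyMeasurable g)
    (hu : AEStronglyMeasurable u) : eLpNorm u 2 ≤ eLpNorm g 2 + eLpNorm (g - u) 2 := by
  have := eLpNorm_sub_le (μ := (volume : Measure (Rd d))) (p := 2) hg (hg.sub hu) one_le_two
  rwa [sub_sub_cancel] at this

lemma tendsto_of_le_add_of_sub_le {a : ℝ≥0∞} (ha : a ≠ ∞) {b c : ℕ → ℝ≥0∞}
    (hb : Tendsto b atTop (𝓝 0)) (hlo : ∀ n, a ≤ c n + b n) (hup : ∀ n, c n ≤ a + b n) :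
    Tendsto c atTop (𝓝 a) := by
  refine tendsto_of_tendsto_of_tendsto_of_le_of_le ?_ ?_
    (fun n => tsub_le_iff_right.2 (hlo n)) hup
  · have := ENNReal.Tendsto.sub (tendsto_const_nhds (x := a) (f := atTop)) hb (Or.inl ha)
    rwa [tsub_zero] at this
  · have := (tendsto_const_nhds (x := a)).add hb
    rwa [add_zero] at this

lemma tendsto_eLpNorm_two {g : Rd d → ℂ} {u : ℕ → Rd d → ℂ} (hg : MemLp g 2)
    (hu : ∀ n, AEStronglyMeasurable (u n))
    (hlim : Tendsto (fun n => eLpNorm (g - u n) 2) atTop (𝓝 0)) :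
    Tendsto (fun n => eLpNorm (u n) 2) atTop (𝓝 (eLpNorm g 2)) := by
  refine tendsto_of_le_add_of_sub_le hg.2.ne hlim (fun n => ?_)
    (fun n => eLpNorm_two_le_add hg.1 (hu n))
  rw [eLpNorm_sub_comm]
  exact eLpNorm_two_le_add (hu n) hg.1

lemma exists_schwartz_eLpNorm_sub_le {g : Rd d → ℂ} (hg2 : MemLp g 2) {ε : ℝ} (hε : 0 < ε) :
    ∃ s : 𝓢(Rd d, ℂ), eLpNorm (g - ⇑s) 2 ≤ ENNReal.ofReal ε := by
  obtain ⟨s, hs1, hs2, hs3⟩ := hg2.exist_eLpNorm_sub_le (by simp) (by norm_num) hε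
  exact ⟨hs1.toSchwartzMap hs2, hs3⟩

lemma exists_schwartz_tendsto_eLpNorm {g : Rd d → ℂ} (hg2 : MemLp g 2) :
    ∃ s : ℕ → 𝓢(Rd d, ℂ), Tendsto (fun n => eLpNorm (g - ⇑(s n)) 2) atTop (𝓝 0) ∧
      Tendsto (fun n => eLpNorm (s n) 2) atTop (𝓝 (eLpNorm g 2)) := by
  choose s hs using fun n : ℕ =>
    exists_schwartz_eLpNorm_sub_le hg2 (Nat.one_div_pos_of_nat (α := ℝ) (n := n))
  have hlim : Tendsto (fun n => eLpNorm (g - ⇑(s n)) 2) atTop (𝓝 0) := by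
    refine tendsto_of_tendsto_of_tendsto_of_le_of_le tendsto_const_nhds ?_ (fun n => zero_le) hs
    have := ENNReal.tendsto_ofReal (tendsto_one_div_add_atTop_nhds_zero_nat (𝕜 := ℝ))
    rwa [ENNReal.ofReal_zero] at this
  exact ⟨s, hlim, tendsto_eLpNorm_two hg2 (fun n => (s n).continuous.aestronglyMeasurable) hlim⟩

/-- `L²` boundedness of the square function. -/
theorem exists_lintegral_sum_conv_dilate_le (χ : 𝓢(Rd d, ℂ)) (h0 : 𝓕 χ 0 = 0) :
    ∃ C : ℝ, 0 ≤ C ∧ ∀ (v : Rd d) (J : Finset ℤ) (g : Rd d → ℂ), Integrable g → MemLp g 2 →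
      ∫⁻ x, ∑ j ∈ J, ‖conv (dilate j v χ) g x‖ₑ ^ (2 : ℝ) ≤
        ENNReal.ofReal C * ∫⁻ x, ‖g x‖ₑ ^ (2 : ℝ) := by
  obtain ⟨C, hC, h⟩ := exists_lintegral_sum_conv_schwartz_le χ h0
  refine ⟨C, hC, fun v J g hg hg2 => ?_⟩
  have hm : ∀ (j : ℤ) (w : Rd d) (u : Rd d → ℂ), Integrable u →
      Measurable fun x => ‖conv (dilate j w χ) u x‖ₑ ^ (2 : ℝ) := fun j w u hu =>
    (continuous_conv (isKernel_schwartz _) hu).measurable.enorm.pow_const _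
  have hshift : ∫⁻ x, ∑ j ∈ J, ‖conv (dilate j v χ) g x‖ₑ ^ (2 : ℝ) =
      ∫⁻ x, ∑ j ∈ J, ‖conv (dilate j 0 χ) g x‖ₑ ^ (2 : ℝ) := by
    rw [lintegral_finsetSum _ fun j _ => hm j v g hg, lintegral_finsetSum _ fun j _ => hm j 0 g hg]
    refine Finset.sum_congr rfl fun j _ => ?_
    simp only [conv_dilate j v]
    exact lintegral_sub_right_eq_self (fun x => ‖conv (dilate j 0 χ) g x‖ₑ ^ (2 : ℝ)) _
  rw [hshift]
  obtain ⟨s, hlim, hlim2⟩ := exists_schwartz_tendsto_eLpNorm hg2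
  have hsq : ∀ u : Rd d → ℂ, ∫⁻ x, ‖u x‖ₑ ^ (2 : ℝ) = eLpNorm u 2 ^ (2 : ℝ) := fun u => by
    rw [← eLpNorm_rpow_eq_lintegral two_pos, ENNReal.ofReal_ofNat]
  calc ∫⁻ x, ∑ j ∈ J, ‖conv (dilate j 0 χ) g x‖ₑ ^ (2 : ℝ)
      = ∫⁻ x, liminf (fun n => ∑ j ∈ J, ‖conv (dilate j 0 χ) (s n) x‖ₑ ^ (2 : ℝ)) atTop := by
        refine lintegral_congr fun x => (Tendsto.liminf_eq ?_).symm
        refine tendsto_finsetSum _ fun j _ => ?_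
        exact ((ENNReal.continuous_rpow_const (y := 2)).tendsto _).comp
          ((continuous_enorm.tendsto _).comp
          (tendsto_conv_of_tendsto_eLpNorm _ hg (fun n => (s n).integrable) hlim x))
    _ ≤ liminf (fun n => ∫⁻ x, ∑ j ∈ J, ‖conv (dilate j 0 χ) (s n) x‖ₑ ^ (2 : ℝ)) atTop :=
        lintegral_liminf_le fun n => Finset.measurable_fun_sum _ fun j _ =>
          hm j 0 _ (s n).integrable
    _ ≤ liminf (fun n => ENNReal.ofReal C * eLpNorm (s n) 2 ^ (2 : ℝ)) atTop := by
        refine liminf_le_liminf (.of_forall fun n => ?_)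
        rw [← hsq]
        exact h J (s n)
    _ = _ := by
        rw [hsq]
        refine Tendsto.liminf_eq (ENNReal.Tendsto.const_mul ?_ (Or.inr ENNReal.ofReal_ne_top))
        exact ((ENNReal.continuous_rpow_const (y := 2)).tendsto _).comp hlim2

end SquareFunctionL2

section Duality

open scoped SchwartzMap
open Filter Topology

lemma isKernel_conv {κ f : Rd d → ℂ} (hκ : IsKernel κ) (hf : Integrable f) :
    IsKernel (conv κ f) := by
  refine ⟨continuous_conv hκ hf, ?_, ?_⟩
  · have := hf.integrable_convolution (ContinuousLinearMap.mul ℂ ℂ) hκ.integrable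
    refine this.congr (.of_forall fun x => ?_)
    simp only [conv, convolution, ContinuousLinearMap.mul_apply', smul_eq_mul, mul_comm]
  · obtain ⟨M, hM⟩ := hκ.bounded
    refine ⟨∫ y, M * ‖f y‖, fun x => norm_integral_le_of_norm_le (hf.norm.const_mul M)
      (.of_forall fun y => ?_)⟩
    rw [norm_smul]
    exact mul_le_mul_of_nonneg_right (hM _) (norm_nonneg _)

lemma lintegral_rpow_ne_top_of_bounded {E : Type*} [NormedAddCommGroup E] {f : Rd d → E}
    (hf : Integrable f) {M : ℝ} (hM : ∀ x, ‖f x‖ ≤ M) {p : ℝ} (hp : 1 ≤ p) :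
    ∫⁻ x, ‖f x‖ₑ ^ p ≠ ⊤ := by
  have hle : ∀ x, ‖f x‖ₑ ^ p ≤ ENNReal.ofReal M ^ (p - 1) * ‖f x‖ₑ := fun x => by
    have h1 : ‖f x‖ₑ ^ p = ‖f x‖ₑ ^ (p - 1) * ‖f x‖ₑ := by
      nth_rewrite 3 [← ENNReal.rpow_one ‖f x‖ₑ]
      rw [← ENNReal.rpow_add_of_nonneg _ _ (by linarith) zero_le_one, sub_add_cancel]
    rw [h1]
    refine mul_le_mul_left (ENNReal.rpow_le_rpow ?_ (by linarith)) _
    rw [← ofReal_norm]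
    exact ENNReal.ofReal_le_ofReal (hM x)
  refine ne_top_of_le_ne_top ?_ (lintegral_mono hle)
  have hc : ENNReal.ofReal M ^ (p - 1) ≠ ⊤ :=
    ENNReal.rpow_ne_top_of_nonneg (by linarith) ENNReal.ofReal_ne_top
  rw [lintegral_const_mul' _ _ hc]
  exact ENNReal.mul_ne_top hc hf.2.ne

lemma IsKernel.lintegral_rpow_ne_top {f : Rd d → ℂ} (hf : IsKernel f) {p : ℝ} (hp : 1 ≤ p) :
    ∫⁻ x, ‖f x‖ₑ ^ p ≠ ⊤ := by
  obtain ⟨M, hM⟩ := hf.bounded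
  exact lintegral_rpow_ne_top_of_bounded hf.integrable hM hp

lemma memLp_two_of_lintegral_ne_top {E : Type*} [NormedAddCommGroup E] {f : Rd d → E}
    (hf : Integrable f) (h : ∫⁻ x, ‖f x‖ₑ ^ (2 : ℝ) ≠ ⊤) : MemLp f 2 := by
  refine ⟨hf.1, ?_⟩
  rw [← eLpNorm_rpow_eq_lintegral two_pos, ENNReal.ofReal_ofNat] at h
  by_contra h'
  rw [not_lt_top_iff] at h'
  rw [h', ENNReal.top_rpow_of_pos two_pos] at h
  exact h rfl

lemma IsKernel.conj {f : Rd d → ℂ} (hf : IsKernel f) :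
    IsKernel fun x => (starRingEnd ℂ) (f x) := by
  obtain ⟨M, hM⟩ := hf.bounded
  refine ⟨Complex.continuous_conj.comp hf.continuous, ?_, M, fun x => by simpa using hM x⟩
  exact (Complex.conjCLE : ℂ →L[ℝ] ℂ).integrable_comp hf.integrable

lemma IsKernel.comp_neg {f : Rd d → ℂ} (hf : IsKernel f) : IsKernel fun x => f (-x) := by
  obtain ⟨M, hM⟩ := hf.bounded
  exact ⟨hf.continuous.comp continuous_neg, hf.integrable.comp_neg, M, fun x => hM _⟩

lemma isKernel_sum {ι : Type*} (s : Finset ι) {f : ι → Rd d → ℂ} (hf : ∀ i, IsKernel (f i)) :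
    IsKernel fun x => ∑ i ∈ s, f i x := by
  choose M hM using fun i => (hf i).bounded
  exact ⟨continuous_finsetSum _ fun i _ => (hf i).continuous,
    integrable_finsetSum _ fun i _ => (hf i).integrable, ∑ i ∈ s, M i,
    fun x => (norm_sum_le _ _).trans (Finset.sum_le_sum fun i _ => hM i x)⟩

lemma integral_conv_mul {κ f h : Rd d → ℂ} (hκ : IsKernel κ) (hf : Integrable f)
    (hh : Integrable h) :
    ∫ x, conv κ f x * h x = ∫ y, f y * conv (fun z => κ (-z)) h y := by
  obtain ⟨M, hM⟩ := hκ.bounded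
  have hint : Integrable (Function.uncurry fun x y : Rd d => κ (x - y) * (h x * f y))
      (volume.prod volume) := by
    refine (hh.mul_prod hf).bdd_mul (c := M) ?_ (.of_forall fun z => hM _)
    exact (hκ.continuous.comp (continuous_fst.sub continuous_snd)).aestronglyMeasurable
  calc ∫ x, conv κ f x * h x = ∫ x, ∫ y, κ (x - y) * (h x * f y) := by
        refine integral_congr_ae (.of_forall fun x => ?_)
        simp only [conv, smul_eq_mul]
        rw [← integral_mul_const]
        refine integral_congr_ae (.of_forall fun y => ?_)
        simp only
        ring
    _ = ∫ y, ∫ x, κ (x - y) * (h x * f y) := integral_integral_swap hint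
    _ = _ := by
        refine integral_congr_ae (.of_forall fun y => ?_)
        simp only [conv, smul_eq_mul, neg_sub]
        rw [← integral_const_mul]
        refine integral_congr_ae (.of_forall fun x => ?_)
        simp only
        ring

lemma sum_mul_le_sq_mul_sq {ι : Type*} (s : Finset ι) (a b : ι → ℝ≥0∞) :
    ∑ i ∈ s, a i * b i ≤ (∑ i ∈ s, a i ^ (2 : ℝ)) ^ (1 / 2 : ℝ) *
      (∑ i ∈ s, b i ^ (2 : ℝ)) ^ (1 / 2 : ℝ) :=
  ENNReal.inner_le_Lp_mul_Lq s a b Real.HolderConjugate.two_two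

lemma le_rpow_of_le_mul_rpow {X B : ℝ≥0∞} {p q : ℝ} (hpq : p.HolderConjugate q) (hX : X ≠ ⊤)
    (h : X ≤ B * X ^ (1 / q)) : X ≤ B ^ p := by
  rcases eq_or_ne X 0 with rfl | h0
  · exact zero_le
  have hq : 0 < X ^ (1 / q) := ENNReal.rpow_pos (pos_iff_ne_zero.2 h0) hX
  have hq' : X ^ (1 / q) ≠ ⊤ := ENNReal.rpow_ne_top_of_nonneg
    (one_div_nonneg.2 hpq.symm.nonneg) hX
  have h1 : X ^ (1 / p) * X ^ (1 / q) ≤ B * X ^ (1 / q) := by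
    rwa [← ENNReal.rpow_add _ _ h0 hX, hpq.one_div_add_one_div, div_one, ENNReal.rpow_one]
  have h2 : X ^ (1 / p) ≤ B := (ENNReal.mul_le_mul_iff_left hq.ne' hq').1 h1
  calc X = (X ^ (1 / p)) ^ p := by
        rw [← ENNReal.rpow_mul, one_div_mul_cancel hpq.ne_zero, ENNReal.rpow_one]
    _ ≤ B ^ p := ENNReal.rpow_le_rpow h2 hpq.nonneg

end Duality

section SquareFunction

open scoped SchwartzMap
open Filter Topology

/-- The operator norm produced by the Calderón–Zygmund argument for unit kernel constants. -/
def czNorm (d : ℕ) (p q : ℝ) : ℝ := 2 * (strongConst d p q).toReal ^ (1 / p)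

lemma czNorm_nonneg {p q : ℝ} : 0 ≤ czNorm d p q := by unfold czNorm; positivity

lemma ofReal_czNorm_mul_rpow {A p q : ℝ} (hA : 0 ≤ A) (hp : 0 < p) :
    ENNReal.ofReal (czNorm d p q * A) ^ p = ENNReal.ofReal (2 * A) ^ p * strongConst d p q := by
  have h : czNorm d p q * A = 2 * A * (strongConst d p q).toReal ^ (1 / p) := by
    unfold czNorm; ring
  rw [h, ENNReal.ofReal_mul (by positivity), ENNReal.mul_rpow_of_nonneg _ _ hp.le,
    ← ENNReal.ofReal_rpow_of_nonneg (by positivity) (by positivity),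
    ENNReal.ofReal_toReal strongConst_ne_top, ← ENNReal.rpow_mul, one_div_mul_cancel hp.ne',
    ENNReal.rpow_one]

section Weak

variable {E F : Type*} [NormedAddCommGroup E] [NormedSpace ℂ E]
  [NormedAddCommGroup F] [NormedSpace ℂ F]

lemma weakBound_two {ι : Type*} [Fintype ι] {κ : ι → Rd d → ℂ} {L : ι → E →L[ℂ] F} {A : ℝ}
    (hA : 0 < A) (hκ : ∀ i, IsKernel (κ i))
    (h : ∀ g : Rd d → E, Integrable g → (∃ M : ℝ, ∀ x, ‖g x‖ ≤ M) →
      ∫⁻ x, ‖vecConv κ L g x‖ₑ ^ (2 : ℝ) ≤ ENNReal.ofReal A ^ (2 : ℝ) * ∫⁻ x, ‖g x‖ₑ ^ (2 : ℝ)) :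
    WeakBound κ L 2 A := by
  intro g hg a ha hga
  have hA' : ENNReal.ofReal A ^ (2 : ℝ) ≠ 0 := by simp [hA]
  have hA'' : ENNReal.ofReal A ^ (2 : ℝ) ≠ ⊤ := by simp
  have ha' : ENNReal.ofReal a ^ (2 : ℝ) ≠ 0 := by simp [ha]
  have ha'' : ENNReal.ofReal a ^ (2 : ℝ) ≠ ⊤ := by simp
  have hsub : {x | A * a < ‖vecConv κ L g x‖} ⊆
      {x | ENNReal.ofReal A ^ (2 : ℝ) * ENNReal.ofReal a ^ (2 : ℝ) ≤
        ‖vecConv κ L g x‖ₑ ^ (2 : ℝ)} := fun x hx => by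
    rw [Set.mem_ofPred_eq, ← ENNReal.mul_rpow_of_nonneg _ _ two_pos.le,
      ← ENNReal.ofReal_mul hA.le]
    refine ENNReal.rpow_le_rpow ?_ two_pos.le
    rw [← ofReal_norm]
    exact ENNReal.ofReal_le_ofReal (le_of_lt hx)
  have h1 := (mul_meas_ge_le_lintegral (μ := volume)
    ((continuous_vecConv hκ L hg).enorm.measurable.pow_const 2)
    (ENNReal.ofReal A ^ (2 : ℝ) * ENNReal.ofReal a ^ (2 : ℝ))).trans (h g hg ⟨_, hga⟩)
  rw [mul_assoc, ENNReal.mul_le_mul_iff_right hA' hA''] at h1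
  rw [ENNReal.rpow_neg, ← ENNReal.mul_le_iff_le_inv ha' ha'']
  exact (mul_le_mul_right (measure_mono hsub) _).trans h1

lemma lintegral_vecConv_rpow_le_czNorm (hd : 0 < d) [CompleteSpace E] {ι : Type*} [Fintype ι]
    {κ : ι → Rd d → ℂ}
    {L : ι → E →L[ℂ] F} (hL : ∀ i, ‖L i‖ ≤ 1) (hκ : ∀ i, IsKernel (κ i)) {A p q : ℝ} (hA0 : 0 < A)
    (hp : 1 < p) (hpq : p < q) (hA : Hormander κ A) (hW : WeakBound κ L q A)
    {f : Rd d → E} (hf : Continuous f) (hfi : Integrable f) :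
    ∫⁻ x, ‖vecConv κ L f x‖ₑ ^ p ≤ ENNReal.ofReal (czNorm d p q * A) ^ p * ∫⁻ x, ‖f x‖ₑ ^ p := by
  rw [ofReal_czNorm_mul_rpow hA0.le (by linarith)]
  exact lintegral_vecConv_rpow_le hd hL hκ hA0 hp hpq hA hW hf hfi

end Weak

variable {ι : Type} [Fintype ι]

/-- The `ℓ²` norm with values in `ℝ≥0∞`. -/
def ellTwo (a : ι → ℂ) : ℝ≥0∞ := (∑ i, ‖a i‖ₑ ^ (2 : ℝ)) ^ (1 / 2 : ℝ)

lemma ellTwo_rpow_two (a : ι → ℂ) : ellTwo a ^ (2 : ℝ) = ∑ i, ‖a i‖ₑ ^ (2 : ℝ) := by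
  rw [ellTwo, ← ENNReal.rpow_mul]; norm_num

lemma ellTwo_eq_enorm (a : ι → ℂ) : ellTwo a = ‖(WithLp.toLp 2 a : EuclideanSpace ℂ ι)‖ₑ := by
  have h : ‖(WithLp.toLp 2 a : EuclideanSpace ℂ ι)‖ₑ ^ (2 : ℝ) = ∑ i, ‖a i‖ₑ ^ (2 : ℝ) := by
    rw [← ofReal_norm, ENNReal.ofReal_rpow_of_nonneg (norm_nonneg _) two_pos.le, Real.rpow_two,
      EuclideanSpace.norm_sq_eq, ENNReal.ofReal_sum_of_nonneg fun i _ => by positivity]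
    refine Finset.sum_congr rfl fun i _ => ?_
    rw [← ofReal_norm, ENNReal.ofReal_rpow_of_nonneg (norm_nonneg _) two_pos.le, Real.rpow_two]
  rw [ellTwo, ← h, ← ENNReal.rpow_mul]; norm_num

lemma sum_enorm_mul_le_ellTwo (a b : ι → ℂ) : ∑ i, ‖a i‖ₑ * ‖b i‖ₑ ≤ ellTwo a * ellTwo b :=
  sum_mul_le_sq_mul_sq _ _ _

/-- A finite family of kernels with uniform Hörmander and `L²` square function bounds, for the
kernels and for their reflections. -/
structure IsSquareFamily (κ : ι → Rd d → ℂ) (A : ℝ) : Prop where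
  pos : 0 < A
  kernel : ∀ i, IsKernel (κ i)
  hormander : Hormander κ A
  sq_le : ∀ g : Rd d → ℂ, Integrable g → MemLp g 2 →
    ∫⁻ x, ellTwo (fun i => conv (κ i) g x) ^ (2 : ℝ) ≤
      ENNReal.ofReal A ^ (2 : ℝ) * ∫⁻ x, ‖g x‖ₑ ^ (2 : ℝ)

/-- The reflected kernels. -/
def reflect {α : Type} (κ : α → Rd d → ℂ) : α → Rd d → ℂ := fun i x => κ i (-x)

/-- The embedding of the `i`-th coordinate axis. -/
def coordSingle [DecidableEq ι] (i : ι) : ℂ →L[ℂ] EuclideanSpace ℂ ι :=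
  ContinuousLinearMap.toSpanSingleton ℂ (EuclideanSpace.single i 1)

lemma vecConv_coordSingle [DecidableEq ι] (κ : ι → Rd d → ℂ) (f : Rd d → ℂ) (x : Rd d) :
    vecConv κ coordSingle f x = WithLp.toLp 2 (fun i => conv (κ i) f x) := by
  ext j
  simp [vecConv, coordSingle, Finset.sum_apply, Pi.single_apply]

lemma IsSquareFamily.lintegral_ellTwo_rpow_le_of_lt_two (hd : 0 < d) {κ : ι → Rd d → ℂ} {A : ℝ}
    (h : IsSquareFamily κ A) {p : ℝ} (hp : 1 < p) (hp2 : p < 2) {f : Rd d → ℂ}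
    (hf : IsKernel f) :
    ∫⁻ x, ellTwo (fun i => conv (κ i) f x) ^ p ≤
      ENNReal.ofReal (czNorm d p 2 * A) ^ p * ∫⁻ x, ‖f x‖ₑ ^ p := by
  classical
  simp only [ellTwo_eq_enorm, ← vecConv_coordSingle]
  refine lintegral_vecConv_rpow_le_czNorm hd (fun i => ?_) h.kernel h.pos hp hp2 h.hormander
    (weakBound_two h.pos h.kernel fun g hg ⟨M, hM⟩ => ?_) hf.continuous hf.integrable
  · simp [coordSingle]
  · have := h.sq_le g hg (memLp_two_of_lintegral_ne_top hg
      (lintegral_rpow_ne_top_of_bounded hg hM one_le_two))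
    simpa only [ellTwo_eq_enorm, ← vecConv_coordSingle] using this

lemma conv_apply_coord {κ : Rd d → ℂ} (hκ : IsKernel κ)
    {g : Rd d → EuclideanSpace ℂ ι} (hg : Integrable g) (i : ι) (x : Rd d) :
    conv κ g x i = conv κ (fun y => g y i) x := by
  have := ContinuousLinearMap.integral_comp_comm
    (EuclideanSpace.proj i : EuclideanSpace ℂ ι →L[ℂ] ℂ) (hκ.integrable_smul hg x)
  simpa [conv] using this.symm

lemma enorm_integral_ofReal {w : Rd d → ℝ} (hw : ∀ x, 0 ≤ w x) (hi : Integrable w) :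
    ‖∫ x, (w x : ℂ)‖ₑ = ∫⁻ x, ENNReal.ofReal (w x) := by
  rw [integral_complex_ofReal, ← ofReal_norm, Complex.norm_real,
    Real.norm_of_nonneg (integral_nonneg hw),
    ofReal_integral_eq_lintegral_ofReal hi (.of_forall hw)]

lemma aemeasurable_ellTwo {f : ι → Rd d → ℂ} (hf : ∀ i, AEMeasurable (f i)) :
    AEMeasurable fun x => ellTwo fun i => f i x :=
  (Finset.aemeasurable_fun_sum _ fun i _ => (hf i).enorm.pow_const _).pow_const _

/-- `L²` bound for the dual square function. -/
lemma lintegral_sum_conv_sq_le {κ : ι → Rd d → ℂ} {A : ℝ} (hκ : ∀ i, IsKernel (κ i))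
    (h : IsSquareFamily (reflect κ) A) {g : ι → Rd d → ℂ} (hg : ∀ i, Integrable (g i)) :
    ∫⁻ x, ‖∑ i, conv (κ i) (g i) x‖ₑ ^ (2 : ℝ) ≤
      ENNReal.ofReal A ^ (2 : ℝ) * ∫⁻ x, ellTwo (fun i => g i x) ^ (2 : ℝ) := by
  set u : Rd d → ℂ := fun x => ∑ i, conv (κ i) (g i) x with hu
  have huK : IsKernel u := isKernel_sum _ fun i => isKernel_conv (hκ i) (hg i)
  set v : Rd d → ℂ := fun x => (starRingEnd ℂ) (u x) with hv
  have hvK : IsKernel v := huK.conj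
  have hfin := huK.lintegral_rpow_ne_top one_le_two
  have h1 : ∫⁻ x, ‖u x‖ₑ ^ (2 : ℝ) = ‖∫ x, u x * v x‖ₑ := by
    have e : ∀ x, u x * v x = ((‖u x‖ ^ 2 : ℝ) : ℂ) := fun x => by
      simp only [hv, Complex.mul_conj, Complex.normSq_eq_norm_sq]
    have hm : MemLp u ((2 : ℕ) : ℝ≥0∞) := memLp_two_of_lintegral_ne_top huK.integrable hfin
    simp only [e]
    rw [enorm_integral_ofReal (fun x => by positivity) (hm.integrable_norm_pow two_ne_zero)]
    refine lintegral_congr fun x => ?_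
    rw [← ofReal_norm, ENNReal.ofReal_rpow_of_nonneg (norm_nonneg _) two_pos.le, Real.rpow_two]
  have hbd : ∀ i, Integrable fun y => conv (reflect κ i) v y * g i y := fun i => by
    obtain ⟨M, hM⟩ := (isKernel_conv (h.kernel i) hvK.integrable).bounded
    exact (hg i).bdd_mul (c := M)
      (continuous_conv (h.kernel i) hvK.integrable).aestronglyMeasurable (.of_forall hM)
  have h2 : ∫ x, u x * v x = ∫ y, ∑ i, conv (reflect κ i) v y * g i y := by
    rw [integral_finsetSum _ fun i _ => hbd i]
    simp only [hu, Finset.sum_mul]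
    rw [integral_finsetSum]
    · refine Finset.sum_congr rfl fun i _ => ?_
      rw [integral_conv_mul (hκ i) (hg i) hvK.integrable]
      simp only [mul_comm]
      rfl
    · intro i _
      obtain ⟨M, hM⟩ := hvK.bounded
      exact (isKernel_conv (hκ i) (hg i)).integrable.mul_bdd (c := M)
        hvK.continuous.aestronglyMeasurable (.of_forall hM)
  have h3 : ∫⁻ x, ‖u x‖ₑ ^ (2 : ℝ) ≤
      ENNReal.ofReal A * (∫⁻ x, ellTwo (fun i => g i x) ^ (2 : ℝ)) ^ (1 / 2 : ℝ) *
        (∫⁻ x, ‖u x‖ₑ ^ (2 : ℝ)) ^ (1 / 2 : ℝ) := by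
    calc ∫⁻ x, ‖u x‖ₑ ^ (2 : ℝ) = ‖∫ y, ∑ i, conv (reflect κ i) v y * g i y‖ₑ := by rw [h1, h2]
      _ ≤ ∫⁻ y, ‖∑ i, conv (reflect κ i) v y * g i y‖ₑ := enorm_integral_le_lintegral_enorm _
      _ ≤ ∫⁻ y, ellTwo (fun i => conv (reflect κ i) v y) * ellTwo (fun i => g i y) := by
        refine lintegral_mono fun y => (enorm_sum_le _ _).trans ?_
        simp only [enorm_mul]
        exact sum_enorm_mul_le_ellTwo _ _
      _ ≤ (∫⁻ y, ellTwo (fun i => conv (reflect κ i) v y) ^ (2 : ℝ)) ^ (1 / 2 : ℝ) *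
          (∫⁻ y, ellTwo (fun i => g i y) ^ (2 : ℝ)) ^ (1 / 2 : ℝ) := by
        refine ENNReal.lintegral_mul_le_Lp_mul_Lq _ Real.HolderConjugate.two_two
          (aemeasurable_ellTwo fun i =>
            (continuous_conv (h.kernel i) hvK.integrable).aemeasurable)
          (aemeasurable_ellTwo fun i => (hg i).1.aemeasurable)
      _ ≤ (ENNReal.ofReal A ^ (2 : ℝ) * ∫⁻ x, ‖u x‖ₑ ^ (2 : ℝ)) ^ (1 / 2 : ℝ) *
          (∫⁻ y, ellTwo (fun i => g i y) ^ (2 : ℝ)) ^ (1 / 2 : ℝ) := by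
        refine mul_le_mul_left (ENNReal.rpow_le_rpow ?_ (by norm_num)) _
        have := h.sq_le v hvK.integrable (memLp_two_of_lintegral_ne_top hvK.integrable
          (hvK.lintegral_rpow_ne_top one_le_two))
        simpa [hv] using this
      _ = _ := by
        rw [ENNReal.mul_rpow_of_nonneg _ _ (by norm_num), ← ENNReal.rpow_mul]
        norm_num
        ring
  refine (le_rpow_of_le_mul_rpow Real.HolderConjugate.two_two hfin h3).trans (le_of_eq ?_)
  rw [ENNReal.mul_rpow_of_nonneg _ _ two_pos.le, ← ENNReal.rpow_mul]
  norm_num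

lemma integrable_toLp {g : ι → Rd d → ℂ} (hg : ∀ i, Integrable (g i)) :
    Integrable fun x => (WithLp.toLp 2 fun i => g i x : EuclideanSpace ℂ ι) := by
  classical
  have := integrable_finsetSum (μ := (volume : Measure (Rd d))) Finset.univ fun i _ =>
    (coordSingle i).integrable_comp (hg i)
  refine this.congr (.of_forall fun x => ?_)
  ext j
  simp [coordSingle, Pi.single_apply]

/-- `Lᵖ` bound for the dual square function, `1 < p < 2`. -/
lemma lintegral_sum_conv_rpow_le (hd : 0 < d) {κ : ι → Rd d → ℂ} {A : ℝ}
    (h : IsSquareFamily κ A) (h' : IsSquareFamily (reflect κ) A) {p : ℝ} (hp : 1 < p)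
    (hp2 : p < 2) {g : ι → Rd d → ℂ} (hg : ∀ i, IsKernel (g i)) :
    ∫⁻ x, ‖∑ i, conv (κ i) (g i) x‖ₑ ^ p ≤
      ENNReal.ofReal (czNorm d p 2 * A) ^ p * ∫⁻ x, ellTwo (fun i => g i x) ^ p := by
  set G : Rd d → EuclideanSpace ℂ ι := fun x => WithLp.toLp 2 fun i => g i x with hG
  have hL : ∀ (w : Rd d → EuclideanSpace ℂ ι), Integrable w → ∀ x,
      vecConv κ (fun i => (EuclideanSpace.proj i : EuclideanSpace ℂ ι →L[ℂ] ℂ)) w x =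
        ∑ i, conv (κ i) (fun y => w y i) x := fun w hw x =>
    Finset.sum_congr rfl fun i _ => conv_apply_coord (h.kernel i) hw i x
  have hGc : Continuous G :=
    (PiLp.continuous_toLp 2 _).comp (continuous_pi fun i => (hg i).continuous)
  have hGi : Integrable G := integrable_toLp fun i => (hg i).integrable
  have key := lintegral_vecConv_rpow_le_czNorm (p := p) hd
    (L := fun i => (EuclideanSpace.proj i : EuclideanSpace ℂ ι →L[ℂ] ℂ)) (fun i => ?_) h.kernel
    h.pos hp hp2 h.hormander (weakBound_two h.pos h.kernel fun w hw _ => ?_) hGc hGi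
  · simp only [hL G hGi] at key
    simpa only [ellTwo_eq_enorm] using key
  · exact ContinuousLinearMap.opNorm_le_bound _ zero_le_one fun x => by
      simpa using PiLp.norm_apply_le x i
  · simp only [hL w hw]
    have := lintegral_sum_conv_sq_le h.kernel h' (g := fun i y => w y i) fun i =>
      (EuclideanSpace.proj i : EuclideanSpace ℂ ι →L[ℂ] ℂ).integrable_comp hw
    simpa only [ellTwo_eq_enorm] using this

lemma IsSquareFamily.lintegral_ellTwo_sq_le {κ : ι → Rd d → ℂ} {A : ℝ}
    (h : IsSquareFamily κ A) {f : Rd d → ℂ} (hf : IsKernel f) :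
    ∫⁻ x, ellTwo (fun i => conv (κ i) f x) ^ (2 : ℝ) ≤
      ENNReal.ofReal A ^ (2 : ℝ) * ∫⁻ x, ‖f x‖ₑ ^ (2 : ℝ) :=
  h.sq_le f hf.integrable (memLp_two_of_lintegral_ne_top hf.integrable
    (hf.lintegral_rpow_ne_top one_le_two))

lemma reflect_reflect {α : Type} (κ : α → Rd d → ℂ) : reflect (reflect κ) = κ := by
  funext i x
  simp [reflect]

lemma IsKernel.mul_bdd {f b : Rd d → ℂ} (hf : IsKernel f) (hb : Continuous b) {M : ℝ}
    (hM : ∀ x, ‖b x‖ ≤ M) : IsKernel fun x => f x * b x := by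
  obtain ⟨N, hN⟩ := hf.bounded
  refine ⟨hf.continuous.mul hb, hf.integrable.mul_bdd (c := M) hb.aestronglyMeasurable
    (.of_forall hM), N * M, fun x => ?_⟩
  rw [norm_mul]
  exact mul_le_mul (hN x) (hM x) (norm_nonneg _) ((norm_nonneg _).trans (hN x))

lemma ellTwo_conj_mul (a : ι → ℂ) (c : ℂ) :
    ellTwo (fun i => (starRingEnd ℂ) (a i) * c) = ellTwo a * ‖c‖ₑ := by
  simp only [ellTwo, enorm_mul, ENNReal.mul_rpow_of_nonneg _ _ two_pos.le, ← Finset.sum_mul]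
  rw [ENNReal.mul_rpow_of_nonneg _ _ (by norm_num), ← ENNReal.rpow_mul]
  simp

lemma sum_mul_conj_mul (a : ι → ℂ) {p : ℝ} (hp : 2 < p) :
    ∑ i, a i * ((starRingEnd ℂ) (a i) * (((ellTwo a).toReal ^ (p - 2) : ℝ) : ℂ)) =
      (((ellTwo a).toReal ^ p : ℝ) : ℂ) := by
  have h : (ellTwo a).toReal = ‖(WithLp.toLp 2 a : EuclideanSpace ℂ ι)‖ := by
    rw [ellTwo_eq_enorm, toReal_enorm]
  have h2 : ∑ i, a i * (starRingEnd ℂ) (a i) = (((ellTwo a).toReal ^ (2 : ℝ) : ℝ) : ℂ) := by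
    rw [h, Real.rpow_two, EuclideanSpace.norm_sq_eq]
    simp [Complex.mul_conj, Complex.normSq_eq_norm_sq]
  simp only [← mul_assoc]
  rw [← Finset.sum_mul, h2, ← Complex.ofReal_mul, ← Real.rpow_add_of_nonneg
    ENNReal.toReal_nonneg two_pos.le (by linarith), add_sub_cancel]

/-- Duality for a finite family of convolution operators. -/
lemma enorm_integral_sum_conv_mul_le {κ : ι → Rd d → ℂ} (hκ : ∀ i, IsKernel (κ i)) {p q : ℝ}
    (hpq : p.HolderConjugate q) {f : Rd d → ℂ} (hf : IsKernel f) {h : ι → Rd d → ℂ}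
    (hh : ∀ i, IsKernel (h i)) :
    ‖∫ x, ∑ i, conv (κ i) f x * h i x‖ₑ ≤ (∫⁻ x, ‖f x‖ₑ ^ p) ^ (1 / p) *
      (∫⁻ x, ‖∑ i, conv (reflect κ i) (h i) x‖ₑ ^ q) ^ (1 / q) := by
  have hr : ∀ i, IsKernel (conv (reflect κ i) (h i)) := fun i =>
    isKernel_conv (hκ i).comp_neg (hh i).integrable
  have e : ∫ x, ∑ i, conv (κ i) f x * h i x = ∫ x, f x * ∑ i, conv (reflect κ i) (h i) x := by
    simp only [Finset.mul_sum]
    rw [integral_finsetSum, integral_finsetSum]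
    · exact Finset.sum_congr rfl fun i _ =>
        integral_conv_mul (hκ i) hf.integrable (hh i).integrable
    · intro i _
      obtain ⟨M, hM⟩ := (hr i).bounded
      exact (hf.mul_bdd (hr i).continuous hM).integrable
    · intro i _
      obtain ⟨M, hM⟩ := (hh i).bounded
      exact ((isKernel_conv (hκ i) hf.integrable).mul_bdd (hh i).continuous hM).integrable
  rw [e]
  refine (enorm_integral_le_lintegral_enorm _).trans ?_
  simp only [enorm_mul]
  exact ENNReal.lintegral_mul_le_Lp_mul_Lq _ hpq hf.continuous.aemeasurable.enorm
    (continuous_finsetSum _ fun i _ => (hr i).continuous).aemeasurable.enorm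

lemma IsSquareFamily.lintegral_ellTwo_rpow_le_of_two_lt (hd : 0 < d) {κ : ι → Rd d → ℂ} {A : ℝ}
    (h : IsSquareFamily κ A) (h' : IsSquareFamily (reflect κ) A) {p q : ℝ} (hp2 : 2 < p)
    (hpq : p.HolderConjugate q) {f : Rd d → ℂ} (hf : IsKernel f) :
    ∫⁻ x, ellTwo (fun i => conv (κ i) f x) ^ p ≤
      ENNReal.ofReal (czNorm d q 2 * A) ^ p * ∫⁻ x, ‖f x‖ₑ ^ p := by
  have hp0 : 0 < p := by linarith
  have hF : ∀ i, IsKernel (conv (κ i) f) := fun i => isKernel_conv (h.kernel i) hf.integrable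
  set H : Rd d → EuclideanSpace ℂ ι := fun x => WithLp.toLp 2 fun i => conv (κ i) f x with hH
  set S : Rd d → ℝ := fun x => (ellTwo fun i => conv (κ i) f x).toReal with hS
  have hSH : ∀ x, S x = ‖H x‖ := fun x => by simp only [hS, hH, ellTwo_eq_enorm, toReal_enorm]
  have hSe : ∀ x, (ellTwo fun i => conv (κ i) f x) = ENNReal.ofReal (S x) := fun x => by
    rw [hSH, ellTwo_eq_enorm, ofReal_norm]
  have hS0 : ∀ x, 0 ≤ S x := fun x => ENNReal.toReal_nonneg
  have hHi : Integrable H := integrable_toLp fun i => (hF i).integrable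
  have hHc : Continuous H :=
    (PiLp.continuous_toLp 2 _).comp (continuous_pi fun i => (hF i).continuous)
  have hSc : Continuous S := by simpa only [← hSH] using hHc.norm
  obtain ⟨M, hM⟩ : ∃ M : ℝ, ∀ x, S x ≤ M := by
    choose N hN using fun i => (hF i).bounded
    refine ⟨√(∑ i, N i ^ 2), fun x => ?_⟩
    rw [hSH, EuclideanSpace.norm_eq]
    exact Real.sqrt_le_sqrt (Finset.sum_le_sum fun i _ =>
      pow_le_pow_left₀ (norm_nonneg _) (hN i x) 2)
  have hX : ∫⁻ x, (ellTwo fun i => conv (κ i) f x) ^ p ≠ ⊤ := by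
    simp only [ellTwo_eq_enorm]
    exact lintegral_rpow_ne_top_of_bounded hHi (fun x => (hSH x ▸ hM x)) (by linarith)
  have hrp : ∀ x, ‖((S x ^ (p - 2) : ℝ) : ℂ)‖ = S x ^ (p - 2) := fun x => by
    rw [Complex.norm_real, Real.norm_of_nonneg (Real.rpow_nonneg (hS0 x) _)]
  have hh : ∀ i, IsKernel fun x =>
      (starRingEnd ℂ) (conv (κ i) f x) * ((S x ^ (p - 2) : ℝ) : ℂ) := fun i => by
    refine (hF i).conj.mul_bdd (Complex.continuous_ofReal.comp
      (hSc.rpow_const fun x => Or.inr (by linarith))) (M := M ^ (p - 2)) fun x => ?_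
    rw [hrp]
    exact Real.rpow_le_rpow (hS0 x) (hM x) (by linarith)
  have hpow : ∀ x, ENNReal.ofReal (S x ^ p) = (ellTwo fun i => conv (κ i) f x) ^ p := fun x => by
    rw [hSe, ENNReal.ofReal_rpow_of_nonneg (hS0 x) hp0.le]
  have h1 : ∫⁻ x, (ellTwo fun i => conv (κ i) f x) ^ p = ‖∫ x, ∑ i, conv (κ i) f x *
      ((starRingEnd ℂ) (conv (κ i) f x) * ((S x ^ (p - 2) : ℝ) : ℂ))‖ₑ := by
    simp only [hS, sum_mul_conj_mul _ hp2]
    rw [enorm_integral_ofReal (fun x => Real.rpow_nonneg (hS0 x) _)]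
    · exact (lintegral_congr hpow).symm
    · refine ⟨(hSc.rpow_const fun x => Or.inr hp0.le).aestronglyMeasurable, ?_⟩
      refine lt_of_eq_of_lt (lintegral_congr fun x => ?_) hX.lt_top
      rw [← hpow, Real.enorm_of_nonneg (Real.rpow_nonneg (hS0 x) _)]
  have h2 := enorm_integral_sum_conv_mul_le h.kernel hpq hf hh
  rw [← h1] at h2
  have hq2 : q < 2 := by
    have := hpq.symm.sub_one_mul_conj
    have := hpq.symm.lt
    nlinarith
  have h3 := lintegral_sum_conv_rpow_le hd h' (by rwa [reflect_reflect]) hpq.symm.lt hq2 hh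
  have h4 : ∀ x, ellTwo (fun i => (starRingEnd ℂ) (conv (κ i) f x) *
      ((S x ^ (p - 2) : ℝ) : ℂ)) ^ q = (ellTwo fun i => conv (κ i) f x) ^ p := fun x => by
    rw [ellTwo_conj_mul, ← ofReal_norm, hrp, hSe, ← ENNReal.ofReal_rpow_of_nonneg (hS0 x)
      (by linarith)]
    nth_rewrite 1 [← ENNReal.rpow_one (ENNReal.ofReal (S x))]
    rw [← ENNReal.rpow_add_of_nonneg _ _ zero_le_one (by linarith), ← ENNReal.rpow_mul]
    congr 1
    have := hpq.sub_one_mul_conj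
    linarith
  simp only [h4] at h3
  have h5 : ∫⁻ x, (ellTwo fun i => conv (κ i) f x) ^ p ≤
      (ENNReal.ofReal (czNorm d q 2 * A) * (∫⁻ x, ‖f x‖ₑ ^ p) ^ (1 / p)) *
        (∫⁻ x, (ellTwo fun i => conv (κ i) f x) ^ p) ^ (1 / q) := by
    refine h2.trans ((mul_le_mul_right (ENNReal.rpow_le_rpow h3
      (one_div_nonneg.2 hpq.symm.nonneg)) _).trans (le_of_eq ?_))
    rw [ENNReal.mul_rpow_of_nonneg _ _ (one_div_nonneg.2 hpq.symm.nonneg), ← ENNReal.rpow_mul,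
      mul_one_div_cancel hpq.symm.ne_zero, ENNReal.rpow_one]
    ring
  refine (le_rpow_of_le_mul_rpow hpq hX h5).trans (le_of_eq ?_)
  rw [ENNReal.mul_rpow_of_nonneg _ _ hp0.le, ← ENNReal.rpow_mul, one_div_mul_cancel hp0.ne',
    ENNReal.rpow_one]

/-- Littlewood–Paley: `Lᵖ` boundedness of the square function. -/
theorem exists_lintegral_ellTwo_rpow_le (hd : 0 < d) {p : ℝ} (hp : 1 < p) :
    ∃ K : ℝ, 0 ≤ K ∧ ∀ {ι : Type} [Fintype ι] (κ : ι → Rd d → ℂ) (A : ℝ), IsSquareFamily κ A →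
      IsSquareFamily (reflect κ) A → ∀ f : Rd d → ℂ, IsKernel f →
      ∫⁻ x, ellTwo (fun i => conv (κ i) f x) ^ p ≤
        ENNReal.ofReal (K * A) ^ p * ∫⁻ x, ‖f x‖ₑ ^ p := by
  rcases lt_trichotomy p 2 with h2 | rfl | h2
  · exact ⟨_, czNorm_nonneg, fun κ A h _ f hf => h.lintegral_ellTwo_rpow_le_of_lt_two hd hp h2 hf⟩
  · exact ⟨1, zero_le_one, fun κ A h _ f hf => by simpa using h.lintegral_ellTwo_sq_le hf⟩
  · exact ⟨_, czNorm_nonneg, fun κ A h h' f hf => h.lintegral_ellTwo_rpow_le_of_two_lt hd h' h2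
      (Real.HolderConjugate.conjExponent hp) hf⟩

end SquareFunction

section Dilates

open scoped SchwartzMap
open Filter Topology

lemma norm_conv_le {κ g : Rd d → ℂ} (hκ : Integrable κ) {B : ℝ} (hB : ∀ x, ‖g x‖ ≤ B)
    (x : Rd d) : ‖conv κ g x‖ ≤ (∫ y, ‖κ y‖) * B := by
  rw [← integral_sub_left_eq_self (fun y => ‖κ y‖) volume x, ← integral_mul_const]
  refine norm_integral_le_of_norm_le ((hκ.comp_sub_left x).norm.mul_const B)
    (.of_forall fun y => ?_)
  rw [norm_smul]
  exact mul_le_mul_of_nonneg_left (hB y) (norm_nonneg _)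

/-- `Lᵖ` boundedness of maximal convolution operators. -/
theorem lintegral_iSup_conv_rpow_le (hd : 0 < d) {ι : Type} [Fintype ι] {κ : ι → Rd d → ℂ}
    {A p : ℝ} (hp : 1 < p) (hA0 : 0 < A) (hκ : ∀ i, IsKernel (κ i)) (hA : Hormander κ A)
    (h1 : ∀ i, (∫ x, ‖κ i x‖) * 2 ^ d ≤ A) {f : Rd d → ℂ} (hf : IsKernel f) :
    ∫⁻ x, (⨆ i, ‖conv (κ i) f x‖ₑ) ^ p ≤
      ENNReal.ofReal (czNorm d p (p + 1) * A) ^ p * ∫⁻ x, ‖f x‖ₑ ^ p := by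
  classical
  set L : ι → ℂ →L[ℂ] (ι → ℂ) := fun i =>
    ContinuousLinearMap.toSpanSingleton ℂ (Pi.single i 1) with hLdef
  have hL : ∀ (g : Rd d → ℂ) x, vecConv κ L g x = fun i => conv (κ i) g x := fun g x => by
    ext j
    simp [vecConv, hLdef, Finset.sum_apply, Pi.single_apply]
  have hW : WeakBound κ L (p + 1) A := by
    intro g hg a ha hga
    have : {x | A * a < ‖vecConv κ L g x‖} = ∅ := by
      refine Set.eq_empty_of_forall_notMem fun x (hx : A * a < ‖vecConv κ L g x‖) =>
        not_le_of_gt hx ?_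
      rw [hL, pi_norm_le_iff_of_nonneg (by positivity)]
      intro i
      refine (norm_conv_le (hκ i).integrable hga x).trans ?_
      rw [← mul_assoc]
      exact mul_le_mul_of_nonneg_right (h1 i) ha.le
    rw [this, measure_empty]
    exact zero_le
  refine le_trans (lintegral_mono fun x => ENNReal.rpow_le_rpow (iSup_le fun i => ?_)
    (by linarith)) (lintegral_vecConv_rpow_le_czNorm hd (L := L) (fun i => ?_) hκ hA0 hp
    (lt_add_one p) hA hW hf.continuous hf.integrable)
  · rw [hL, ← ofReal_norm, ← ofReal_norm]
    exact ENNReal.ofReal_le_ofReal (norm_le_pi_norm (fun i => conv (κ i) f x) i)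
  · simp only [hLdef, ContinuousLinearMap.norm_toSpanSingleton]
    rw [Pi.norm_single, norm_one]

lemma Hormander.mono {ι : Type} [Fintype ι] {κ : ι → Rd d → ℂ} {A B : ℝ} (h : Hormander κ A)
    (hAB : A ≤ B) : Hormander κ B := fun c y R hy =>
  (h c y R hy).trans (ENNReal.ofReal_le_ofReal hAB)

lemma integral_norm_dilate (j : ℤ) (v : Rd d) (χ : 𝓢(Rd d, ℂ)) :
    ∫ x, ‖dilate j v χ x‖ = ∫ x, ‖χ x‖ := by
  rw [integral_norm_eq_lintegral_enorm (dilate j v χ).continuous.aestronglyMeasurable,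
    integral_norm_eq_lintegral_enorm χ.continuous.aestronglyMeasurable, lintegral_enorm_dilate]

/-- Maximal function of the dilates of a Schwartz function. -/
theorem exists_lintegral_iSup_dilate_le (hd : 0 < d) (χ : 𝓢(Rd d, ℂ)) {p : ℝ} (hp : 1 < p) :
    ∃ C : ℝ, 0 ≤ C ∧ ∀ (v : Rd d) (J : Finset ℤ) (f : Rd d → ℂ), IsKernel f →
      ∫⁻ x, (⨆ j : J, ‖conv (dilate j.1 v χ) f x‖ₑ) ^ p ≤
        ENNReal.ofReal (C * (1 + ‖v‖)) ^ p * ∫⁻ x, ‖f x‖ₑ ^ p := by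
  obtain ⟨C, hC, h⟩ := exists_hormander_dilate χ
  have hI : 0 ≤ ∫ x, ‖χ x‖ := integral_nonneg fun _ => norm_nonneg _
  refine ⟨czNorm d p (p + 1) * (C + (∫ x, ‖χ x‖) * 2 ^ d + 1),
    mul_nonneg czNorm_nonneg (by positivity), fun v J f hf => ?_⟩
  rw [mul_assoc]
  refine lintegral_iSup_conv_rpow_le hd hp (by positivity) (fun j => isKernel_schwartz _)
    ((h v J).mono ?_) (fun j => ?_) hf
  · refine mul_le_mul_of_nonneg_right ?_ (by positivity)
    have : 0 ≤ (∫ x, ‖χ x‖) * 2 ^ d := by positivity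
    linarith
  · rw [integral_norm_dilate]
    have h3 : 0 ≤ (∫ x, ‖χ x‖) * 2 ^ d := by positivity
    nlinarith [norm_nonneg v]

/-- Reflection of a Schwartz function. -/
def schwartzNeg (χ : 𝓢(Rd d, ℂ)) : 𝓢(Rd d, ℂ) :=
  SchwartzMap.compCLMOfContinuousLinearEquiv ℂ (ContinuousLinearEquiv.neg ℝ) χ

lemma schwartzNeg_apply (χ : 𝓢(Rd d, ℂ)) (x : Rd d) : schwartzNeg χ x = χ (-x) := rfl

lemma dilate_neg_apply (j : ℤ) (v : Rd d) (χ : 𝓢(Rd d, ℂ)) (x : Rd d) :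
    dilate j v χ (-x) = dilate j (-v) (schwartzNeg χ) x := by
  simp only [dilate_apply, schwartzNeg_apply]
  congr 2
  simp [neg_add_eq_sub]

lemma fourier_zero_eq_integral (χ : 𝓢(Rd d, ℂ)) : 𝓕 χ 0 = ∫ x, χ x := by
  rw [SchwartzMap.fourier_coe, Real.fourier_eq]
  simp

lemma fourier_schwartzNeg_zero (χ : 𝓢(Rd d, ℂ)) : 𝓕 (schwartzNeg χ) 0 = 𝓕 χ 0 := by
  simp only [fourier_zero_eq_integral, schwartzNeg_apply]
  exact integral_neg_eq_self (fun x => χ x) volume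

lemma exists_isSquareFamily_dilate (χ : 𝓢(Rd d, ℂ)) (h0 : 𝓕 χ 0 = 0) :
    ∃ C : ℝ, 0 ≤ C ∧ ∀ (v : Rd d) (J : Finset ℤ) (B : ℝ), C ≤ B → 0 < B →
      IsSquareFamily (fun j : J => ⇑(dilate j.1 v χ)) (B * (1 + ‖v‖)) := by
  obtain ⟨C, hC, h⟩ := exists_hormander_dilate χ
  obtain ⟨D, hD, h'⟩ := exists_lintegral_sum_conv_dilate_le χ h0
  refine ⟨max C √D, by positivity, fun v J B hB hB0 => ⟨by positivity, fun j => isKernel_schwartz _,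
    (h v J).mono ?_, fun g hg hg2 => ?_⟩⟩
  · exact mul_le_mul_of_nonneg_right ((le_max_left _ _).trans hB) (by positivity)
  · simp only [ellTwo_rpow_two]
    have := h' v J g hg hg2
    simp only [← Finset.sum_coe_sort J] at this
    refine this.trans (mul_le_mul_left ?_ _)
    rw [ENNReal.ofReal_rpow_of_nonneg (by positivity) two_pos.le, Real.rpow_two]
    refine ENNReal.ofReal_le_ofReal ?_
    have h1 : √D ≤ B * (1 + ‖v‖) := by
      have := (le_max_right C √D).trans hB
      nlinarith [norm_nonneg v]
    calc D = √D ^ 2 := (Real.sq_sqrt hD).symm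
      _ ≤ _ := pow_le_pow_left₀ (Real.sqrt_nonneg D) h1 2

/-- Square function of the dilates of a Schwartz function with mean zero. -/
theorem exists_lintegral_ellTwo_dilate_le (hd : 0 < d) (χ : 𝓢(Rd d, ℂ)) (h0 : 𝓕 χ 0 = 0) {p : ℝ}
    (hp : 1 < p) :
    ∃ C : ℝ, 0 ≤ C ∧ ∀ (v : Rd d) (J : Finset ℤ) (f : Rd d → ℂ), IsKernel f →
      ∫⁻ x, ellTwo (fun j : J => conv (dilate j.1 v χ) f x) ^ p ≤
        ENNReal.ofReal (C * (1 + ‖v‖)) ^ p * ∫⁻ x, ‖f x‖ₑ ^ p := by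
  obtain ⟨C, hC, h⟩ := exists_isSquareFamily_dilate χ h0
  obtain ⟨D, hD, h'⟩ := exists_isSquareFamily_dilate (schwartzNeg χ)
    ((fourier_schwartzNeg_zero χ).trans h0)
  obtain ⟨K, hK, hmain⟩ := exists_lintegral_ellTwo_rpow_le (p := p) hd hp
  refine ⟨K * (C + D + 1), by positivity, fun v J f hf => ?_⟩
  rw [mul_assoc]
  refine hmain _ _ (h v J _ (by linarith) (by positivity)) ?_ f hf
  have := h' (-v) J (C + D + 1) (by linarith) (by positivity)
  rw [norm_neg] at this
  convert this using 1
  funext j x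
  exact dilate_neg_apply _ _ _ _

end Dilates

section Trilinear

open scoped SchwartzMap

lemma lintegral_mul_mul_le {a b c : Rd d → ℝ≥0∞} (ha : AEMeasurable a) (hb : AEMeasurable b)
    (hc : AEMeasurable c) {p q r : ℝ} (hp : 0 < p) (hq : 0 < q) (hr : 0 < r)
    (h : 1 / p + 1 / q + 1 / r = 1) :
    ∫⁻ x, a x * b x * c x ≤ (∫⁻ x, a x ^ p) ^ (1 / p) * (∫⁻ x, b x ^ q) ^ (1 / q) *
      (∫⁻ x, c x ^ r) ^ (1 / r) := by
  have := ENNReal.lintegral_prod_norm_pow_le (μ := (volume : Measure (Rd d))) Finset.univ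
    (f := ![fun x => a x ^ p, fun x => b x ^ q, fun x => c x ^ r])
    (p := ![1 / p, 1 / q, 1 / r]) (fun i _ => ?_) ?_ (fun i _ => ?_)
  · simpa [Fin.prod_univ_three, ← ENNReal.rpow_mul, hp.ne', hq.ne', hr.ne'] using this
  · fin_cases i
    exacts [ha.pow_const p, hb.pow_const q, hc.pow_const r]
  · simpa [Fin.sum_univ_three] using h
  · fin_cases i
    exacts [(one_div_pos.2 hp).le, (one_div_pos.2 hq).le, (one_div_pos.2 hr).le]

lemma sum_enorm_mul_mul_le {ι : Type} [Fintype ι] (a b c : ι → ℂ) :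
    ∑ i, ‖a i‖ₑ * ‖b i‖ₑ * ‖c i‖ₑ ≤ ellTwo a * ellTwo b * ⨆ i, ‖c i‖ₑ := by
  calc ∑ i, ‖a i‖ₑ * ‖b i‖ₑ * ‖c i‖ₑ ≤ ∑ i, ‖a i‖ₑ * ‖b i‖ₑ * ⨆ i, ‖c i‖ₑ :=
        Finset.sum_le_sum fun i _ => mul_le_mul_right (le_iSup (fun i => ‖c i‖ₑ) i) _
    _ = (∑ i, ‖a i‖ₑ * ‖b i‖ₑ) * ⨆ i, ‖c i‖ₑ := by rw [Finset.sum_mul]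
    _ ≤ _ := mul_le_mul_left (sum_enorm_mul_le_ellTwo a b) _

lemma rpow_one_div_le_of_le {X Y A : ℝ≥0∞} {p : ℝ} (hp : 0 < p) (h : X ≤ A ^ p * Y) :
    X ^ (1 / p) ≤ A * Y ^ (1 / p) := by
  have := ENNReal.rpow_le_rpow h (one_div_pos.2 hp).le
  rwa [ENNReal.mul_rpow_of_nonneg _ _ (one_div_pos.2 hp).le, ← ENNReal.rpow_mul,
    mul_one_div_cancel hp.ne', ENNReal.rpow_one] at this

/-- The trilinear estimate, with mean-zero conditions on the first two functions. -/
theorem exists_lintegral_trilinear_le (hd : 0 < d) {χ₁ χ₂ : 𝓢(Rd d, ℂ)} (χ₃ : 𝓢(Rd d, ℂ))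
    (h₁ : 𝓕 χ₁ 0 = 0) (h₂ : 𝓕 χ₂ 0 = 0) {p q r : ℝ} (hp : 1 < p) (hq : 1 < q) (hr : 1 < r)
    (h : 1 / p + 1 / q + 1 / r = 1) :
    ∃ C : ℝ, 0 ≤ C ∧ ∀ (v₁ v₂ v₃ : Rd d) (J : Finset ℤ) (f₁ f₂ f₃ : Rd d → ℂ),
      IsKernel f₁ → IsKernel f₂ → IsKernel f₃ →
      ∫⁻ x, ∑ j ∈ J, ‖conv (dilate j v₁ χ₁) f₁ x‖ₑ * ‖conv (dilate j v₂ χ₂) f₂ x‖ₑ *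
        ‖conv (dilate j v₃ χ₃) f₃ x‖ₑ ≤
      ENNReal.ofReal (C * ((1 + ‖v₁‖) * (1 + ‖v₂‖) * (1 + ‖v₃‖))) *
        ((∫⁻ x, ‖f₁ x‖ₑ ^ p) ^ (1 / p) * (∫⁻ x, ‖f₂ x‖ₑ ^ q) ^ (1 / q) *
          (∫⁻ x, ‖f₃ x‖ₑ ^ r) ^ (1 / r)) := by
  obtain ⟨C₁, hC₁, H₁⟩ := exists_lintegral_ellTwo_dilate_le hd χ₁ h₁ hp
  obtain ⟨C₂, hC₂, H₂⟩ := exists_lintegral_ellTwo_dilate_le hd χ₂ h₂ hq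
  obtain ⟨C₃, hC₃, H₃⟩ := exists_lintegral_iSup_dilate_le hd χ₃ hr
  have hp0 : 0 < p := by linarith
  have hq0 : 0 < q := by linarith
  have hr0 : 0 < r := by linarith
  refine ⟨C₁ * C₂ * C₃, by positivity, fun v₁ v₂ v₃ J f₁ f₂ f₃ hf₁ hf₂ hf₃ => ?_⟩
  have hm : ∀ (v : Rd d) (χ : 𝓢(Rd d, ℂ)) (f : Rd d → ℂ), IsKernel f → ∀ j : J,
      Measurable (conv (dilate j.1 v χ) f) := fun v χ f hf j =>
    (continuous_conv (isKernel_schwartz _) hf.integrable).measurable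
  simp only [← Finset.sum_coe_sort J]
  refine (lintegral_mono fun x => sum_enorm_mul_mul_le (fun j : J => conv (dilate j.1 v₁ χ₁) f₁ x)
    (fun j : J => conv (dilate j.1 v₂ χ₂) f₂ x)
    (fun j : J => conv (dilate j.1 v₃ χ₃) f₃ x)).trans ?_
  refine (lintegral_mul_mul_le (aemeasurable_ellTwo fun j => (hm v₁ χ₁ f₁ hf₁ j).aemeasurable)
    (aemeasurable_ellTwo fun j => (hm v₂ χ₂ f₂ hf₂ j).aemeasurable)
    (Measurable.iSup fun j => (hm v₃ χ₃ f₃ hf₃ j).enorm).aemeasurable hp0 hq0 hr0 h).trans ?_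
  refine (mul_le_mul' (mul_le_mul' (rpow_one_div_le_of_le hp0 (H₁ v₁ J f₁ hf₁))
    (rpow_one_div_le_of_le hq0 (H₂ v₂ J f₂ hf₂)))
    (rpow_one_div_le_of_le hr0 (H₃ v₃ J f₃ hf₃))).trans (le_of_eq ?_)
  have e : C₁ * C₂ * C₃ * ((1 + ‖v₁‖) * (1 + ‖v₂‖) * (1 + ‖v₃‖)) =
      C₁ * (1 + ‖v₁‖) * (C₂ * (1 + ‖v₂‖)) * (C₃ * (1 + ‖v₃‖)) := by ring
  rw [e, ENNReal.ofReal_mul (p := C₁ * (1 + ‖v₁‖) * (C₂ * (1 + ‖v₂‖))) (by positivity),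
    ENNReal.ofReal_mul (p := C₁ * (1 + ‖v₁‖)) (by positivity)]
  ac_rfl

end Trilinear

section FourierIdentities

open scoped SchwartzMap
open Filter Topology

/-- The trilinear estimate, with mean-zero conditions on two of the three functions. -/
theorem exists_lintegral_trilinear_le_of_two (hd : 0 < d) {χ₁ χ₂ χ₃ : 𝓢(Rd d, ℂ)}
    (h0 : (𝓕 χ₁ 0 = 0 ∧ 𝓕 χ₂ 0 = 0) ∨ (𝓕 χ₁ 0 = 0 ∧ 𝓕 χ₃ 0 = 0) ∨ (𝓕 χ₂ 0 = 0 ∧ 𝓕 χ₃ 0 = 0))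
    {p q r : ℝ} (hp : 1 < p) (hq : 1 < q) (hr : 1 < r)
    (h : 1 / p + 1 / q + 1 / r = 1) :
    ∃ C : ℝ, 0 ≤ C ∧ ∀ (v₁ v₂ v₃ : Rd d) (J : Finset ℤ) (f₁ f₂ f₃ : Rd d → ℂ),
      IsKernel f₁ → IsKernel f₂ → IsKernel f₃ →
      ∫⁻ x, ∑ j ∈ J, ‖conv (dilate j v₁ χ₁) f₁ x‖ₑ * ‖conv (dilate j v₂ χ₂) f₂ x‖ₑ *
        ‖conv (dilate j v₃ χ₃) f₃ x‖ₑ ≤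
      ENNReal.ofReal (C * ((1 + ‖v₁‖) * (1 + ‖v₂‖) * (1 + ‖v₃‖))) *
        ((∫⁻ x, ‖f₁ x‖ₑ ^ p) ^ (1 / p) * (∫⁻ x, ‖f₂ x‖ₑ ^ q) ^ (1 / q) *
          (∫⁻ x, ‖f₃ x‖ₑ ^ r) ^ (1 / r)) := by
  rcases h0 with ⟨h1, h2⟩ | ⟨h1, h3⟩ | ⟨h2, h3⟩
  · exact exists_lintegral_trilinear_le hd χ₃ h1 h2 hp hq hr h
  · obtain ⟨C, hC, H⟩ := exists_lintegral_trilinear_le hd χ₂ h1 h3 hp hr hq (by linarith)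
    refine ⟨C, hC, fun v₁ v₂ v₃ J f₁ f₂ f₃ hf₁ hf₂ hf₃ => ?_⟩
    have := H v₁ v₃ v₂ J f₁ f₃ f₂ hf₁ hf₃ hf₂
    rw [mul_right_comm (1 + ‖v₁‖), mul_right_comm (_ ^ (1 / p))] at this
    simpa only [mul_right_comm ‖conv _ f₁ _‖ₑ] using this
  · obtain ⟨C, hC, H⟩ := exists_lintegral_trilinear_le hd χ₁ h2 h3 hq hr hp (by linarith)
    refine ⟨C, hC, fun v₁ v₂ v₃ J f₁ f₂ f₃ hf₁ hf₂ hf₃ => ?_⟩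
    have := H v₂ v₃ v₁ J f₂ f₃ f₁ hf₂ hf₃ hf₁
    rw [mul_comm _ (1 + ‖v₁‖), mul_comm _ (_ ^ (1 / p)), ← mul_assoc, ← mul_assoc] at this
    simpa only [mul_comm _ ‖conv _ f₁ _‖ₑ, ← mul_assoc] using this

/-- The complex-valued character `t ↦ exp (2πit)`. -/
def expChar (t : ℝ) : ℂ := Real.fourierChar t

lemma expChar_add (s t : ℝ) : expChar (s + t) = expChar s * expChar t := by
  simp [expChar, AddChar.map_add_eq_mul]

lemma norm_expChar (t : ℝ) : ‖expChar t‖ = 1 := Circle.norm_coe _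

lemma continuous_expChar : Continuous expChar :=
  continuous_subtype_val.comp Real.continuous_fourierChar

lemma fourierInv_eq_integral_expChar (u : Rd d → ℂ) (x : Rd d) :
    𝓕⁻ u x = ∫ ξ, expChar (inner ℝ ξ x) * u ξ := by
  rw [Real.fourierInv_eq]
  rfl

lemma integral_expChar_mul_conv {κ : Rd d → ℂ} (x ζ : Rd d) :
    ∫ y, κ (x - y) * expChar (inner ℝ ζ y) = expChar (inner ℝ ζ x) * 𝓕 κ ζ := by
  have h := integral_sub_left_eq_self
    (fun y => expChar (inner ℝ ζ x) * (expChar (-inner ℝ y ζ) * κ y)) volume x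
  rw [Real.fourier_eq]
  change _ = _ * ∫ y, expChar (-inner ℝ y ζ) * κ y
  rw [← integral_const_mul, ← h]
  refine integral_congr_ae (.of_forall fun y => ?_)
  simp only
  rw [← mul_assoc, ← expChar_add, inner_sub_left, real_inner_comm ζ x, real_inner_comm ζ y,
    mul_comm]
  congr 2
  ring

lemma conv_dilate_eq_integral (j : ℤ) (v : Rd d) (χ f : 𝓢(Rd d, ℂ)) (y : Rd d) :
    conv (dilate j (-v) χ) f y = ∫ ξ, expChar (inner ℝ ξ y) *
      (expChar (inner ℝ ξ (((2 : ℝ) ^ j)⁻¹ • v)) * 𝓕 χ (((2 : ℝ) ^ j)⁻¹ • ξ) * 𝓕 f ξ) := by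
  rw [conv_dilate, conv_eq_convolution, smul_neg, sub_neg_eq_add]
  set w := SchwartzMap.convolution (ContinuousLinearMap.mul ℂ ℂ) f (dilate j 0 χ) with hw
  have h : w = 𝓕⁻ (𝓕 w) := by simp
  rw [h, SchwartzMap.fourierInv_coe, fourierInv_eq_integral_expChar]
  refine integral_congr_ae (.of_forall fun ξ => ?_)
  simp only [hw, fourier_convolution_schwartz, fourier_dilate_zero]
  rw [inner_add_right, expChar_add]
  ring

lemma conv_mul_fourierInv {κ A B : Rd d → ℂ} (hκ : IsKernel κ) (hA : Integrable A)
    (hB : Integrable B) (x : Rd d) :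
    conv κ (fun y => 𝓕⁻ A y * 𝓕⁻ B y) x =
      ∫ z : Rd d × Rd d, expChar (inner ℝ (z.1 + z.2) x) * 𝓕 κ (z.1 + z.2) * (A z.1 * B z.2) := by
  have hAB : Integrable fun z : Rd d × Rd d => A z.1 * B z.2 := hA.mul_prod hB
  have h1 : ∀ y, 𝓕⁻ A y * 𝓕⁻ B y =
      ∫ z : Rd d × Rd d, expChar (inner ℝ (z.1 + z.2) y) * (A z.1 * B z.2) := fun y => by
    rw [fourierInv_eq_integral_expChar, fourierInv_eq_integral_expChar, ← integral_prod_mul]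
    refine integral_congr_ae (.of_forall fun z => ?_)
    simp only [inner_add_left, expChar_add]
    ring
  have hint : Integrable (Function.uncurry fun (y : Rd d) (z : Rd d × Rd d) =>
      expChar (inner ℝ (z.1 + z.2) y) * (κ (x - y) * (A z.1 * B z.2))) (volume.prod volume) := by
    refine ((hκ.integrable.comp_sub_left x).mul_prod hAB).bdd_mul (c := 1) ?_
      (.of_forall fun z => (norm_expChar _).le)
    exact (continuous_expChar.comp (by fun_prop)).aestronglyMeasurable
  calc conv κ (fun y => 𝓕⁻ A y * 𝓕⁻ B y) x
      = ∫ y, ∫ z : Rd d × Rd d,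
          expChar (inner ℝ (z.1 + z.2) y) * (κ (x - y) * (A z.1 * B z.2)) := by
        refine integral_congr_ae (.of_forall fun y => ?_)
        simp only [h1, smul_eq_mul]
        rw [← integral_const_mul]
        refine integral_congr_ae (.of_forall fun z => ?_)
        simp only
        ring
    _ = ∫ z : Rd d × Rd d, ∫ y,
          expChar (inner ℝ (z.1 + z.2) y) * (κ (x - y) * (A z.1 * B z.2)) :=
        integral_integral_swap hint
    _ = _ := by
        refine integral_congr_ae (.of_forall fun z => ?_)
        simp only
        rw [← integral_expChar_mul_conv, ← integral_mul_const]
        refine integral_congr_ae (.of_forall fun y => ?_)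
        simp only
        ring

end FourierIdentities

section Paraproduct

open scoped SchwartzMap

lemma integral_mul_integral_integral_comm {X V Z : Type*} [MeasurableSpace X] [MeasurableSpace V]
    [MeasurableSpace Z] {μ : Measure X} {ν : Measure V} {ρ : Measure Z} [SFinite μ] [SFinite ν]
    [SFinite ρ] {h : X → ℂ} {k : V → ℂ} {w : Z → ℂ} (hh : Integrable h μ) (hk : Integrable k ν)
    (hw : Integrable w ρ) {q : X × V × Z → ℂ} (hq : AEStronglyMeasurable q (μ.prod (ν.prod ρ)))
    {M : ℝ} (hM : ∀ t, ‖q t‖ ≤ M) (hq' : ∀ x, AEStronglyMeasurable (fun t => q (x, t)) (ν.prod ρ)) :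
    ∫ x, h x * ∫ z, (∫ v, k v * q (x, v, z) ∂ν) * w z ∂ρ ∂μ =
      ∫ v, k v * ∫ x, h x * ∫ z, q (x, v, z) * w z ∂ρ ∂μ ∂ν := by
  have hkw : Integrable (fun t : V × Z => k t.1 * w t.2) (ν.prod ρ) := hk.mul_prod hw
  have h3 : Integrable (fun t : X × V × Z => q t * (h t.1 * (k t.2.1 * w t.2.2)))
      (μ.prod (ν.prod ρ)) := (hh.mul_prod hkw).bdd_mul (c := M) hq (.of_forall hM)
  have h4 : Integrable (fun t : (X × V) × Z =>
      q (t.1.1, t.1.2, t.2) * (h t.1.1 * (k t.1.2 * w t.2))) ((μ.prod ν).prod ρ) :=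
    ((measurePreserving_prodAssoc μ ν ρ).integrable_comp_emb
      MeasurableEquiv.prodAssoc.measurableEmbedding).2 h3
  have h5 := h4.integral_prod_left
  have hx : ∀ x, ∫ z, (∫ v, k v * q (x, v, z) ∂ν) * w z ∂ρ =
      ∫ v, ∫ z, q (x, v, z) * (k v * w z) ∂ρ ∂ν := fun x => by
    rw [integral_integral_swap (hkw.bdd_mul (c := M) (hq' x) (.of_forall fun t => hM _))]
    refine integral_congr_ae (.of_forall fun z => ?_)
    simp only
    rw [← integral_mul_const]
    exact integral_congr_ae (.of_forall fun v => by ring)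
  calc ∫ x, h x * ∫ z, (∫ v, k v * q (x, v, z) ∂ν) * w z ∂ρ ∂μ
      = ∫ x, ∫ v, ∫ z, q (x, v, z) * (h x * (k v * w z)) ∂ρ ∂ν ∂μ := by
        refine integral_congr_ae (.of_forall fun x => ?_)
        simp only
        rw [hx, ← integral_const_mul]
        refine integral_congr_ae (.of_forall fun v => ?_)
        simp only
        rw [← integral_const_mul]
        exact integral_congr_ae (.of_forall fun z => by ring)
    _ = ∫ v, ∫ x, ∫ z, q (x, v, z) * (h x * (k v * w z)) ∂ρ ∂μ ∂ν := integral_integral_swap h5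
    _ = _ := by
        refine integral_congr_ae (.of_forall fun v => ?_)
        simp only
        rw [← integral_const_mul]
        refine integral_congr_ae (.of_forall fun x => ?_)
        simp only
        rw [← integral_const_mul, ← integral_const_mul]
        exact integral_congr_ae (.of_forall fun z => by ring)

lemma sum_lintegral_le {X ι : Type*} [MeasurableSpace X] {μ : Measure X} (s : Finset ι)
    (F : ι → X → ℝ≥0∞) : ∑ i ∈ s, ∫⁻ x, F i x ∂μ ≤ ∫⁻ x, ∑ i ∈ s, F i x ∂μ := by
  classical
  induction s using Finset.induction_on with
  | empty => simp
  | insert i s hi ih =>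
    simp only [Finset.sum_insert hi]
    exact (add_le_add_right ih _).trans (le_lintegral_add _ _)

/-- The symbol, at scale `2 ^ j`, obtained by superposing characters with amplitude `k` and
localising with the Fourier transforms of `χ₁`, `χ₂`, `χ₃`. -/
def pieceSymbol (χ₁ χ₂ χ₃ : 𝓢(Rd d, ℂ)) (k : Rd d × Rd d → ℂ) (j : ℤ) (z : Rd d × Rd d) : ℂ :=
  (∫ v : Rd d × Rd d, k v * (expChar (inner ℝ z.1 (((2 : ℝ) ^ j)⁻¹ • v.1)) *
    expChar (inner ℝ z.2 (((2 : ℝ) ^ j)⁻¹ • v.2)))) *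
  (𝓕 χ₁ (((2 : ℝ) ^ j)⁻¹ • z.1) * 𝓕 χ₂ (((2 : ℝ) ^ j)⁻¹ • z.2) *
    𝓕 χ₃ (((2 : ℝ) ^ j)⁻¹ • (z.1 + z.2)))

lemma conv_mul_conv_dilate (χ₁ χ₂ χ₃ f g : 𝓢(Rd d, ℂ)) (j : ℤ) (v : Rd d × Rd d) (x : Rd d) :
    conv (dilate j 0 χ₃) (fun y => conv (dilate j (-v.1) χ₁) f y *
      conv (dilate j (-v.2) χ₂) g y) x =
    ∫ z : Rd d × Rd d, expChar (inner ℝ (z.1 + z.2) x) *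
      ((expChar (inner ℝ z.1 (((2 : ℝ) ^ j)⁻¹ • v.1)) *
      expChar (inner ℝ z.2 (((2 : ℝ) ^ j)⁻¹ • v.2))) *
      (𝓕 χ₁ (((2 : ℝ) ^ j)⁻¹ • z.1) * 𝓕 χ₂ (((2 : ℝ) ^ j)⁻¹ • z.2) *
      𝓕 χ₃ (((2 : ℝ) ^ j)⁻¹ • (z.1 + z.2)))) * (𝓕 f z.1 * 𝓕 g z.2) := by
  have hint : ∀ (w : Rd d) (χ u : 𝓢(Rd d, ℂ)), Integrable fun ξ : Rd d =>
      expChar (inner ℝ ξ (((2 : ℝ) ^ j)⁻¹ • w)) * 𝓕 χ (((2 : ℝ) ^ j)⁻¹ • ξ) * 𝓕 u ξ :=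
    fun w χ u => by
    obtain ⟨M, hM⟩ := (isKernel_schwartz (𝓕 χ)).bounded
    refine (𝓕 u).integrable.bdd_mul (c := M) ?_ (.of_forall fun ξ => ?_)
    · exact ((continuous_expChar.comp (by fun_prop)).mul
        ((𝓕 χ).continuous.comp (continuous_const_smul _))).aestronglyMeasurable
    · rw [norm_mul, norm_expChar, one_mul]
      exact hM _
  have h := conv_mul_fourierInv (isKernel_schwartz (dilate j 0 χ₃)) (hint v.1 χ₁ f)
    (hint v.2 χ₂ g) x
  simp only [fourierInv_eq_integral_expChar, ← conv_dilate_eq_integral] at h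
  rw [h]
  refine integral_congr_ae (.of_forall fun z => ?_)
  simp only [← SchwartzMap.fourier_coe, fourier_dilate_zero]
  ring

lemma integral_mul_integral_pieceSymbol (χ₁ χ₂ χ₃ f g : 𝓢(Rd d, ℂ)) {k : Rd d × Rd d → ℂ}
    (hk : Integrable k) (j : ℤ) {h : Rd d → ℂ} (hh : IsKernel h) :
    ∫ x, h x * ∫ z : Rd d × Rd d, expChar (inner ℝ (z.1 + z.2) x) *
      pieceSymbol χ₁ χ₂ χ₃ k j z * (𝓕 f z.1 * 𝓕 g z.2) =
    ∫ v : Rd d × Rd d, k v * ∫ y, conv (dilate j (-v.1) χ₁) f y * conv (dilate j (-v.2) χ₂) g y *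
      conv (dilate j 0 (schwartzNeg χ₃)) h y := by
  obtain ⟨M₁, hM₁⟩ := (isKernel_schwartz (𝓕 χ₁)).bounded
  obtain ⟨M₂, hM₂⟩ := (isKernel_schwartz (𝓕 χ₂)).bounded
  obtain ⟨M₃, hM₃⟩ := (isKernel_schwartz (𝓕 χ₃)).bounded
  set q : Rd d × (Rd d × Rd d) × (Rd d × Rd d) → ℂ := fun t =>
    expChar (inner ℝ (t.2.2.1 + t.2.2.2) t.1) *
      ((expChar (inner ℝ t.2.2.1 (((2 : ℝ) ^ j)⁻¹ • t.2.1.1)) *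
      expChar (inner ℝ t.2.2.2 (((2 : ℝ) ^ j)⁻¹ • t.2.1.2))) *
      (𝓕 χ₁ (((2 : ℝ) ^ j)⁻¹ • t.2.2.1) * 𝓕 χ₂ (((2 : ℝ) ^ j)⁻¹ • t.2.2.2) *
      𝓕 χ₃ (((2 : ℝ) ^ j)⁻¹ • (t.2.2.1 + t.2.2.2)))) with hqdef
  have hq : Continuous q := by
    refine (continuous_expChar.comp (by fun_prop)).mul (((continuous_expChar.comp
      (by fun_prop)).mul (continuous_expChar.comp (by fun_prop))).mul
      ((((𝓕 χ₁).continuous.comp (by fun_prop)).mul ((𝓕 χ₂).continuous.comp (by fun_prop))).mul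
      ((𝓕 χ₃).continuous.comp (by fun_prop))))
  have hqM : ∀ t, ‖q t‖ ≤ M₁ * M₂ * M₃ := fun t => by
    simp only [hqdef, norm_mul, norm_expChar, one_mul]
    have h1 := (norm_nonneg _).trans (hM₁ 0)
    have h2 := (norm_nonneg _).trans (hM₂ 0)
    have := hM₁ (((2 : ℝ) ^ j)⁻¹ • t.2.2.1)
    have := hM₂ (((2 : ℝ) ^ j)⁻¹ • t.2.2.2)
    have := hM₃ (((2 : ℝ) ^ j)⁻¹ • (t.2.2.1 + t.2.2.2))
    gcongr
  have hw : Integrable fun z : Rd d × Rd d => 𝓕 f z.1 * 𝓕 g z.2 :=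
    (𝓕 f).integrable.mul_prod (𝓕 g).integrable
  have key := integral_mul_integral_integral_comm (μ := volume) (ν := volume) (ρ := volume)
    hh.integrable hk hw hq.aestronglyMeasurable hqM
    fun x => (hq.comp (by fun_prop)).aestronglyMeasurable
  refine Eq.trans ?_ (key.trans ?_)
  · refine integral_congr_ae (.of_forall fun x => ?_)
    simp only
    congr 1
    refine integral_congr_ae (.of_forall fun z => ?_)
    simp only [pieceSymbol, hqdef]
    congr 1
    rw [← integral_mul_const, ← integral_const_mul]
    refine integral_congr_ae (.of_forall fun v => ?_)
    simp only
    ring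
  · refine integral_congr_ae (.of_forall fun v => ?_)
    simp only
    congr 1
    have hF := isKernel_conv (isKernel_schwartz (dilate j (-v.1) χ₁)) f.integrable
    have hG := isKernel_conv (isKernel_schwartz (dilate j (-v.2) χ₂)) g.integrable
    obtain ⟨M, hM⟩ := hG.bounded
    have h2 := integral_conv_mul (isKernel_schwartz (dilate j 0 χ₃))
      (hF.mul_bdd hG.continuous hM).integrable hh.integrable
    simp only [dilate_neg_apply, neg_zero] at h2
    refine Eq.trans ?_ h2
    refine integral_congr_ae (.of_forall fun x => ?_)
    simp only [hqdef]
    rw [conv_mul_conv_dilate, mul_comm]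

/-- Uniform bound for the trilinear forms attached to finite sums of pieces. -/
theorem exists_enorm_sum_pieceSymbol_le (hd : 0 < d) {χ₁ χ₂ χ₃ : 𝓢(Rd d, ℂ)}
    (h0 : (𝓕 χ₁ 0 = 0 ∧ 𝓕 χ₂ 0 = 0) ∨ (𝓕 χ₁ 0 = 0 ∧ 𝓕 χ₃ 0 = 0) ∨ (𝓕 χ₂ 0 = 0 ∧ 𝓕 χ₃ 0 = 0))
    {p q r : ℝ} (hp : 1 < p) (hq : 1 < q) (hr : 1 < r) (h : 1 / p + 1 / q + 1 / r = 1)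
    {K : Rd d × Rd d → ℝ} (hK : Integrable fun v => K v * ((1 + ‖v.1‖) * (1 + ‖v.2‖))) :
    ∃ C : ℝ, 0 ≤ C ∧ ∀ k : ℤ → Rd d × Rd d → ℂ, (∀ j, Integrable (k j)) →
      (∀ j v, ‖k j v‖ ≤ K v) → ∀ (J : Finset ℤ) (f g : 𝓢(Rd d, ℂ)) (u : Rd d → ℂ), IsKernel u →
      ‖∑ j ∈ J, ∫ x, u x * ∫ z : Rd d × Rd d, expChar (inner ℝ (z.1 + z.2) x) *
        pieceSymbol χ₁ χ₂ χ₃ (k j) j z * (𝓕 f z.1 * 𝓕 g z.2)‖ₑ ≤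
      ENNReal.ofReal C * ((∫⁻ x, ‖f x‖ₑ ^ p) ^ (1 / p) * (∫⁻ x, ‖g x‖ₑ ^ q) ^ (1 / q) *
          (∫⁻ x, ‖u x‖ₑ ^ r) ^ (1 / r)) := by
  have h0' : (𝓕 χ₁ 0 = 0 ∧ 𝓕 χ₂ 0 = 0) ∨ (𝓕 χ₁ 0 = 0 ∧ 𝓕 (schwartzNeg χ₃) 0 = 0) ∨
      (𝓕 χ₂ 0 = 0 ∧ 𝓕 (schwartzNeg χ₃) 0 = 0) := by
    simpa only [fourier_schwartzNeg_zero] using h0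
  obtain ⟨C, hC, H⟩ := exists_lintegral_trilinear_le_of_two hd h0' hp hq hr h
  refine ⟨C * ∫ v, |K v * ((1 + ‖v.1‖) * (1 + ‖v.2‖))|,
    mul_nonneg hC (integral_nonneg fun _ => abs_nonneg _), fun k hk hkK J f g u hu => ?_⟩
  set N := (∫⁻ x, ‖f x‖ₑ ^ p) ^ (1 / p) * (∫⁻ x, ‖g x‖ₑ ^ q) ^ (1 / q) *
    (∫⁻ x, ‖u x‖ₑ ^ r) ^ (1 / r)
  set T : ℤ → Rd d × Rd d → ℝ≥0∞ := fun j v => ∫⁻ y, ‖conv (dilate j (-v.1) χ₁) f y‖ₑ *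
    ‖conv (dilate j (-v.2) χ₂) g y‖ₑ * ‖conv (dilate j 0 (schwartzNeg χ₃)) u y‖ₑ with hT
  have hTv : ∀ v, ∑ j ∈ J, T j v ≤
      ENNReal.ofReal (C * ((1 + ‖v.1‖) * (1 + ‖v.2‖))) * N := fun v => by
    refine (sum_lintegral_le J _).trans ?_
    have := H (-v.1) (-v.2) 0 J f g u (isKernel_schwartz f) (isKernel_schwartz g) hu
    simpa only [norm_neg, norm_zero, add_zero, mul_one] using this
  calc _ ≤ ∑ j ∈ J, ‖∫ x, u x * ∫ z : Rd d × Rd d, expChar (inner ℝ (z.1 + z.2) x) *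
        pieceSymbol χ₁ χ₂ χ₃ (k j) j z * (𝓕 f z.1 * 𝓕 g z.2)‖ₑ := enorm_sum_le _ _
    _ ≤ ∑ j ∈ J, ∫⁻ v, ENNReal.ofReal |K v| * T j v := by
        refine Finset.sum_le_sum fun j _ => ?_
        rw [integral_mul_integral_pieceSymbol χ₁ χ₂ χ₃ f g (hk j) j hu]
        refine (enorm_integral_le_lintegral_enorm _).trans (lintegral_mono fun v => ?_)
        rw [enorm_mul]
        refine mul_le_mul' ?_ ((enorm_integral_le_lintegral_enorm _).trans (le_of_eq ?_))
        · rw [← ofReal_norm]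
          exact ENNReal.ofReal_le_ofReal ((hkK j v).trans (le_abs_self _))
        · simp only [enorm_mul, hT]
    _ ≤ ∫⁻ v, ∑ j ∈ J, ENNReal.ofReal |K v| * T j v := sum_lintegral_le _ _
    _ ≤ ∫⁻ v, ENNReal.ofReal |K v * ((1 + ‖v.1‖) * (1 + ‖v.2‖))| * (ENNReal.ofReal C * N) := by
        refine lintegral_mono fun v => ?_
        simp only
        rw [← Finset.mul_sum]
        refine (mul_le_mul_right (hTv v) _).trans (le_of_eq ?_)
        rw [abs_mul, abs_of_nonneg (a := (1 + ‖v.1‖) * (1 + ‖v.2‖)) (by positivity),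
          ENNReal.ofReal_mul hC, ENNReal.ofReal_mul (abs_nonneg _)]
        ring
    _ = _ := by
        simp only [← Real.norm_eq_abs]
        rw [lintegral_mul_const'' _ hK.1.aemeasurable.norm.ennreal_ofReal,
          ← ofReal_integral_eq_lintegral_ofReal hK.norm (.of_forall fun _ => norm_nonneg _),
          ENNReal.ofReal_mul hC]
        ring

end Paraproduct

section SymbolDecay

open scoped ContDiff
open Filter Topology

variable {V : Type*} [NormedAddCommGroup V]

section Calculus

variable [NormedSpace ℝ V]

/-- Mikhlin-type bounds: derivatives of order `n` are `O (‖w‖ ^ (-n))`. -/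
structure IsSymbol (A : ℕ → ℝ) (M : V → ℂ) : Prop where
  contDiffOn : ContDiffOn ℝ ∞ M {w | w ≠ 0}
  bound : ∀ (n : ℕ) (w : V), w ≠ 0 →
    ‖iteratedFDerivWithin ℝ n M {w | w ≠ 0} w‖ ≤ A n * ‖w‖ ^ (-(n : ℝ))

lemma IsSymbol.comp_smul {A : ℕ → ℝ} {M : V → ℂ} (h : IsSymbol A M) {a : ℝ} (ha : 0 < a) :
    IsSymbol A fun w => M (a • w) := by
  have hs : IsOpen {w : V | w ≠ 0} := isOpen_ne
  set e : V ≃L[ℝ] V := ContinuousLinearEquiv.smulLeft (Units.mk0 a ha.ne') with he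
  have hea : ∀ w, e w = a • w := fun w => rfl
  have hpre : e ⁻¹' {w : V | w ≠ 0} = {w : V | w ≠ 0} := by
    ext w
    simp
  have hM : (fun w => M (a • w)) = M ∘ e := rfl
  constructor
  · have := h.contDiffOn.comp_continuousLinearMap (e : V →L[ℝ] V)
    exact hpre ▸ this
  · intro n w hw
    have h1 := e.iteratedFDerivWithin_comp_right M hs.uniqueDiffOn (x := w)
      (show e w ∈ {w : V | w ≠ 0} by simpa using hw) n
    rw [hpre] at h1
    rw [hM, h1]
    refine (ContinuousMultilinearMap.norm_compContinuousLinearMap_le _ _).trans ?_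
    have hb := h.bound n (e w) (by simpa using hw)
    have hen : ‖(e : V →L[ℝ] V)‖ ≤ a :=
      ContinuousLinearMap.opNorm_le_bound _ ha.le fun w => by
        change ‖a • w‖ ≤ _
        rw [norm_smul, Real.norm_of_nonneg ha.le]
    rw [Finset.prod_const, Finset.card_univ, Fintype.card_fin]
    calc _ ≤ (A n * ‖e w‖ ^ (-(n : ℝ))) * a ^ n :=
          mul_le_mul hb (pow_le_pow_left₀ (norm_nonneg _) hen n) (by positivity)
            ((norm_nonneg _).trans hb)
      _ = _ := by
          rw [hea, norm_smul, Real.norm_of_nonneg ha.le, Real.mul_rpow ha.le (norm_nonneg _),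
            Real.rpow_neg ha.le, Real.rpow_natCast]
          field_simp

lemma iteratedFDeriv_eq_zero_of_eventuallyEq {F : V → ℂ} {w : V} (h : F =ᶠ[𝓝 w] 0) (n : ℕ) :
    iteratedFDeriv ℝ n F w = 0 := by
  rw [(h.iteratedFDeriv ℝ n).eq_of_nhds]
  exact congrFun (iteratedFDeriv_fun_zero) w

lemma exists_contDiff_mul_le {Φ : V → ℂ} (hΦ : ContDiff ℝ ∞ Φ) {c : ℝ} (hc : 0 < c)
    (hΦc : ∀ w, ‖w‖ < c → Φ w = 0) (hΦR : HasCompactSupport Φ) (A : ℕ → ℝ) :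
    ∃ B : ℕ → ℝ, ∀ M : V → ℂ, IsSymbol A M → ContDiff ℝ ∞ (fun w => M w * Φ w) ∧
      ∀ n w, ‖iteratedFDeriv ℝ n (fun w => M w * Φ w) w‖ ≤ B n := by
  have hs : IsOpen {w : V | w ≠ 0} := isOpen_ne
  have hD : ∀ n : ℕ, ∃ D, ∀ w, ‖iteratedFDeriv ℝ n Φ w‖ ≤ D := fun n =>
    (hΦ.continuous_iteratedFDeriv (m := n) (mod_cast le_top)).bounded_above_of_compact_support
      (hΦR.iteratedFDeriv n)
  choose D hD using hD
  have hD0 : ∀ n, 0 ≤ D n := fun n => (norm_nonneg _).trans (hD n 0)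
  set B : ℕ → ℝ := fun n => ∑ i ∈ Finset.range (n + 1),
    (n.choose i : ℝ) * (|A i| * c ^ (-(i : ℝ))) * D (n - i) with hB
  have hB0 : ∀ n, 0 ≤ B n := fun n => Finset.sum_nonneg fun i _ =>
    mul_nonneg (mul_nonneg (Nat.cast_nonneg _) (mul_nonneg (abs_nonneg _) (by positivity)))
      (hD0 _)
  refine ⟨B, fun M hM => ?_⟩
  have hzero : ∀ w, ‖w‖ < c → (fun w => M w * Φ w) =ᶠ[𝓝 w] 0 := fun w hw => by
    filter_upwards [(isOpen_lt continuous_norm continuous_const).mem_nhds hw] with v hv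
    simp [hΦc v hv]
  have hon : ContDiffOn ℝ ∞ (fun w => M w * Φ w) {w | w ≠ 0} := hM.contDiffOn.mul hΦ.contDiffOn
  refine ⟨contDiff_iff_contDiffAt.2 fun w => ?_, fun n w => ?_⟩
  · rcases eq_or_ne w 0 with rfl | hw
    · exact (contDiffAt_const (c := (0 : ℂ))).congr_of_eventuallyEq (hzero 0 (by simpa using hc))
    · exact hon.contDiffAt (hs.mem_nhds hw)
  · rcases lt_or_ge ‖w‖ c with hwc | hwc
    · rw [iteratedFDeriv_eq_zero_of_eventuallyEq (hzero w hwc), norm_zero]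
      exact hB0 n
    · have hw : w ∈ {w : V | w ≠ 0} := norm_pos_iff.1 (hc.trans_le hwc)
      rw [← iteratedFDerivWithin_of_isOpen n hs hw]
      refine (norm_iteratedFDerivWithin_mul_le hM.contDiffOn hΦ.contDiffOn hs.uniqueDiffOn hw
        (n := n) (mod_cast le_top)).trans (Finset.sum_le_sum fun i _ => ?_)
      rw [iteratedFDerivWithin_of_isOpen (n - i) (f := Φ) hs hw]
      have h1 : ‖iteratedFDerivWithin ℝ i M {w | w ≠ 0} w‖ ≤ |A i| * c ^ (-(i : ℝ)) := by
        refine (hM.bound i w hw).trans (mul_le_mul (le_abs_self _) ?_ (by positivity)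
          (abs_nonneg _))
        exact Real.rpow_le_rpow_of_nonpos hc hwc (by simp)
      have := hD (n - i) w
      gcongr

end Calculus

section Fourier

variable [InnerProductSpace ℝ V] [FiniteDimensional ℝ V] [MeasurableSpace V] [BorelSpace V]

lemma exists_pow_mul_norm_fourier_le (A : ℕ → ℝ) (R : ℝ) (N : ℕ) :
    ∃ C : ℝ, 0 ≤ C ∧ ∀ F : V → ℂ, ContDiff ℝ ∞ F → (∀ w, R < ‖w‖ → F w = 0) →
      (∀ n w, ‖iteratedFDeriv ℝ n F w‖ ≤ A n) → ∀ w, (1 + ‖w‖) ^ N * ‖𝓕 F w‖ ≤ C := by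
  set b : ℝ := (volume : Measure V).real (Metric.closedBall (0 : V) R)
  set B : ℕ → ℝ := fun n => 2 ^ n * ∑ i ∈ Finset.range (n + 1), |A i| * b with hB
  have hB0 : ∀ n, 0 ≤ B n := fun n => mul_nonneg (by positivity)
    (Finset.sum_nonneg fun i _ => mul_nonneg (abs_nonneg _) measureReal_nonneg)
  refine ⟨2 ^ (N - 1) * (B 0 + B N), mul_nonneg (by positivity) (add_nonneg (hB0 _) (hB0 _)),
    fun F hF hR hA w => ?_⟩
  have hsupp : HasCompactSupport F := HasCompactSupport.intro (isCompact_closedBall 0 R)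
    fun w hw => hR w (by simpa using hw)
  have hcont : ∀ n : ℕ, Continuous (iteratedFDeriv ℝ n F) := fun n =>
    hF.continuous_iteratedFDeriv (m := n) (mod_cast le_top)
  have hint : ∀ k n : ℕ, Integrable fun v => ‖v‖ ^ k * ‖iteratedFDeriv ℝ n F v‖ := fun k n => by
    refine Continuous.integrable_of_hasCompactSupport ?_ ?_
    · exact (continuous_norm.pow k).mul (hcont n).norm
    · exact ((hsupp.iteratedFDeriv n).norm).mul_left
  have hI : ∀ n : ℕ, ∫ v, ‖iteratedFDeriv ℝ n F v‖ ≤ |A n| * b := fun n => by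
    rw [← setIntegral_eq_integral_of_forall_compl_eq_zero (s := Metric.closedBall (0 : V) R)]
    · refine (le_abs_self _).trans ?_
      refine norm_setIntegral_le_of_norm_le_const (μ := volume) (s := Metric.closedBall (0 : V) R)
        (f := fun v => ‖iteratedFDeriv ℝ n F v‖) measure_closedBall_lt_top fun v _ => ?_
      rw [norm_norm]
      exact (hA n v).trans (le_abs_self _)
    · intro v hv
      rw [iteratedFDeriv_eq_zero_of_eventuallyEq, norm_zero]
      have hv' : R < ‖v‖ := by simpa using hv
      filter_upwards [(isOpen_lt continuous_const continuous_norm).mem_nhds hv'] with u hu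
      exact hR u hu
  have key : ∀ n : ℕ, ‖w‖ ^ n * ‖𝓕 F w‖ ≤ B n := fun n => by
    have := Real.pow_mul_norm_iteratedFDeriv_fourier_le (K := 0) (N := n) (k := 0) (n := n)
      (hF.of_le (mod_cast le_top)) (fun k i _ _ => hint k i) le_rfl le_rfl w
    simp only [norm_iteratedFDeriv_zero, pow_zero, one_mul, Nat.cast_zero, mul_zero, zero_add,
      Finset.range_one, Finset.sum_product, Finset.sum_singleton] at this
    refine this.trans (mul_le_mul_of_nonneg_left ?_ (by positivity))
    exact Finset.sum_le_sum fun i _ => hI i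
  calc (1 + ‖w‖) ^ N * ‖𝓕 F w‖ ≤ 2 ^ (N - 1) * (1 ^ N + ‖w‖ ^ N) * ‖𝓕 F w‖ :=
        mul_le_mul_of_nonneg_right (add_pow_le zero_le_one (norm_nonneg _) N) (norm_nonneg _)
    _ = 2 ^ (N - 1) * (‖w‖ ^ 0 * ‖𝓕 F w‖ + ‖w‖ ^ N * ‖𝓕 F w‖) := by
        rw [one_pow, pow_zero]; ring
    _ ≤ _ := mul_le_mul_of_nonneg_left (add_le_add (key 0) (key N)) (by positivity)

/-- A symbol localised to an annulus has rapidly decreasing Fourier transform, uniformly over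
all symbols with given bounds. -/
theorem exists_fourier_representation {Φ : V → ℂ} (hΦ : ContDiff ℝ ∞ Φ) {c R : ℝ} (hc : 0 < c)
    (hΦc : ∀ w, ‖w‖ < c → Φ w = 0) (hΦR : ∀ w, R < ‖w‖ → Φ w = 0) (A : ℕ → ℝ) {N : ℕ}
    (hN : Module.finrank ℝ V < N) :
    ∃ C : ℝ, 0 ≤ C ∧ ∀ M : V → ℂ, IsSymbol A M → ∃ k : V → ℂ, Continuous k ∧
      (∀ w, (1 + ‖w‖) ^ N * ‖k w‖ ≤ C) ∧
      ∀ z, M z * Φ z = ∫ w, (Real.fourierChar (inner ℝ w z) : ℂ) * k w := by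
  have hsupp : HasCompactSupport Φ := HasCompactSupport.intro (isCompact_closedBall 0 R)
    fun w hw => hΦR w (by simpa using hw)
  obtain ⟨B, hB⟩ := exists_contDiff_mul_le hΦ hc hΦc hsupp A
  obtain ⟨C, hC, H⟩ := exists_pow_mul_norm_fourier_le (V := V) B R N
  refine ⟨C, hC, fun M hM => ?_⟩
  obtain ⟨h1, h2⟩ := hB M hM
  set F : V → ℂ := fun w => M w * Φ w with hF
  have hFi : Integrable F := h1.continuous.integrable_of_hasCompactSupport hsupp.mul_left
  have hdec := H F h1 (fun w hw => by simp [hF, hΦR w hw]) h2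
  have hcont : Continuous (𝓕 F) := VectorFourier.fourierIntegral_continuous
    Real.continuous_fourierChar (by exact continuous_inner) hFi
  have hkint : Integrable (𝓕 F) := by
    have hi := (integrable_one_add_norm (E := V) (μ := volume) (r := N)
      (mod_cast hN)).const_mul C
    refine hi.mono' hcont.aestronglyMeasurable (.of_forall fun w => ?_)
    rw [Real.rpow_neg (by positivity), Real.rpow_natCast, ← div_eq_mul_inv,
      le_div_iff₀ (by positivity), mul_comm]
    exact hdec w
  refine ⟨𝓕 F, hcont, hdec, fun z => ?_⟩
  have := congrFun (h1.continuous.fourierInv_fourier_eq hFi hkint) z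
  rw [← show F z = M z * Φ z from rfl, ← this, Real.fourierInv_eq]
  rfl

end Fourier

end SymbolDecay

section LocalisedSymbol

open scoped ContDiff SchwartzMap
open Filter Topology

lemma norm_toLp_le (z : Rd d × Rd d) : ‖WithLp.toLp 2 z‖ ≤ ‖z.1‖ + ‖z.2‖ := by
  rw [WithLp.prod_norm_eq_of_L2]
  refine Real.sqrt_le_iff.2 ⟨by positivity, ?_⟩
  change ‖z.1‖ ^ 2 + ‖z.2‖ ^ 2 ≤ _
  nlinarith [mul_nonneg (norm_nonneg z.1) (norm_nonneg z.2)]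

lemma norm_le_norm_toLp (z : Rd d × Rd d) : ‖z‖ ≤ ‖WithLp.toLp 2 z‖ := by
  rw [WithLp.prod_norm_eq_of_L2]
  change max ‖z.1‖ ‖z.2‖ ≤ √(‖z.1‖ ^ 2 + ‖z.2‖ ^ 2)
  refine max_le (Real.le_sqrt_of_sq_le ?_) (Real.le_sqrt_of_sq_le ?_) <;>
    nlinarith [sq_nonneg ‖z.1‖, sq_nonneg ‖z.2‖]

lemma exists_isSymbol {m : Rd d × Rd d → ℂ} (hsmooth : ContDiffOn ℝ ∞ m {z | z ≠ 0})
    (hbound : ∀ n : ℕ, ∃ Cn : ℝ, ∀ z : Rd d × Rd d, z ≠ 0 →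
      ‖iteratedFDerivWithin ℝ n m {z | z ≠ 0} z‖ ≤ Cn * (‖z.1‖ + ‖z.2‖) ^ (-(n : ℝ))) :
    ∃ A : ℕ → ℝ, IsSymbol A fun w : WithLp 2 (Rd d × Rd d) => m w.ofLp := by
  choose D hD using hbound
  set e : WithLp 2 (Rd d × Rd d) ≃L[ℝ] Rd d × Rd d :=
    WithLp.prodContinuousLinearEquiv 2 ℝ (Rd d) (Rd d)
  have hs : IsOpen {z : Rd d × Rd d | z ≠ 0} := isOpen_ne
  have hpre : e ⁻¹' {z | z ≠ 0} = {w | w ≠ 0} := by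
    ext w
    simp
  have hm : (fun w : WithLp 2 (Rd d × Rd d) => m w.ofLp) = m ∘ e := rfl
  refine ⟨fun n => |D n| * ‖(e : WithLp 2 (Rd d × Rd d) →L[ℝ] Rd d × Rd d)‖ ^ n, ?_, ?_⟩
  · have := hsmooth.comp_continuousLinearMap (e : WithLp 2 (Rd d × Rd d) →L[ℝ] Rd d × Rd d)
    exact hpre ▸ this
  · intro n w hw
    have hw' : e w ≠ 0 := by simpa using hw
    have h1 := e.iteratedFDerivWithin_comp_right m hs.uniqueDiffOn (x := w) hw' n
    rw [hpre] at h1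
    rw [hm, h1]
    refine (ContinuousMultilinearMap.norm_compContinuousLinearMap_le _ _).trans ?_
    rw [Finset.prod_const, Finset.card_univ, Fintype.card_fin, mul_right_comm]
    refine mul_le_mul_of_nonneg_right ((hD n _ hw').trans ?_) (by positivity)
    refine mul_le_mul (le_abs_self _) ?_ (by positivity) (abs_nonneg _)
    exact Real.rpow_le_rpow_of_nonpos (norm_pos_iff.2 hw) (norm_toLp_le (e w)) (by simp)

lemma exists_amplitude {Φ : WithLp 2 (Rd d × Rd d) → ℂ} (hΦ : ContDiff ℝ ∞ Φ) {c R : ℝ}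
    (hc : 0 < c) (hΦc : ∀ w, ‖w‖ < c → Φ w = 0) (hΦR : ∀ w, R < ‖w‖ → Φ w = 0) {A : ℕ → ℝ}
    {m : Rd d × Rd d → ℂ} (hm : IsSymbol A fun w : WithLp 2 (Rd d × Rd d) => m w.ofLp) :
    ∃ K : Rd d × Rd d → ℝ, Integrable (fun v => K v * ((1 + ‖v.1‖) * (1 + ‖v.2‖))) ∧
      ∃ k : ℤ → Rd d × Rd d → ℂ, (∀ j, Integrable (k j)) ∧ (∀ j v, ‖k j v‖ ≤ K v) ∧
      ∀ j z, m ((2 : ℝ) ^ j • z) * Φ (WithLp.toLp 2 z) =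
        ∫ v, k j v * (expChar (inner ℝ z.1 v.1) * expChar (inner ℝ z.2 v.2)) := by
  have hdim : Module.finrank ℝ (WithLp 2 (Rd d × Rd d)) < 2 * d + 3 := by
    rw [(WithLp.prodContinuousLinearEquiv 2 ℝ (Rd d) (Rd d)).toLinearEquiv.finrank_eq]
    simp
    omega
  obtain ⟨C, hC, H⟩ := exists_fourier_representation hΦ hc hΦc hΦR A hdim
  choose k hk hkC hkz using fun j : ℤ => H _ (hm.comp_smul (show (0 : ℝ) < 2 ^ j by positivity))
  have hcont : ∀ j, Continuous fun v : Rd d × Rd d => k j (WithLp.toLp 2 v) := fun j =>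
    (hk j).comp (WithLp.prodContinuousLinearEquiv 2 ℝ (Rd d) (Rd d)).symm.continuous
  have hK : Integrable (fun v : Rd d × Rd d =>
      (C * ((1 + ‖v‖) ^ (2 * d + 3))⁻¹) * ((1 + ‖v.1‖) * (1 + ‖v.2‖))) := by
    have : (volume : Measure (Rd d × Rd d)).IsAddHaarMeasure :=
      inferInstanceAs (((volume : Measure (Rd d)).prod volume).IsAddHaarMeasure)
    have hi := (integrable_one_add_norm (E := Rd d × Rd d) (μ := volume) (r := (2 * d + 1 : ℕ))
      (by simp; linarith)).const_mul C
    refine hi.mono' (Continuous.aestronglyMeasurable ?_) (.of_forall fun v => ?_)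
    · refine Continuous.mul (continuous_const.mul (Continuous.inv₀ (by fun_prop) fun v => ?_))
        (by fun_prop)
      positivity
    · rw [Real.norm_of_nonneg (by positivity), mul_assoc]
      refine mul_le_mul_of_nonneg_left ?_ hC
      rw [Real.rpow_neg (by positivity), Real.rpow_natCast, inv_mul_le_iff₀ (by positivity),
        show 2 * d + 3 = 2 * d + 1 + 2 by ring, pow_add (1 + ‖v‖) (2 * d + 1),
        mul_assoc, mul_comm (_ ^ 2), ← mul_assoc, mul_inv_cancel₀ (by positivity), one_mul, sq]
      have h1 := norm_fst_le v
      have h2 := norm_snd_le v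
      gcongr
  have hkK : ∀ j (v : Rd d × Rd d), ‖k j (WithLp.toLp 2 v)‖ ≤
      C * ((1 + ‖v‖) ^ (2 * d + 3))⁻¹ := fun j v => by
    rw [← div_eq_mul_inv, le_div_iff₀ (by positivity), mul_comm]
    refine le_trans ?_ (hkC j (WithLp.toLp 2 v))
    have := norm_le_norm_toLp v
    gcongr
  refine ⟨_, hK, fun j v => k j (WithLp.toLp 2 v), fun j => ?_, hkK, fun j z => ?_⟩
  · refine hK.mono' (hcont j).aestronglyMeasurable (.of_forall fun v => (hkK j v).trans ?_)
    refine le_mul_of_one_le_right (by positivity) ?_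
    nlinarith [norm_nonneg v.1, norm_nonneg v.2, mul_nonneg (norm_nonneg v.1) (norm_nonneg v.2)]
  · have h1 := hkz j (WithLp.toLp 2 z)
    refine Eq.trans h1 ?_
    rw [← (WithLp.volume_preserving_toLp (Rd d) (Rd d)).integral_comp
      (MeasurableEquiv.toLp 2 (Rd d × Rd d)).measurableEmbedding]
    refine integral_congr_ae (.of_forall fun v => ?_)
    simp only [WithLp.prod_inner_apply]
    rw [← expChar_add, mul_comm (k j _), real_inner_comm, real_inner_comm z.2]
    rfl

end LocalisedSymbol

section MultiplierOperator

open scoped ContDiff SchwartzMap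
open Filter Topology

/-- The bilinear multiplier operator with symbol `σ`, written as an integral over `ℝ^d × ℝ^d`. -/
def multOp (σ : Rd d × Rd d → ℂ) (f g : 𝓢(Rd d, ℂ)) (x : Rd d) : ℂ :=
  ∫ z : Rd d × Rd d, expChar (inner ℝ (z.1 + z.2) x) * σ z * (𝓕 f z.1 * 𝓕 g z.2)

section

variable {σ : Rd d × Rd d → ℂ} {M : ℝ}

lemma integrable_multOp (hσ : AEStronglyMeasurable σ) (hM : ∀ᵐ z, ‖σ z‖ ≤ M) (f g : 𝓢(Rd d, ℂ))
    (x : Rd d) : Integrable fun z : Rd d × Rd d =>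
      expChar (inner ℝ (z.1 + z.2) x) * σ z * (𝓕 f z.1 * 𝓕 g z.2) := by
  have hw : Integrable fun z : Rd d × Rd d => 𝓕 f z.1 * 𝓕 g z.2 :=
    (𝓕 f).integrable.mul_prod (𝓕 g).integrable
  refine hw.bdd_mul (c := M) (AEStronglyMeasurable.mul ?_ hσ) ?_
  · exact (continuous_expChar.comp (by fun_prop)).aestronglyMeasurable
  · filter_upwards [hM] with z hz
    rwa [norm_mul, norm_expChar, one_mul]

lemma norm_multOp_le (hM : ∀ᵐ z, ‖σ z‖ ≤ M) (f g : 𝓢(Rd d, ℂ)) (x : Rd d) :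
    ‖multOp σ f g x‖ ≤ ∫ z : Rd d × Rd d, M * ‖𝓕 f z.1 * 𝓕 g z.2‖ := by
  refine norm_integral_le_of_norm_le
    (((𝓕 f).integrable.mul_prod (𝓕 g).integrable).norm.const_mul M) ?_
  filter_upwards [hM] with z hz
  rw [norm_mul, norm_mul, norm_expChar, one_mul]
  gcongr

lemma continuous_multOp (hσ : AEStronglyMeasurable σ) (hM : ∀ᵐ z, ‖σ z‖ ≤ M)
    (f g : 𝓢(Rd d, ℂ)) : Continuous (multOp σ f g) := by
  refine continuous_of_dominated (bound := fun z => M * ‖𝓕 f z.1 * 𝓕 g z.2‖)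
    (fun x => (integrable_multOp hσ hM f g x).1) (fun x => ?_)
    (((𝓕 f).integrable.mul_prod (𝓕 g).integrable).norm.const_mul M) (.of_forall fun z => ?_)
  · filter_upwards [hM] with z hz
    rw [norm_mul, norm_mul, norm_expChar, one_mul]
    gcongr
  · exact ((continuous_expChar.comp (by fun_prop)).mul continuous_const).mul continuous_const

lemma integral_mul_multOp_sum {ι : Type*} (s : Finset ι) {τ : ι → Rd d × Rd d → ℂ}
    (hτ : ∀ i, AEStronglyMeasurable (τ i)) (hM : ∀ i, ∃ M, ∀ᵐ z, ‖τ i z‖ ≤ M)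
    (f g : 𝓢(Rd d, ℂ)) {u : Rd d → ℂ} (hu : IsKernel u) :
    ∫ x, u x * multOp (fun z => ∑ i ∈ s, τ i z) f g x =
      ∑ i ∈ s, ∫ x, u x * multOp (τ i) f g x := by
  choose M hM using hM
  have h1 : ∀ x, multOp (fun z => ∑ i ∈ s, τ i z) f g x = ∑ i ∈ s, multOp (τ i) f g x :=
    fun x => by
    unfold multOp
    rw [← integral_finsetSum _ fun i _ => integrable_multOp (hτ i) (hM i) f g x]
    exact integral_congr_ae (.of_forall fun z => by simp only [Finset.mul_sum, Finset.sum_mul])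
  rw [← integral_finsetSum _ fun i _ => (hu.mul_bdd (continuous_multOp (hτ i) (hM i) f g)
    (norm_multOp_le (hM i) f g)).integrable]
  exact integral_congr_ae (.of_forall fun x => by simp only [h1, Finset.mul_sum])

end

/-- A bump function on an annulus of `ℝ^d × ℝ^d`, reproduced by cut-offs in `ξ`, `η` and `ξ + η`,
two of which vanish at the origin. -/
structure IsLocalised (Φ : WithLp 2 (Rd d × Rd d) → ℂ) : Prop where
  contDiff : ContDiff ℝ ∞ Φ
  eq_zero_of_lt : ∀ w, ‖w‖ < 1 / 2 → Φ w = 0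
  eq_zero_of_gt : ∀ w, 2 < ‖w‖ → Φ w = 0
  exists_cutoff : ∃ a b c : 𝓢(Rd d, ℂ),
    ((a 0 = 0 ∧ b 0 = 0) ∨ (a 0 = 0 ∧ c 0 = 0) ∨ (b 0 = 0 ∧ c 0 = 0)) ∧
    ∀ z : Rd d × Rd d, Φ (WithLp.toLp 2 z) * (a z.1 * b z.2 * c (z.1 + z.2)) =
      Φ (WithLp.toLp 2 z)

theorem IsLocalised.exists_enorm_sum_le (hd : 0 < d) {Φ : WithLp 2 (Rd d × Rd d) → ℂ}
    (hΦ : IsLocalised Φ) {A : ℕ → ℝ} {m : Rd d × Rd d → ℂ}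
    (hm : IsSymbol A fun w : WithLp 2 (Rd d × Rd d) => m w.ofLp)
    {p q r : ℝ} (hp : 1 < p) (hq : 1 < q) (hr : 1 < r) (h : 1 / p + 1 / q + 1 / r = 1) :
    ∃ C : ℝ, 0 ≤ C ∧ ∀ (J : Finset ℤ) (f g : 𝓢(Rd d, ℂ)) (u : Rd d → ℂ), IsKernel u →
      ‖∑ j ∈ J, ∫ x, u x *
        multOp (fun z => m z * Φ (WithLp.toLp 2 (((2 : ℝ) ^ j)⁻¹ • z))) f g x‖ₑ ≤
      ENNReal.ofReal C * ((∫⁻ x, ‖f x‖ₑ ^ p) ^ (1 / p) * (∫⁻ x, ‖g x‖ₑ ^ q) ^ (1 / q) *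
          (∫⁻ x, ‖u x‖ₑ ^ r) ^ (1 / r)) := by
  obtain ⟨a, b, c, h0, hloc⟩ := hΦ.exists_cutoff
  obtain ⟨K, hK, k, hki, hkK, hk⟩ := exists_amplitude hΦ.contDiff (by norm_num : (0 : ℝ) < 1 / 2)
    hΦ.eq_zero_of_lt hΦ.eq_zero_of_gt hm
  obtain ⟨C, hC, H⟩ := exists_enorm_sum_pieceSymbol_le hd (χ₁ := 𝓕⁻ a) (χ₂ := 𝓕⁻ b)
    (χ₃ := 𝓕⁻ c) (by simpa using h0) hp hq hr h hK
  refine ⟨C, hC, fun J f g u hu => ?_⟩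
  have hpiece : ∀ j, (fun z => m z * Φ (WithLp.toLp 2 (((2 : ℝ) ^ j)⁻¹ • z))) =
      pieceSymbol (𝓕⁻ a) (𝓕⁻ b) (𝓕⁻ c) (k j) j := fun j => by
    ext z
    have h2 : (2 : ℝ) ^ j ≠ 0 := by positivity
    have h1 := hk j (((2 : ℝ) ^ j)⁻¹ • z)
    rw [smul_inv_smul₀ h2, ← hloc, ← mul_assoc] at h1
    rw [← hloc, ← mul_assoc]
    simp only [pieceSymbol, FourierTransform.fourier_fourierInv_eq, real_inner_smul_right]
    simp only [Prod.smul_fst, Prod.smul_snd, real_inner_smul_left, ← smul_add] at h1 ⊢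
    have h3 := hk j (((2 : ℝ) ^ j)⁻¹ • z)
    rw [smul_inv_smul₀ h2] at h3
    simp only [Prod.smul_fst, Prod.smul_snd, real_inner_smul_left] at h3
    rw [h3]
  simp only [hpiece]
  exact H k hki hkK J f g u hu

end MultiplierOperator

section Partition

open scoped ContDiff SchwartzMap
open Filter Topology

/-- A smooth bump function as a complex-valued Schwartz function. -/
def bumpSchwartz (β : ContDiffBump (0 : Rd d)) : 𝓢(Rd d, ℂ) :=
  HasCompactSupport.toSchwartzMap (f := fun ξ => (β ξ : ℂ))
    (β.hasCompactSupport.comp_left Complex.ofReal_zero) (Complex.ofRealCLM.contDiff.comp β.contDiff)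

lemma bumpSchwartz_apply (β : ContDiffBump (0 : Rd d)) (ξ : Rd d) :
    bumpSchwartz β ξ = (β ξ : ℂ) := rfl

lemma bump_eq_one {E : Type*} [NormedAddCommGroup E] [NormedSpace ℝ E] [HasContDiffBump E]
    (β : ContDiffBump (0 : E)) {ξ : E} (h : ‖ξ‖ ≤ β.rIn) : β ξ = 1 :=
  β.one_of_mem_closedBall (by simpa using h)

lemma bump_eq_zero {E : Type*} [NormedAddCommGroup E] [NormedSpace ℝ E] [HasContDiffBump E]
    (β : ContDiffBump (0 : E)) {ξ : E} (h : β.rOut ≤ ‖ξ‖) : β ξ = 0 :=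
  β.zero_of_le_dist (by simpa using h)

/-- Cut-off equal to one on the ball of radius `4`. -/
def lowCutoff : 𝓢(Rd d, ℂ) := bumpSchwartz ⟨4, 8, by norm_num, by norm_num⟩

/-- Cut-off equal to one on the annulus `1 / 16 ≤ ‖ξ‖ ≤ 4` and vanishing at the origin. -/
def bandCutoff : 𝓢(Rd d, ℂ) :=
  lowCutoff - bumpSchwartz ⟨1 / 32, 1 / 16, by norm_num, by norm_num⟩

lemma lowCutoff_eq_one {ξ : Rd d} (h : ‖ξ‖ ≤ 4) : lowCutoff ξ = 1 := by
  rw [lowCutoff, bumpSchwartz_apply, bump_eq_one _ h, Complex.ofReal_one]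

lemma bandCutoff_eq_one {ξ : Rd d} (h : 1 / 16 ≤ ‖ξ‖) (h' : ‖ξ‖ ≤ 4) : bandCutoff ξ = 1 := by
  rw [bandCutoff, sub_apply, lowCutoff_eq_one h', bumpSchwartz_apply,
    bump_eq_zero _ h, Complex.ofReal_zero, sub_zero]

lemma bandCutoff_zero : bandCutoff (0 : Rd d) = 0 := by
  rw [bandCutoff, sub_apply, lowCutoff_eq_one (by simp), bumpSchwartz_apply,
    bump_eq_one _ (by simp), Complex.ofReal_one, sub_self]

/-- The radial bump function generating the dyadic partition of unity. -/
def dyadicBump : ContDiffBump (0 : WithLp 2 (Rd d × Rd d)) := ⟨1, 2, by norm_num, by norm_num⟩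

/-- The bump function separating low from high frequencies in one variable. -/
def smallBump : ContDiffBump (0 : Rd d) := ⟨1 / 16, 1 / 8, by norm_num, by norm_num⟩

lemma isLocalised_mul {W : WithLp 2 (Rd d × Rd d) → ℝ} (hW : ContDiff ℝ ∞ W)
    {a b c : 𝓢(Rd d, ℂ)}
    (h0 : (a 0 = 0 ∧ b 0 = 0) ∨ (a 0 = 0 ∧ c 0 = 0) ∨ (b 0 = 0 ∧ c 0 = 0))
    (h : ∀ z : Rd d × Rd d, W (WithLp.toLp 2 z) ≠ 0 → 1 / 2 ≤ ‖z.1‖ + ‖z.2‖ → ‖z.1‖ ≤ 2 →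
      ‖z.2‖ ≤ 2 → a z.1 = 1 ∧ b z.2 = 1 ∧ c (z.1 + z.2) = 1) :
    IsLocalised fun w => (((dyadicBump w - dyadicBump ((2 : ℝ) • w)) * W w : ℝ) : ℂ) := by
  have hlt : ∀ w : WithLp 2 (Rd d × Rd d), ‖w‖ < 1 / 2 →
      dyadicBump w - dyadicBump ((2 : ℝ) • w) = 0 := fun w hw => by
    rw [bump_eq_one _ (show ‖w‖ ≤ 1 by linarith), bump_eq_one, sub_self]
    rw [norm_smul, Real.norm_two]
    change _ ≤ (1 : ℝ)
    linarith
  have hgt : ∀ w : WithLp 2 (Rd d × Rd d), 2 < ‖w‖ →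
      dyadicBump w - dyadicBump ((2 : ℝ) • w) = 0 := fun w hw => by
    rw [bump_eq_zero _ (show (2 : ℝ) ≤ ‖w‖ from hw.le), bump_eq_zero, sub_self]
    rw [norm_smul, Real.norm_two]
    change (2 : ℝ) ≤ _
    linarith
  refine ⟨?_, fun w hw => ?_, fun w hw => ?_, a, b, c, h0, fun z => ?_⟩
  · exact Complex.ofRealCLM.contDiff.comp ((dyadicBump.contDiff.sub
      (dyadicBump.contDiff.comp (contDiff_const_smul _))).mul hW)
  · rw [hlt w hw, zero_mul, Complex.ofReal_zero]
  · rw [hgt w hw, zero_mul, Complex.ofReal_zero]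
  · set w := WithLp.toLp 2 z with hw
    by_cases hΦ : (dyadicBump w - dyadicBump ((2 : ℝ) • w)) * W w = 0
    · rw [hΦ, Complex.ofReal_zero, zero_mul]
    have h1 := mul_ne_zero_iff.1 hΦ
    have hge : 1 / 2 ≤ ‖w‖ := by
      by_contra! hlt'
      exact h1.1 (hlt w hlt')
    have hle : ‖w‖ ≤ 2 := by
      by_contra! hgt'
      exact h1.1 (hgt w hgt')
    have hz := (norm_le_norm_toLp z).trans hle
    obtain ⟨ha, hb, hc⟩ := h z h1.2 (hge.trans (norm_toLp_le z)) ((norm_fst_le z).trans hz)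
      ((norm_snd_le z).trans hz)
    rw [ha, hb, hc]
    ring

theorem exists_isLocalised_partition :
    ∃ Φ : Fin 3 → WithLp 2 (Rd d × Rd d) → ℂ, (∀ i, IsLocalised (Φ i)) ∧
      ∀ w, ∑ i, Φ i w = ((dyadicBump w - dyadicBump ((2 : ℝ) • w) : ℝ) : ℂ) := by
  have hfst : ContDiff ℝ ∞ fun w : WithLp 2 (Rd d × Rd d) => smallBump w.fst :=
    smallBump.contDiff.comp (contDiff_fst.comp
      (WithLp.prodContinuousLinearEquiv 2 ℝ (Rd d) (Rd d)).contDiff)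
  have hsnd : ContDiff ℝ ∞ fun w : WithLp 2 (Rd d × Rd d) => smallBump w.snd :=
    smallBump.contDiff.comp (contDiff_snd.comp
      (WithLp.prodContinuousLinearEquiv 2 ℝ (Rd d) (Rd d)).contDiff)
  have hsmall : ∀ ξ : Rd d, smallBump ξ ≠ 0 → ‖ξ‖ ≤ 1 / 8 := fun ξ h => by
    by_contra! h'
    exact h (bump_eq_zero _ h'.le)
  have hlarge : ∀ ξ : Rd d, 1 - smallBump ξ ≠ 0 → 1 / 16 ≤ ‖ξ‖ := fun ξ h => by
    by_contra! h'
    exact h (by rw [bump_eq_one smallBump (ξ := ξ) h'.le, sub_self])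
  have hadd : ∀ z : Rd d × Rd d, ‖z.1 + z.2‖ ≤ ‖z.1‖ + ‖z.2‖ ∧
      ‖z.1‖ - ‖z.2‖ ≤ ‖z.1 + z.2‖ ∧ ‖z.2‖ - ‖z.1‖ ≤ ‖z.1 + z.2‖ := fun z => by
    refine ⟨norm_add_le _ _, ?_, ?_⟩
    · simpa using norm_sub_norm_le z.1 (-z.2)
    · simpa [add_comm] using norm_sub_norm_le z.2 (-z.1)
  have h1 := isLocalised_mul (W := fun w => smallBump w.fst) hfst (a := lowCutoff)
    (b := bandCutoff) (c := bandCutoff) (.inr (.inr ⟨bandCutoff_zero, bandCutoff_zero⟩))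
    fun z hW hge hz1 hz2 => by
      have hs := hsmall z.1 hW
      obtain ⟨e1, e2, e3⟩ := hadd z
      exact ⟨lowCutoff_eq_one (by linarith), bandCutoff_eq_one (by linarith) (by linarith),
        bandCutoff_eq_one (by linarith) (by linarith)⟩
  have h2 := isLocalised_mul (W := fun w => (1 - smallBump w.fst) * smallBump w.snd)
    ((contDiff_const.sub hfst).mul hsnd) (a := bandCutoff)
    (b := lowCutoff) (c := bandCutoff) (.inr (.inl ⟨bandCutoff_zero, bandCutoff_zero⟩))
    fun z hW hge hz1 hz2 => by
      have hs := hsmall z.2 (mul_ne_zero_iff.1 hW).2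
      obtain ⟨e1, e2, e3⟩ := hadd z
      exact ⟨bandCutoff_eq_one (by linarith) (by linarith), lowCutoff_eq_one (by linarith),
        bandCutoff_eq_one (by linarith) (by linarith)⟩
  have h3 := isLocalised_mul (W := fun w => (1 - smallBump w.fst) * (1 - smallBump w.snd))
    ((contDiff_const.sub hfst).mul (contDiff_const.sub hsnd)) (a := bandCutoff)
    (b := bandCutoff) (c := lowCutoff) (.inl ⟨bandCutoff_zero, bandCutoff_zero⟩)
    fun z hW hge hz1 hz2 => by
      have hs1 := hlarge z.1 (mul_ne_zero_iff.1 hW).1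
      have hs2 := hlarge z.2 (mul_ne_zero_iff.1 hW).2
      obtain ⟨e1, e2, e3⟩ := hadd z
      exact ⟨bandCutoff_eq_one (by linarith) (by linarith),
        bandCutoff_eq_one (by linarith) (by linarith), lowCutoff_eq_one (by linarith)⟩
  have H : ∀ Φ₁ Φ₂ Φ₃ : WithLp 2 (Rd d × Rd d) → ℂ, IsLocalised Φ₁ → IsLocalised Φ₂ →
      IsLocalised Φ₃ → (∀ w, Φ₁ w + Φ₂ w + Φ₃ w =
        ((dyadicBump w - dyadicBump ((2 : ℝ) • w) : ℝ) : ℂ)) →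
      ∃ Φ : Fin 3 → WithLp 2 (Rd d × Rd d) → ℂ, (∀ i, IsLocalised (Φ i)) ∧
        ∀ w, ∑ i, Φ i w = ((dyadicBump w - dyadicBump ((2 : ℝ) • w) : ℝ) : ℂ) := by
    intro Φ₁ Φ₂ Φ₃ h₁ h₂ h₃ hsum
    refine ⟨![Φ₁, Φ₂, Φ₃], fun i => ?_, fun w => ?_⟩
    · fin_cases i
      exacts [h₁, h₂, h₃]
    · rw [Fin.sum_univ_three]
      exact hsum w
  refine H _ _ _ h1 h2 h3 fun w => ?_
  simp only [← Complex.ofReal_add]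
  congr 1
  ring

end Partition

section Truncation

open scoped ContDiff SchwartzMap
open Filter Topology

lemma ae_ne_zero (hd : 0 < d) : ∀ᵐ z : Rd d × Rd d, z ≠ 0 := by
  have : Nonempty (Fin d) := ⟨⟨0, hd⟩⟩
  have h : (volume : Measure (Rd d × Rd d)) {0} = 0 := by
    rw [Measure.volume_eq_prod, ← Prod.mk_zero_zero, ← Set.singleton_prod_singleton,
      Measure.prod_prod, measure_singleton, zero_mul]
  exact ae_iff.2 (by simpa using h)

lemma aestronglyMeasurable_of_continuousOn_ne_zero (hd : 0 < d) {m : Rd d × Rd d → ℂ}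
    (hm : ContinuousOn m {z | z ≠ 0}) : AEStronglyMeasurable m := by
  have h := hm.aestronglyMeasurable (μ := volume) isOpen_ne.measurableSet
  have e : (volume : Measure (Rd d × Rd d)).restrict {z | z ≠ 0} = volume :=
    Measure.restrict_eq_self_of_ae_mem (ae_ne_zero hd)
  rwa [e] at h

lemma IsSymbol.norm_le {A : ℕ → ℝ} {m : Rd d × Rd d → ℂ}
    (hm : IsSymbol A fun w : WithLp 2 (Rd d × Rd d) => m w.ofLp) {z : Rd d × Rd d} (hz : z ≠ 0) :
    ‖m z‖ ≤ A 0 := by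
  have h := hm.bound 0 (WithLp.toLp 2 z) (by simpa using hz)
  simpa using h

/-- The symbol `m` truncated to `2 ^ (-N) ≲ ‖z‖ ≲ 2 ^ N`. -/
def truncSymbol (m : Rd d × Rd d → ℂ) (N : ℕ) (z : Rd d × Rd d) : ℂ :=
  m z * ((dyadicBump (((2 : ℝ) ^ (N : ℤ))⁻¹ • WithLp.toLp 2 z) -
    dyadicBump (((2 : ℝ) ^ (-(N : ℤ) - 1))⁻¹ • WithLp.toLp 2 z) : ℝ) : ℂ)

lemma continuous_toLp_smul (a : ℝ) :
    Continuous fun z : Rd d × Rd d => a • WithLp.toLp 2 z :=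
  (WithLp.prodContinuousLinearEquiv 2 ℝ (Rd d) (Rd d)).symm.continuous.const_smul a

lemma norm_truncSymbol_le (m : Rd d × Rd d → ℂ) (N : ℕ) (z : Rd d × Rd d) :
    ‖truncSymbol m N z‖ ≤ ‖m z‖ := by
  rw [truncSymbol, norm_mul, Complex.norm_real]
  refine mul_le_of_le_one_right (norm_nonneg _) (abs_le.2 ⟨?_, ?_⟩)
  · linarith [dyadicBump.nonneg (x := ((2 : ℝ) ^ (N : ℤ))⁻¹ • WithLp.toLp 2 z),
      dyadicBump.le_one (x := ((2 : ℝ) ^ (-(N : ℤ) - 1))⁻¹ • WithLp.toLp 2 z)]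
  · linarith [dyadicBump.le_one (x := ((2 : ℝ) ^ (N : ℤ))⁻¹ • WithLp.toLp 2 z),
      dyadicBump.nonneg (x := ((2 : ℝ) ^ (-(N : ℤ) - 1))⁻¹ • WithLp.toLp 2 z)]

lemma aestronglyMeasurable_truncSymbol {m : Rd d × Rd d → ℂ} (hm : AEStronglyMeasurable m)
    (N : ℕ) : AEStronglyMeasurable (truncSymbol m N) :=
  hm.mul (Complex.continuous_ofReal.comp ((dyadicBump.continuous.comp
    (continuous_toLp_smul _)).sub (dyadicBump.continuous.comp
    (continuous_toLp_smul _)))).aestronglyMeasurable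

lemma tendsto_truncSymbol (m : Rd d × Rd d → ℂ) {z : Rd d × Rd d} (hz : z ≠ 0) :
    Tendsto (fun N => truncSymbol m N z) atTop (𝓝 (m z)) := by
  set w := WithLp.toLp 2 z with hw
  have hw0 : 0 < ‖w‖ := norm_pos_iff.2 (by simpa [hw] using hz)
  have h1 : Tendsto (fun N : ℕ => dyadicBump (((2 : ℝ) ^ (N : ℤ))⁻¹ • w)) atTop (𝓝 1) := by
    have h0 : Tendsto (fun N : ℕ => ((2 : ℝ) ^ (N : ℤ))⁻¹ • w) atTop (𝓝 ((0 : ℝ) • w)) := by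
      refine Tendsto.smul_const ?_ w
      simp only [zpow_natCast]
      exact (tendsto_pow_atTop_atTop_of_one_lt one_lt_two).inv_tendsto_atTop
    rw [zero_smul] at h0
    have h2 := (dyadicBump.continuous.tendsto (0 : WithLp 2 (Rd d × Rd d))).comp h0
    rwa [bump_eq_one _ (by simpa using dyadicBump.rIn_pos.le)] at h2
  have h2 : Tendsto (fun N : ℕ => dyadicBump (((2 : ℝ) ^ (-(N : ℤ) - 1))⁻¹ • w)) atTop
      (𝓝 0) := by
    refine tendsto_const_nhds.congr' ?_
    have h3 := (tendsto_pow_atTop_atTop_of_one_lt (one_lt_two (α := ℝ))).eventually_ge_atTop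
      (2 / ‖w‖)
    filter_upwards [h3] with N hN
    refine (bump_eq_zero _ ?_).symm
    rw [norm_smul, norm_inv, norm_zpow, Real.norm_two]
    change (2 : ℝ) ≤ _
    rw [← zpow_neg, neg_sub, sub_neg_eq_add, zpow_add₀ two_ne_zero, zpow_natCast, zpow_one]
    rw [div_le_iff₀ hw0] at hN
    linarith [mul_nonneg (pow_nonneg zero_le_two N) hw0.le]
  have h3 := (Complex.continuous_ofReal.tendsto _).comp (h1.sub h2)
  have h4 := h3.const_mul (m z)
  simpa [truncSymbol, Function.comp_def] using h4

lemma sum_dyadicBump_sub (N : ℕ) (w : WithLp 2 (Rd d × Rd d)) :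
    ∑ k ∈ Finset.range (2 * N + 1), (dyadicBump (((2 : ℝ) ^ ((k : ℤ) - N))⁻¹ • w) -
      dyadicBump ((2 : ℝ) • ((2 : ℝ) ^ ((k : ℤ) - N))⁻¹ • w)) =
    dyadicBump (((2 : ℝ) ^ (N : ℤ))⁻¹ • w) -
      dyadicBump (((2 : ℝ) ^ (-(N : ℤ) - 1))⁻¹ • w) := by
  set G : ℕ → ℝ := fun k => dyadicBump (((2 : ℝ) ^ ((k : ℤ) - N - 1))⁻¹ • w) with hG
  have h := Finset.sum_range_sub G (2 * N + 1)
  have e1 : G (2 * N + 1) = dyadicBump (((2 : ℝ) ^ (N : ℤ))⁻¹ • w) := by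
    simp only [hG]
    congr 4
    push_cast
    ring
  have e2 : G 0 = dyadicBump (((2 : ℝ) ^ (-(N : ℤ) - 1))⁻¹ • w) := by
    simp only [hG]
    congr 4
    push_cast
    ring
  rw [e1, e2] at h
  rw [← h]
  refine Finset.sum_congr rfl fun k _ => ?_
  simp only [hG, smul_smul]
  rw [show ((k + 1 : ℕ) : ℤ) - N - 1 = (k : ℤ) - N by push_cast; ring,
    zpow_sub_one₀ two_ne_zero, mul_inv, inv_inv, mul_comm (2 : ℝ)]

lemma truncSymbol_eq_sum {Φ : Fin 3 → WithLp 2 (Rd d × Rd d) → ℂ}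
    (hΦ : ∀ w, ∑ i, Φ i w = ((dyadicBump w - dyadicBump ((2 : ℝ) • w) : ℝ) : ℂ))
    (m : Rd d × Rd d → ℂ) (N : ℕ) (z : Rd d × Rd d) :
    truncSymbol m N z = ∑ t ∈ (Finset.univ : Finset (Fin 3)) ×ˢ
      (Finset.range (2 * N + 1)).image (fun k : ℕ => (k : ℤ) - N),
      m z * Φ t.1 (WithLp.toLp 2 (((2 : ℝ) ^ t.2)⁻¹ • z)) := by
  rw [truncSymbol, ← sum_dyadicBump_sub, ← Finset.mul_sum, Finset.sum_product_right]
  simp only [hΦ, WithLp.toLp_smul]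
  rw [Finset.sum_image fun a _ b _ hab => by simpa using hab, Complex.ofReal_sum]

theorem exists_enorm_integral_truncSymbol_le (hd : 0 < d) {A : ℕ → ℝ} {m : Rd d × Rd d → ℂ}
    (hm : IsSymbol A fun w : WithLp 2 (Rd d × Rd d) => m w.ofLp) (hmeas : AEStronglyMeasurable m)
    {p q r : ℝ} (hp : 1 < p) (hq : 1 < q) (hr : 1 < r) (h : 1 / p + 1 / q + 1 / r = 1) :
    ∃ C : ℝ, 0 ≤ C ∧ ∀ (N : ℕ) (f g : 𝓢(Rd d, ℂ)) (u : Rd d → ℂ), IsKernel u →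
      ‖∫ x, u x * multOp (truncSymbol m N) f g x‖ₑ ≤
      ENNReal.ofReal C * ((∫⁻ x, ‖f x‖ₑ ^ p) ^ (1 / p) * (∫⁻ x, ‖g x‖ₑ ^ q) ^ (1 / q) *
          (∫⁻ x, ‖u x‖ₑ ^ r) ^ (1 / r)) := by
  obtain ⟨Φ, hΦ, hsum⟩ := exists_isLocalised_partition (d := d)
  choose C hC H using fun i => (hΦ i).exists_enorm_sum_le hd hm hp hq hr h
  refine ⟨∑ i, C i, Finset.sum_nonneg fun i _ => hC i, fun N f g u hu => ?_⟩
  set J := (Finset.range (2 * N + 1)).image (fun k : ℕ => (k : ℤ) - N)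
  set τ : Fin 3 × ℤ → Rd d × Rd d → ℂ := fun t z =>
    m z * Φ t.1 (WithLp.toLp 2 (((2 : ℝ) ^ t.2)⁻¹ • z)) with hτ
  have hmeasτ : ∀ t, AEStronglyMeasurable (τ t) := fun t =>
    hmeas.mul ((hΦ t.1).contDiff.continuous.comp (continuous_toLp_smul _)).aestronglyMeasurable
  have hbdd : ∀ t, ∃ M, ∀ᵐ z, ‖τ t z‖ ≤ M := fun t => by
    have hsupp : HasCompactSupport (Φ t.1) := HasCompactSupport.intro (isCompact_closedBall 0 2)
      fun w hw => (hΦ t.1).eq_zero_of_gt w (by simpa using hw)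
    obtain ⟨D, hD⟩ := (hΦ t.1).contDiff.continuous.bounded_above_of_compact_support hsupp
    refine ⟨A 0 * D, ?_⟩
    filter_upwards [ae_ne_zero hd] with z hz
    have h1 := hm.norm_le hz
    rw [hτ, norm_mul]
    exact mul_le_mul h1 (hD _) (norm_nonneg _) ((norm_nonneg _).trans h1)
  have heq : truncSymbol m N = fun z => ∑ t ∈ (Finset.univ : Finset (Fin 3)) ×ˢ J, τ t z :=
    funext fun z => truncSymbol_eq_sum hsum m N z
  rw [heq, integral_mul_multOp_sum _ hmeasτ hbdd f g hu, Finset.sum_product]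
  refine (enorm_sum_le _ _).trans ((Finset.sum_le_sum fun i _ => H i J f g u hu).trans ?_)
  rw [← Finset.sum_mul, ENNReal.ofReal_sum_of_nonneg fun i _ => hC i]

end Truncation

section Duality

open scoped SchwartzMap ComplexConjugate
open Filter Topology

variable {p r : ℝ}

/-- The function `z ↦ conj z * ‖z‖ ^ (p - 2)`, with which `L ^ p` norms are tested. -/
def dualPower (p : ℝ) (z : ℂ) : ℂ := ((‖z‖ ^ (p - 2) : ℝ) : ℂ) * conj z

lemma norm_dualPower (hp : 1 < p) (z : ℂ) : ‖dualPower p z‖ = ‖z‖ ^ (p - 1) := by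
  rw [dualPower, norm_mul, Complex.norm_real, RCLike.norm_conj,
    Real.norm_of_nonneg (Real.rpow_nonneg (norm_nonneg _) _)]
  rcases eq_or_ne z 0 with rfl | hz
  · simp [Real.zero_rpow (sub_pos.2 hp).ne']
  · rw [← Real.rpow_add_one (norm_ne_zero_iff.2 hz)]
    congr 1
    ring

lemma dualPower_mul_self (hp : 1 < p) (z : ℂ) : dualPower p z * z = ((‖z‖ ^ p : ℝ) : ℂ) := by
  rcases eq_or_ne z 0 with rfl | hz
  · simp [Real.zero_rpow (zero_lt_one.trans hp).ne']
  · rw [dualPower, mul_assoc, Complex.conj_mul', ← Complex.ofReal_pow, ← Complex.ofReal_mul,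
      ← Real.rpow_natCast, ← Real.rpow_add (norm_pos_iff.2 hz)]
    congr 2
    push_cast
    ring

lemma continuous_dualPower (hp : 1 < p) : Continuous (dualPower p) := by
  refine continuous_iff_continuousAt.2 fun z => ?_
  rcases eq_or_ne z 0 with rfl | hz
  · have h0 : dualPower p 0 = 0 := by simp [dualPower]
    rw [ContinuousAt, h0, tendsto_zero_iff_norm_tendsto_zero]
    simp only [norm_dualPower hp]
    have h := (continuous_norm (E := ℂ)).rpow_const (p := p - 1)
      (fun _ => Or.inr (sub_pos.2 hp).le)
    simpa [Real.zero_rpow (sub_pos.2 hp).ne'] using h.tendsto 0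
  · refine (Complex.continuous_ofReal.continuousAt.comp ?_).mul Complex.continuous_conj.continuousAt
    exact continuous_norm.continuousAt.rpow_const (Or.inl (norm_ne_zero_iff.2 hz))

/-- An exhausting sequence of bump functions. -/
def exhaustingBump (d n : ℕ) : ContDiffBump (0 : Rd d) where
  rIn := n + 1
  rOut := n + 2
  rIn_pos := by positivity
  rIn_lt_rOut := by linarith

lemma tendsto_exhaustingBump (x : Rd d) :
    Tendsto (fun n => exhaustingBump d n x) atTop (𝓝 1) := by
  refine tendsto_const_nhds.congr' ?_
  obtain ⟨n, hn⟩ := exists_nat_ge ‖x‖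
  filter_upwards [eventually_ge_atTop n] with k hk
  have hk' : (n : ℝ) ≤ k := by exact_mod_cast hk
  refine ((exhaustingBump d k).one_of_mem_closedBall ?_).symm
  rw [mem_closedBall_zero_iff]
  change ‖x‖ ≤ (k : ℝ) + 1
  linarith

lemma isKernel_exhaustingBump (n : ℕ) : IsKernel fun x => (exhaustingBump d n x : ℂ) where
  continuous := Complex.continuous_ofReal.comp (exhaustingBump d n).continuous
  integrable := (exhaustingBump d n).integrable.ofReal
  bounded := ⟨1, fun x => by
    rw [Complex.norm_real, Real.norm_of_nonneg (exhaustingBump d n).nonneg]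
    exact (exhaustingBump d n).le_one⟩

lemma lintegral_mul_bump_le_of_dual (hpr : p.HolderConjugate r) {U : Rd d → ℂ}
    (hU : Continuous U) {M : ℝ} (hM : ∀ x, ‖U x‖ ≤ M) {B : ℝ≥0∞}
    (h : ∀ u : Rd d → ℂ, IsKernel u →
      ‖∫ x, u x * U x‖ₑ ≤ B * (∫⁻ x, ‖u x‖ₑ ^ r) ^ (1 / r)) (n : ℕ) :
    ∫⁻ x, ENNReal.ofReal (‖U x‖ ^ p * exhaustingBump d n x) ≤ B ^ p := by
  have hp := hpr.lt
  have hw0 : ∀ x, 0 ≤ exhaustingBump d n x := fun x => (exhaustingBump d n).nonneg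
  have hnn : ∀ x, 0 ≤ ‖U x‖ ^ p * exhaustingBump d n x := fun x =>
    mul_nonneg (Real.rpow_nonneg (norm_nonneg _) _) (hw0 x)
  have hcont : Continuous fun x => ‖U x‖ ^ p :=
    hU.norm.rpow_const fun _ => Or.inr hpr.nonneg
  have hint : Integrable fun x => ‖U x‖ ^ p * exhaustingBump d n x :=
    (exhaustingBump d n).integrable.bdd_mul (c := M ^ p) hcont.aestronglyMeasurable
      (.of_forall fun x => by
        rw [Real.norm_of_nonneg (Real.rpow_nonneg (norm_nonneg _) _)]
        exact Real.rpow_le_rpow (norm_nonneg _) (hM x) hpr.nonneg)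
  set u : Rd d → ℂ := (fun x => (exhaustingBump d n x : ℂ)) * fun x => dualPower p (U x) with hu
  have huK : IsKernel u := (isKernel_exhaustingBump n).mul_bdd
    ((continuous_dualPower hp).comp hU) (M := M ^ (p - 1)) fun x => by
      rw [norm_dualPower hp]
      exact Real.rpow_le_rpow (norm_nonneg _) (hM x) (sub_pos.2 hp).le
  have hX : ‖∫ x, u x * U x‖ₑ = ∫⁻ x, ENNReal.ofReal (‖U x‖ ^ p * exhaustingBump d n x) := by
    rw [← enorm_integral_ofReal hnn hint]
    congr 2
    funext x
    rw [hu, Pi.mul_apply, mul_assoc, dualPower_mul_self hp, Complex.ofReal_mul, mul_comm]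
  have hle : ∫⁻ x, ‖u x‖ₑ ^ r ≤ ∫⁻ x, ENNReal.ofReal (‖U x‖ ^ p * exhaustingBump d n x) := by
    refine lintegral_mono fun x => ?_
    rw [← ofReal_norm, ENNReal.ofReal_rpow_of_nonneg (norm_nonneg _) hpr.symm.nonneg]
    refine ENNReal.ofReal_le_ofReal ?_
    rw [hu, Pi.mul_apply, norm_mul, norm_dualPower hp, Complex.norm_real,
      Real.norm_of_nonneg (hw0 x), Real.mul_rpow (hw0 x) (Real.rpow_nonneg (norm_nonneg _) _),
      ← Real.rpow_mul (norm_nonneg _), hpr.sub_one_mul_conj, mul_comm]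
    refine mul_le_mul_of_nonneg_left ?_ (Real.rpow_nonneg (norm_nonneg _) _)
    exact Real.rpow_le_self_of_le_one (hw0 x) (exhaustingBump d n).le_one hpr.symm.lt.le
  refine le_rpow_of_le_mul_rpow hpr ?_ ?_
  · rw [← hX]
    exact enorm_ne_top
  · rw [← hX]
    refine (h u huK).trans ?_
    rw [hX]
    gcongr
    exact one_div_nonneg.2 hpr.symm.nonneg

/-- A continuous bounded function whose pairings with test functions are controlled by their
`L ^ r` norms lies in the dual space `L ^ p`. -/
theorem lintegral_rpow_le_of_dual (hpr : p.HolderConjugate r) {U : Rd d → ℂ}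
    (hU : Continuous U) {M : ℝ} (hM : ∀ x, ‖U x‖ ≤ M) {B : ℝ≥0∞}
    (h : ∀ u : Rd d → ℂ, IsKernel u →
      ‖∫ x, u x * U x‖ₑ ≤ B * (∫⁻ x, ‖u x‖ₑ ^ r) ^ (1 / r)) :
    ∫⁻ x, ‖U x‖ₑ ^ p ≤ B ^ p := by
  have hlim : ∀ x, Tendsto (fun n => ENNReal.ofReal (‖U x‖ ^ p * exhaustingBump d n x)) atTop
      (𝓝 (‖U x‖ₑ ^ p)) := fun x => by
    have h1 := ENNReal.tendsto_ofReal ((tendsto_exhaustingBump x).const_mul (‖U x‖ ^ p))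
    rwa [mul_one, ← ENNReal.ofReal_rpow_of_nonneg (norm_nonneg _) hpr.nonneg, ofReal_norm] at h1
  calc ∫⁻ x, ‖U x‖ₑ ^ p
      = ∫⁻ x, liminf (fun n => ENNReal.ofReal (‖U x‖ ^ p * exhaustingBump d n x)) atTop :=
        lintegral_congr fun x => (hlim x).liminf_eq.symm
    _ ≤ liminf (fun n => ∫⁻ x, ENNReal.ofReal (‖U x‖ ^ p * exhaustingBump d n x)) atTop := by
        refine lintegral_liminf_le fun n => ?_
        exact ((hU.norm.rpow_const fun _ => Or.inr hpr.nonneg).mul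
          (exhaustingBump d n).continuous).measurable.ennreal_ofReal
    _ ≤ B ^ p := by
        refine liminf_le_of_frequently_le' (Frequently.of_forall fun n => ?_)
        exact lintegral_mul_bump_le_of_dual hpr hU hM h n

lemma tendsto_multOp_truncSymbol (hd : 0 < d) {m : Rd d × Rd d → ℂ}
    (hmeas : AEStronglyMeasurable m) {M : ℝ} (hM : ∀ᵐ z, ‖m z‖ ≤ M) (f g : 𝓢(Rd d, ℂ))
    (x : Rd d) :
    Tendsto (fun N => multOp (truncSymbol m N) f g x) atTop (𝓝 (multOp m f g x)) := by
  refine tendsto_integral_of_dominated_convergence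
    (fun z => ‖expChar (inner ℝ (z.1 + z.2) x) * m z * (𝓕 f z.1 * 𝓕 g z.2)‖) (fun N => ?_)
    (integrable_multOp hmeas hM f g x).norm (fun N => .of_forall fun z => ?_) ?_
  · exact (integrable_multOp (aestronglyMeasurable_truncSymbol hmeas N)
      (hM.mono fun z hz => (norm_truncSymbol_le m N z).trans hz) f g x).1
  · simp only [norm_mul]
    gcongr
    exact norm_truncSymbol_le m N z
  · filter_upwards [ae_ne_zero hd] with z hz
    exact ((tendsto_truncSymbol m hz).const_mul _).mul_const _

theorem exists_lintegral_multOp_le (hd : 0 < d) {A : ℕ → ℝ} {m : Rd d × Rd d → ℂ}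
    (hm : IsSymbol A fun w : WithLp 2 (Rd d × Rd d) => m w.ofLp) (hmeas : AEStronglyMeasurable m)
    {q₁ q₂ : ℝ} (hq₁ : 1 < q₁) (hq₂ : 1 < q₂) (hpr : p.HolderConjugate r)
    (h : 1 / q₁ + 1 / q₂ + 1 / r = 1) :
    ∃ C : ℝ, 0 ≤ C ∧ ∀ f g : 𝓢(Rd d, ℂ), ∫⁻ x, ‖multOp m f g x‖ₑ ^ p ≤
      (ENNReal.ofReal C * ((∫⁻ x, ‖f x‖ₑ ^ q₁) ^ (1 / q₁) *
        (∫⁻ x, ‖g x‖ₑ ^ q₂) ^ (1 / q₂))) ^ p := by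
  obtain ⟨C, hC, H⟩ := exists_enorm_integral_truncSymbol_le hd hm hmeas hq₁ hq₂ hpr.symm.lt h
  refine ⟨C, hC, fun f g => ?_⟩
  have hM : ∀ᵐ z, ‖m z‖ ≤ A 0 := (ae_ne_zero hd).mono fun z hz => hm.norm_le hz
  have hMN : ∀ N, ∀ᵐ z, ‖truncSymbol m N z‖ ≤ A 0 := fun N =>
    hM.mono fun z hz => (norm_truncSymbol_le m N z).trans hz
  have hcont : ∀ N, Continuous (multOp (truncSymbol m N) f g) := fun N =>
    continuous_multOp (aestronglyMeasurable_truncSymbol hmeas N) (hMN N) f g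
  calc ∫⁻ x, ‖multOp m f g x‖ₑ ^ p
      = ∫⁻ x, liminf (fun N => ‖multOp (truncSymbol m N) f g x‖ₑ ^ p) atTop :=
        lintegral_congr fun x => (((ENNReal.continuous_rpow_const.tendsto _).comp
          ((continuous_enorm.tendsto _).comp
            (tendsto_multOp_truncSymbol hd hmeas hM f g x))).liminf_eq).symm
    _ ≤ liminf (fun N => ∫⁻ x, ‖multOp (truncSymbol m N) f g x‖ₑ ^ p) atTop :=
        lintegral_liminf_le fun N => (hcont N).enorm.measurable.pow_const _
    _ ≤ _ := by
        refine liminf_le_of_frequently_le' (Frequently.of_forall fun N => ?_)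
        refine lintegral_rpow_le_of_dual hpr (hcont N) (norm_multOp_le (hMN N) f g) fun u hu => ?_
        rw [mul_assoc]
        exact H N f g u hu

end Duality

section Representation

open scoped SchwartzMap

lemma measurePreserving_shear :
    MeasurePreserving fun z : Rd d × Rd d => (z.1 - z.2, z.2) :=
  measurePreserving_sub_prod (volume : Measure (Rd d)) (volume : Measure (Rd d))

/-- The bilinear operator of the statement is the multiplier operator with symbol `m`. -/
theorem fourierInv_integral_eq_multOp {m : Rd d × Rd d → ℂ} (hmeas : AEStronglyMeasurable m)
    {M : ℝ} (hM : ∀ᵐ z, ‖m z‖ ≤ M) (f g : 𝓢(Rd d, ℂ)) (x : Rd d) :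
    𝓕⁻ (fun ξ => ∫ η, m (ξ - η, η) * 𝓕 (⇑f) (ξ - η) * 𝓕 (⇑g) η) x = multOp m f g x := by
  set F : Rd d × Rd d → ℂ := fun z =>
    expChar (inner ℝ (z.1 + z.2) x) * m z * (𝓕 f z.1 * 𝓕 g z.2) with hF
  have hint : Integrable F := integrable_multOp hmeas hM f g x
  have hshear := measurePreserving_shear (d := d)
  have hintS : Integrable fun z : Rd d × Rd d => F (z.1 - z.2, z.2) :=
    hshear.integrable_comp_of_integrable hint
  have hval : ∀ ξ η : Rd d, F (ξ - η, η) =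
      expChar (inner ℝ ξ x) * (m (ξ - η, η) * 𝓕 (⇑f) (ξ - η) * 𝓕 (⇑g) η) := fun ξ η => by
    simp only [hF, sub_add_cancel, SchwartzMap.fourier_coe]
    ring
  rw [fourierInv_eq_integral_expChar]
  calc ∫ ξ, expChar (inner ℝ ξ x) * ∫ η, m (ξ - η, η) * 𝓕 (⇑f) (ξ - η) * 𝓕 (⇑g) η
      = ∫ ξ, ∫ η, F (ξ - η, η) := by
        simp only [hval, integral_const_mul]
    _ = ∫ η, ∫ ξ, F (ξ - η, η) := integral_integral_swap hintS
    _ = ∫ η, ∫ ξ, F (ξ, η) := by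
        congr 1
        funext η
        exact integral_sub_right_eq_self (fun ξ => F (ξ, η)) η
    _ = ∫ ξ, ∫ η, F (ξ, η) := (integral_integral_swap hint).symm
    _ = multOp m f g x := integral_integral hint

end Representation

end CoifmanMeyer

/-- Coifman–Meyer bilinear multiplier theorem: if `m` is smooth away from the origin of
`ℝ^d × ℝ^d` with `|∂^α m(ξ,η)| ≤ C_α (|ξ|+|η|)^{-|α|}` for all orders `α`, then
`T(f,g) = ℱ⁻¹[∫ m(ξ-η,η) f̂(ξ-η) ĝ(η) dη]` maps `L^{p₁} × L^{p₂} → L^p` for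
`1 < p, p₁, p₂ < ∞` with `1/p = 1/p₁ + 1/p₂`. -/
theorem stmt10 (d : ℕ) (hd : 0 < d) (p p₁ p₂ : ℝ)
    (hp : 1 < p) (hp1 : 1 < p₁) (hp2 : 1 < p₂)
    (hrel : 1 / p = 1 / p₁ + 1 / p₂)
    (m : EuclideanSpace ℝ (Fin d) × EuclideanSpace ℝ (Fin d) → ℂ)
    (hsmooth : ContDiffOn ℝ (⊤ : ℕ∞) m {z | z ≠ 0})
    (hbound : ∀ n : ℕ, ∃ Cn : ℝ,
      ∀ z : EuclideanSpace ℝ (Fin d) × EuclideanSpace ℝ (Fin d), z ≠ 0 →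
        ‖iteratedFDerivWithin ℝ n m {z | z ≠ 0} z‖ ≤ Cn * (‖z.1‖ + ‖z.2‖) ^ (-(n:ℝ))) :
    ∃ C : ℝ, 0 < C ∧
      ∀ f g : SchwartzMap (EuclideanSpace ℝ (Fin d)) ℂ,
        eLpNorm
            (fun x => 𝓕⁻ (fun ξ => ∫ η, m (ξ - η, η) * 𝓕 (⇑f) (ξ - η) * 𝓕 (⇑g) η) x)
            (ENNReal.ofReal p) volume
          ≤ ENNReal.ofReal C * eLpNorm (⇑f) (ENNReal.ofReal p₁) volume *
              eLpNorm (⇑g) (ENNReal.ofReal p₂) volume := by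
  obtain ⟨A, hA⟩ := CoifmanMeyer.exists_isSymbol hsmooth hbound
  have hmeas := CoifmanMeyer.aestronglyMeasurable_of_continuousOn_ne_zero hd hsmooth.continuousOn
  have hM : ∀ᵐ z, ‖m z‖ ≤ A 0 :=
    (CoifmanMeyer.ae_ne_zero hd).mono fun z hz => hA.norm_le hz
  have hpr : p.HolderConjugate p.conjExponent := Real.HolderConjugate.conjExponent hp
  have hsum : 1 / p₁ + 1 / p₂ + 1 / p.conjExponent = 1 := by
    rw [← hrel]
    simpa using hpr.inv_add_inv_eq_one
  obtain ⟨C, hC, H⟩ := CoifmanMeyer.exists_lintegral_multOp_le hd hA hmeas hp1 hp2 hpr hsum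
  refine ⟨C + 1, by positivity, fun f g => ?_⟩
  simp only [CoifmanMeyer.fourierInv_integral_eq_multOp hmeas hM f g]
  have h0 : 0 < p := zero_lt_one.trans hp
  have h1 : 0 < p₁ := zero_lt_one.trans hp1
  have h2 : 0 < p₂ := zero_lt_one.trans hp2
  have key := H f g
  rw [← CoifmanMeyer.eLpNorm_rpow_eq_lintegral h0, ← CoifmanMeyer.eLpNorm_rpow_eq_lintegral h1,
    ← CoifmanMeyer.eLpNorm_rpow_eq_lintegral h2, one_div, one_div, ENNReal.rpow_rpow_inv h1.ne',
    ENNReal.rpow_rpow_inv h2.ne', ENNReal.rpow_le_rpow_iff h0] at key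
  refine key.trans ?_
  rw [mul_assoc]
  gcongr
  linarith
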